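/- arXiv:1205.3234 — 3 statements merged into one kernel-verified Lean document; each statement's English description precedes it below -/
import Mathlib

section
/- Let M ≥ 2 be an integer and 0 < b* < 1. For a ∈ [0,1] and b_1, b_2 ∈ [0,1], the identity a·f(m|b_1) + (1−a)·f(m|b_2) = f(m|b*) holds for every m ∈ {0,1,…,M} if and only if (a = 1 and b_1 = b*) or (b_1 = b_2 = b*) or (a = 0 and b_2 = b*). In other words, the true parameter set of the two-component binomial mixture with a one-component truth decomposes as W_X^t = W_1^t ∪ W_2^t ∪ W_3^t with W_1^t = {a=1, b_1=b*}, W_2^t = {b_1=b_2=b*}, W_3^t = {a=0, b_2=b*}. -/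
/-- The binomial probability mass function `f(m|b) = C(M,m) b^m (1-b)^(M-m)`. -/
noncomputable def binomialPMF (M : ℕ) (b : ℝ) (m : ℕ) : ℝ :=
  (M.choose m : ℝ) * b ^ m * (1 - b) ^ (M - m)

theorem binomialPMF_eq_eval_bernsteinPolynomial (M : ℕ) (b : ℝ) (m : ℕ) :
    binomialPMF M b m = (bernsteinPolynomial ℝ M m).eval b := by
  simp [binomialPMF, bernsteinPolynomial]

theorem sum_mul_binomialPMF (M : ℕ) (b : ℝ) :
    ∑ m ∈ Finset.range (M + 1), (m : ℝ) * binomialPMF M b m = M * b := by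
  simpa [Polynomial.eval_finsetSum, binomialPMF_eq_eval_bernsteinPolynomial] using
    congrArg (Polynomial.eval b) (bernsteinPolynomial.sum_smul ℝ M)

/-- The second factorial moment of the binomial distribution. -/
theorem sum_mul_pred_mul_binomialPMF (M : ℕ) (b : ℝ) :
    ∑ m ∈ Finset.range (M + 1), ((m * (m - 1) : ℕ) : ℝ) * binomialPMF M b m =
      ((M * (M - 1) : ℕ) : ℝ) * b ^ 2 := by
  simpa [Polynomial.eval_finsetSum, binomialPMF_eq_eval_bernsteinPolynomial] using
    congrArg (Polynomial.eval b) (bernsteinPolynomial.sum_mul_smul ℝ M)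

/-- A mixture identity between mass functions passes to weighted sums. -/
theorem sum_mul_binomialPMF_mixture {M : ℕ} {a b₁ b₂ b : ℝ}
    (h : ∀ m : ℕ, m ≤ M →
      a * binomialPMF M b₁ m + (1 - a) * binomialPMF M b₂ m = binomialPMF M b m)
    (g : ℕ → ℝ) :
    a * ∑ m ∈ Finset.range (M + 1), g m * binomialPMF M b₁ m +
        (1 - a) * ∑ m ∈ Finset.range (M + 1), g m * binomialPMF M b₂ m =
      ∑ m ∈ Finset.range (M + 1), g m * binomialPMF M b m := by
  rw [Finset.mul_sum, Finset.mul_sum, ← Finset.sum_add_distrib]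
  refine Finset.sum_congr rfl fun m hm => ?_
  rw [← h m (Nat.lt_succ_iff.mp (Finset.mem_range.mp hm))]
  ring

/-- the true parameter set of the two-component binomial mixture with a
one-component truth decomposes as `W_X^t = W_1^t ∪ W_2^t ∪ W_3^t`. -/
theorem binomial_mixture_true_parameter_set (M : ℕ) (hM : 2 ≤ M)
    (bstar : ℝ) (hbstar : bstar ∈ Set.Ioo (0 : ℝ) 1)
    (a b₁ b₂ : ℝ) (ha : a ∈ Set.Icc (0 : ℝ) 1)
    (hb₁ : b₁ ∈ Set.Icc (0 : ℝ) 1) (hb₂ : b₂ ∈ Set.Icc (0 : ℝ) 1) :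
    (∀ m : ℕ, m ≤ M →
        a * binomialPMF M b₁ m + (1 - a) * binomialPMF M b₂ m = binomialPMF M bstar m)
      ↔ ((a = 1 ∧ b₁ = bstar) ∨ (b₁ = bstar ∧ b₂ = bstar) ∨ (a = 0 ∧ b₂ = bstar)) := by
  constructor
  · intro h
    have mean := sum_mul_binomialPMF_mixture h fun m => (m : ℝ)
    have second := sum_mul_binomialPMF_mixture h fun m => ((m * (m - 1) : ℕ) : ℝ)
    simp only [sum_mul_binomialPMF] at mean
    simp only [sum_mul_pred_mul_binomialPMF] at second
    have hM₀ : (M : ℝ) ≠ 0 := by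
      exact_mod_cast (by omega : M ≠ 0)
    have hM₁ : ((M * (M - 1) : ℕ) : ℝ) ≠ 0 := by
      exact_mod_cast Nat.mul_ne_zero (by omega) (by omega)
    replace mean : a * b₁ + (1 - a) * b₂ = bstar :=
      mul_left_cancel₀ hM₀ (by linear_combination mean)
    replace second : a * b₁ ^ 2 + (1 - a) * b₂ ^ 2 = bstar ^ 2 :=
      mul_left_cancel₀ hM₁ (by linear_combination second)
    have spread : a * ((1 - a) * (b₁ - b₂) ^ 2) = 0 := by
      rw [← mean] at second
      linear_combination second
    rcases mul_eq_zero.mp spread with ha₀ | spread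
    · subst ha₀
      exact Or.inr (Or.inr ⟨rfl, by linarith⟩)
    rcases mul_eq_zero.mp spread with ha₁ | hb
    · obtain rfl : a = 1 := by linarith
      exact Or.inl ⟨rfl, by linarith⟩
    · obtain rfl : b₁ = b₂ := sub_eq_zero.mp (pow_eq_zero_iff two_ne_zero |>.mp hb)
      have : b₁ = bstar := by linear_combination mean
      exact Or.inr (Or.inl ⟨this, this⟩)
  · rintro (⟨rfl, rfl⟩ | ⟨rfl, rfl⟩ | ⟨rfl, rfl⟩) m _ <;> ring
end

section
/- Define, for each integer j ≥ 1, c_j = (1/j) ∫_ℝ (1 − e^{2x−2})^j (2π)^{−1/2} e^{−x²/2} dx. Then limsup_{j→∞} |c_j|^{1/j} = ∞ (equivalently, for every r > 0 the sequence |c_j| r^j is unbounded), so the power series Σ_{j≥1} c_j a^j has radius of convergence zero. Consequently, the function H_X(a) = −∫_ℝ (2π)^{−1/2} e^{−x²/2} ln(1 + a(e^{2x−2} − 1)) dx, which is well defined for a ∈ [0,1], admits no representation H_X(a) = Σ_{j≥0} γ_j a^j by a power series with positive radius of convergence valid on any interval [0,δ) with δ > 0; in particular H_X is not real-analytic at a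 = 0. -/
open MeasureTheory

/-- The Taylor remainder of `-log (1 - u)` at `0` is uniformly controlled on `(-∞, 1/2]`. -/
lemma abs_sum_add_log_one_sub_le (N : ℕ) {u : ℝ} (hu : u ≤ 1 / 2) :
    |(∑ j ∈ Finset.range N, u ^ (j + 1) / (j + 1)) + Real.log (1 - u)| ≤ 2 * |u| ^ (N + 1) := by
  have hderiv : ∀ t ∈ Set.uIcc 0 u, HasDerivWithinAt
      (fun t : ℝ => (∑ j ∈ Finset.range N, t ^ (j + 1) / (j + 1)) + Real.log (1 - t))
      (-t ^ N / (1 - t)) (Set.uIcc 0 u) t := by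
    intro t ht
    have ht2 : t ≤ 1 / 2 := ht.2.trans (max_le (by norm_num) hu)
    have hpos : 0 < 1 - t := by linarith
    have hsum : HasDerivAt (fun t : ℝ => ∑ j ∈ Finset.range N, t ^ (j + 1) / ((j : ℝ) + 1))
        (∑ j ∈ Finset.range N, t ^ j) t := by
      refine HasDerivAt.fun_sum fun j _ => ?_
      have hj : (j : ℝ) + 1 ≠ 0 := by positivity
      refine ((hasDerivAt_pow (j + 1) t).div_const ((j : ℝ) + 1)).congr_deriv ?_
      push_cast
      rw [mul_div_cancel_left₀ _ hj]
    have hlog : HasDerivAt (fun t : ℝ => Real.log (1 - t)) (-1 / (1 - t)) t :=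
      ((hasDerivAt_id t).const_sub 1).log hpos.ne'
    refine ((hsum.add hlog).congr_deriv ?_).hasDerivWithinAt
    rw [eq_div_iff hpos.ne', add_mul, div_mul_cancel₀ _ hpos.ne']
    linarith [geom_sum_mul t N]
  have hbound : ∀ t ∈ Set.uIcc 0 u, ‖-t ^ N / (1 - t)‖ ≤ 2 * |u| ^ N := by
    intro t ht
    have ht2 : t ≤ 1 / 2 := ht.2.trans (max_le (by norm_num) hu)
    have habs : |t| ≤ |u| := by
      simpa using Set.abs_sub_left_of_mem_uIcc ht
    have hpos : 0 < 1 - t := by linarith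
    rw [norm_div, norm_neg, norm_pow, Real.norm_eq_abs, Real.norm_eq_abs, abs_of_pos hpos,
      div_le_iff₀ hpos]
    have hpow : |t| ^ N ≤ |u| ^ N := pow_le_pow_left₀ (abs_nonneg t) habs N
    have hnn : 0 ≤ |u| ^ N := by positivity
    nlinarith
  have h := (convex_uIcc (0 : ℝ) u).norm_image_sub_le_of_norm_hasDerivWithin_le hderiv hbound
    Set.left_mem_uIcc Set.right_mem_uIcc
  simpa [pow_succ, mul_assoc] using h

lemma integrable_exp_mul_mul_exp_neg_sq_div_two (k : ℝ) :
    Integrable fun x : ℝ => Real.exp (k * x) * Real.exp (-x ^ 2 / 2) := by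
  have h := ((integrable_exp_neg_mul_sq (b := 1 / 2) (by norm_num)).comp_sub_right k).const_mul
    (Real.exp (k ^ 2 / 2))
  refine h.congr (.of_forall fun x => ?_)
  simp only [← Real.exp_add]
  ring_nf

lemma integrable_one_sub_exp_pow_mul_exp_mul_exp_neg_sq_div_two (j : ℕ) (k : ℝ) :
    Integrable fun x : ℝ =>
      (1 - Real.exp (2 * x - 2)) ^ j * (Real.exp (k * x) * Real.exp (-x ^ 2 / 2)) := by
  induction j generalizing k with
  | zero => simpa using integrable_exp_mul_mul_exp_neg_sq_div_two k
  | succ j ih =>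
    refine ((ih k).sub ((ih (k + 2)).const_mul (Real.exp (-2)))).congr (.of_forall fun x => ?_)
    have h1 : Real.exp (2 * x - 2) = Real.exp (2 * x) * Real.exp (-2) := by
      rw [← Real.exp_add]; ring_nf
    have h2 : Real.exp ((k + 2) * x) = Real.exp (k * x) * Real.exp (2 * x) := by
      rw [← Real.exp_add]; ring_nf
    simp only [Pi.sub_apply, h1, h2]
    ring

lemma integrable_one_sub_exp_pow_mul_gaussian (j : ℕ) (K : ℝ) :
    Integrable fun x : ℝ =>
      (1 - Real.exp (2 * x - 2)) ^ j * (K * Real.exp (-x ^ 2 / 2)) := by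
  refine ((integrable_one_sub_exp_pow_mul_exp_mul_exp_neg_sq_div_two j 0).const_mul K).congr
    (.of_forall fun x => ?_)
  simp only [zero_mul, Real.exp_zero]
  ring

/-- Even moments of `1 - exp (2 x - 2)` under a Gaussian weight grow at least like
`exp (j ^ 2 / 2 - j - 1 / 2)`. -/
lemma mul_exp_le_integral_one_sub_exp_pow {j : ℕ} (hj : 3 ≤ j) (hev : Even j) {K : ℝ}
    (hK : 0 ≤ K) :
    K * Real.exp ((j : ℝ) ^ 2 / 2 - j - 1 / 2) ≤
      ∫ x : ℝ, (1 - Real.exp (2 * x - 2)) ^ j * (K * Real.exp (-x ^ 2 / 2)) := by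
  have hint := integrable_one_sub_exp_pow_mul_gaussian j K
  have hj' : (3 : ℝ) ≤ j := by exact_mod_cast hj
  have hpoint : ∀ x ∈ Set.Icc (j : ℝ) (j + 1), K * Real.exp ((j : ℝ) ^ 2 / 2 - j - 1 / 2) ≤
      (1 - Real.exp (2 * x - 2)) ^ j * (K * Real.exp (-x ^ 2 / 2)) := by
    rintro x ⟨hx1, hx2⟩
    have hbase : Real.exp j ≤ Real.exp (2 * x - 2) - 1 := by
      have h1 : Real.exp (j + 1) ≤ Real.exp (2 * x - 2) := Real.exp_le_exp.2 (by linarith)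
      have h2 : (2 : ℝ) ≤ Real.exp 1 := by linarith [Real.add_one_le_exp (1 : ℝ)]
      have h3 : (1 : ℝ) ≤ Real.exp j := Real.one_le_exp (by linarith)
      rw [Real.exp_add] at h1
      nlinarith
    have hpow : Real.exp ((j : ℝ) ^ 2) ≤ (1 - Real.exp (2 * x - 2)) ^ j := by
      rw [← hev.neg_pow, neg_sub, sq, Real.exp_nat_mul]
      exact pow_le_pow_left₀ (Real.exp_pos _).le hbase j
    have hgauss : Real.exp (-((j : ℝ) + 1) ^ 2 / 2) ≤ Real.exp (-x ^ 2 / 2) :=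
      Real.exp_le_exp.2 (by nlinarith)
    calc K * Real.exp ((j : ℝ) ^ 2 / 2 - j - 1 / 2)
        = Real.exp ((j : ℝ) ^ 2) * (K * Real.exp (-((j : ℝ) + 1) ^ 2 / 2)) := by
          rw [mul_left_comm, ← Real.exp_add]; ring_nf
      _ ≤ _ := by gcongr; exact (Real.exp_pos _).le.trans hpow
  calc K * Real.exp ((j : ℝ) ^ 2 / 2 - j - 1 / 2)
      = ∫ _x in Set.Icc (j : ℝ) (j + 1), K * Real.exp ((j : ℝ) ^ 2 / 2 - j - 1 / 2) := by
        simp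
    _ ≤ ∫ x in Set.Icc (j : ℝ) (j + 1),
          (1 - Real.exp (2 * x - 2)) ^ j * (K * Real.exp (-x ^ 2 / 2)) :=
        setIntegral_mono_on (integrableOn_const (by simp)) hint.integrableOn measurableSet_Icc hpoint
    _ ≤ _ := setIntegral_le_integral hint (.of_forall fun x =>
        mul_nonneg (hev.pow_nonneg _) (by positivity))

/-- The Taylor coefficients at `0` of the Gaussian mixture divergence grow faster than any
geometric sequence. -/
lemma not_bddAbove_range_abs_mul_pow {K : ℝ} (hK : 0 < K) {c : ℕ → ℝ}
    (hc : ∀ j : ℕ, 1 ≤ j → c j = (1 / (j : ℝ)) *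
      ∫ x : ℝ, (1 - Real.exp (2 * x - 2)) ^ j * (K * Real.exp (-x ^ 2 / 2)))
    {r : ℝ} (hr : 0 < r) : ¬ BddAbove (Set.range fun j : ℕ => |c j| * r ^ j) := by
  rintro ⟨M, hM⟩
  obtain ⟨m, hm⟩ := exists_nat_gt (max (M / K) (max (3 - Real.log r) 2))
  obtain ⟨hm1, hm2, hm3⟩ : M / K < m ∧ 3 - Real.log r < m ∧ (2 : ℝ) < m := by
    simpa [max_lt_iff] using hm
  have hm3' : 2 < m := by exact_mod_cast hm3
  have hle : |c (2 * m)| * r ^ (2 * m) ≤ M := hM ⟨2 * m, rfl⟩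
  have hmom := mul_exp_le_integral_one_sub_exp_pow (j := 2 * m) (by omega) (even_two_mul m) hK.le
  have hinv : Real.exp (-(2 * m : ℝ)) ≤ 1 / ((2 * m : ℕ) : ℝ) := by
    rw [Real.exp_neg, ← one_div]
    push_cast
    exact one_div_le_one_div_of_le (by linarith) (by linarith [Real.add_one_le_exp (2 * m : ℝ)])
  have hrpow : r ^ (2 * m) = Real.exp (2 * m * Real.log r) := by
    rw [← Real.exp_log (pow_pos hr (2 * m)), Real.log_pow]
    push_cast
    rfl
  have hcoef : Real.exp (-(2 * m : ℝ)) * (K * Real.exp (((2 * m : ℕ) : ℝ) ^ 2 / 2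
      - (2 * m : ℕ) - 1 / 2)) ≤ |c (2 * m)| := by
    rw [hc (2 * m) (by omega)]
    refine le_trans ?_ (le_abs_self _)
    gcongr
  have hlower : K * Real.exp m ≤ |c (2 * m)| * r ^ (2 * m) := by
    calc K * Real.exp m
        ≤ K * Real.exp (-(2 * m : ℝ) + (((2 * m : ℕ) : ℝ) ^ 2 / 2 - (2 * m : ℕ) - 1 / 2)
            + 2 * m * Real.log r) := by
          gcongr
          push_cast
          nlinarith
      _ = Real.exp (-(2 * m : ℝ)) * (K * Real.exp (((2 * m : ℕ) : ℝ) ^ 2 / 2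
            - (2 * m : ℕ) - 1 / 2)) * r ^ (2 * m) := by
          rw [hrpow, Real.exp_add, Real.exp_add]; ring
      _ ≤ _ := by gcongr
  rw [div_lt_iff₀ hK] at hm1
  nlinarith [Real.add_one_le_exp (m : ℝ)]

/-- The Gaussian integral of `log (1 + a (exp (2 x - 2) - 1))` has an asymptotic expansion as
`a → 0⁺` whose coefficients are the moments of `1 - exp (2 x - 2)`. -/
lemma exists_abs_integral_log_add_sum_le {K : ℝ} (hK : 0 ≤ K) (N : ℕ) :
    ∃ C : ℝ, ∀ a ∈ Set.Icc (0 : ℝ) (1 / 2),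
      |(-∫ x : ℝ, K * Real.exp (-x ^ 2 / 2) * Real.log (1 + a * (Real.exp (2 * x - 2) - 1)))
        - ∑ j ∈ Finset.range N, (1 / ((j : ℝ) + 1) *
          ∫ x : ℝ, (1 - Real.exp (2 * x - 2)) ^ (j + 1) * (K * Real.exp (-x ^ 2 / 2)))
            * a ^ (j + 1)| ≤ C * a ^ (N + 1) := by
  have hmaj : ∀ n : ℕ, Integrable fun x : ℝ =>
      |1 - Real.exp (2 * x - 2)| ^ n * (K * Real.exp (-x ^ 2 / 2)) := fun n => by
    refine (integrable_one_sub_exp_pow_mul_gaussian n K).abs.congr (.of_forall fun x => ?_)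
    have h : 0 ≤ K * Real.exp (-x ^ 2 / 2) := by positivity
    simp only [abs_mul _ (K * Real.exp (-x ^ 2 / 2)), abs_pow, abs_of_nonneg h]
  refine ⟨2 * ∫ x : ℝ, |1 - Real.exp (2 * x - 2)| ^ (N + 1) * (K * Real.exp (-x ^ 2 / 2)), ?_⟩
  rintro a ⟨ha0, ha⟩
  have hrem : ∀ (n : ℕ) (x : ℝ), |(∑ j ∈ Finset.range n,
      (a * (1 - Real.exp (2 * x - 2))) ^ (j + 1) / (j + 1))
        + Real.log (1 + a * (Real.exp (2 * x - 2) - 1))| ≤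
      2 * a ^ (n + 1) * |1 - Real.exp (2 * x - 2)| ^ (n + 1) := fun n x => by
    have hu : a * (1 - Real.exp (2 * x - 2)) ≤ 1 / 2 := by
      nlinarith [mul_nonneg ha0 (Real.exp_pos (2 * x - 2)).le]
    have h := abs_sum_add_log_one_sub_le n hu
    rw [abs_mul, abs_of_nonneg ha0, mul_pow, ← mul_assoc] at h
    rwa [show 1 - a * (1 - Real.exp (2 * x - 2)) = 1 + a * (Real.exp (2 * x - 2) - 1) by ring] at h
  have hlog : Integrable fun x : ℝ =>
      K * Real.exp (-x ^ 2 / 2) * Real.log (1 + a * (Real.exp (2 * x - 2) - 1)) := by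
    refine ((hmaj 1).const_mul (2 * a)).mono' (by fun_prop) (.of_forall fun x => ?_)
    have h := hrem 0 x
    have hg : 0 ≤ K * Real.exp (-x ^ 2 / 2) := by positivity
    rw [norm_mul, Real.norm_eq_abs, Real.norm_eq_abs, abs_of_nonneg hg]
    simp only [Finset.range_zero, Finset.sum_empty, zero_add, pow_one] at h ⊢
    nlinarith [mul_le_mul_of_nonneg_left h hg]
  have hterm : ∀ j ∈ Finset.range N, Integrable fun x : ℝ => (1 / ((j : ℝ) + 1) * a ^ (j + 1)) *
      ((1 - Real.exp (2 * x - 2)) ^ (j + 1) * (K * Real.exp (-x ^ 2 / 2))) := fun j _ =>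
    (integrable_one_sub_exp_pow_mul_gaussian (j + 1) K).const_mul _
  have hsum : ∑ j ∈ Finset.range N, (1 / ((j : ℝ) + 1) *
      ∫ x : ℝ, (1 - Real.exp (2 * x - 2)) ^ (j + 1) * (K * Real.exp (-x ^ 2 / 2))) * a ^ (j + 1)
      = ∫ x : ℝ, ∑ j ∈ Finset.range N, (1 / ((j : ℝ) + 1) * a ^ (j + 1)) *
        ((1 - Real.exp (2 * x - 2)) ^ (j + 1) * (K * Real.exp (-x ^ 2 / 2))) := by
    rw [integral_finsetSum _ hterm]
    refine Finset.sum_congr rfl fun j _ => ?_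
    rw [integral_const_mul]
    ring
  rw [hsum, ← integral_neg, ← integral_sub hlog.fun_neg (integrable_finsetSum _ hterm)]
  have hmajN : 2 * (∫ x : ℝ, |1 - Real.exp (2 * x - 2)| ^ (N + 1) * (K * Real.exp (-x ^ 2 / 2)))
      * a ^ (N + 1) = ∫ x : ℝ, (2 * a ^ (N + 1)) *
        (|1 - Real.exp (2 * x - 2)| ^ (N + 1) * (K * Real.exp (-x ^ 2 / 2))) := by
    rw [integral_const_mul]
    ring
  rw [hmajN, ← Real.norm_eq_abs]
  refine norm_integral_le_of_norm_le ((hmaj (N + 1)).const_mul _) (.of_forall fun x => ?_)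
  have hg : 0 ≤ K * Real.exp (-x ^ 2 / 2) := by positivity
  have hfactor : -(K * Real.exp (-x ^ 2 / 2) * Real.log (1 + a * (Real.exp (2 * x - 2) - 1)))
      - ∑ j ∈ Finset.range N, (1 / ((j : ℝ) + 1) * a ^ (j + 1)) *
        ((1 - Real.exp (2 * x - 2)) ^ (j + 1) * (K * Real.exp (-x ^ 2 / 2)))
      = -(K * Real.exp (-x ^ 2 / 2) * ((∑ j ∈ Finset.range N,
      (a * (1 - Real.exp (2 * x - 2))) ^ (j + 1) / (j + 1))
        + Real.log (1 + a * (Real.exp (2 * x - 2) - 1)))) := by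
    rw [mul_add, Finset.mul_sum, neg_add, add_comm, sub_eq_add_neg, add_comm, add_left_inj,
      neg_inj]
    refine Finset.sum_congr rfl fun j _ => ?_
    rw [mul_pow]
    ring
  rw [hfactor, norm_neg, norm_mul, Real.norm_eq_abs, Real.norm_eq_abs, abs_of_nonneg hg]
  calc _ ≤ K * Real.exp (-x ^ 2 / 2) *
        (2 * a ^ (N + 1) * |1 - Real.exp (2 * x - 2)| ^ (N + 1)) := by gcongr; exact hrem N x
    _ = _ := by ring

/-- A power series with geometrically bounded coefficients is asymptotic to its partial sums. -/
lemma exists_abs_sub_sum_le_of_hasSum {γ : ℕ → ℝ} {r M : ℝ} (hr : 0 < r)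
    (hγ : ∀ j, |γ j| * r ^ j ≤ M) (N : ℕ) :
    ∃ C : ℝ, ∀ a ∈ Set.Icc (0 : ℝ) (r / 2), ∀ s : ℝ, HasSum (fun j => γ j * a ^ j) s →
      |s - ∑ j ∈ Finset.range N, γ j * a ^ j| ≤ C * a ^ N := by
  have hM : 0 ≤ M := (by positivity : 0 ≤ |γ 0| * r ^ 0).trans (hγ 0)
  refine ⟨2 * M / r ^ N, ?_⟩
  rintro a ⟨ha0, ha⟩ s hs
  have hgeom : HasSum (fun j : ℕ => M * (a / r) ^ N * (1 / 2 : ℝ) ^ j) (M * (a / r) ^ N * 2) :=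
    hasSum_geometric_two.mul_left _
  have hbound : ∀ j : ℕ, ‖γ (j + N) * a ^ (j + N)‖ ≤ M * (a / r) ^ N * (1 / 2 : ℝ) ^ j := by
    intro j
    have hratio : a / r ≤ 1 / 2 := by rw [div_le_iff₀ hr]; linarith
    have hratio0 : 0 ≤ a / r := by positivity
    calc ‖γ (j + N) * a ^ (j + N)‖ = |γ (j + N)| * r ^ (j + N) * ((a / r) ^ N * (a / r) ^ j) := by
          rw [norm_mul, norm_pow, Real.norm_eq_abs, Real.norm_eq_abs, abs_of_nonneg ha0, ← pow_add,
            add_comm N j, div_pow]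
          field_simp
      _ ≤ M * ((a / r) ^ N * (1 / 2) ^ j) := by gcongr; exact hγ _
      _ = _ := by ring
  have htail := (hasSum_nat_add_iff' N).2 hs
  have h := tsum_of_norm_bounded hgeom hbound
  rw [htail.tsum_eq, Real.norm_eq_abs] at h
  refine h.trans_eq ?_
  rw [div_pow]
  ring

/-- Asymptotic expansions at `0⁺` in powers of `a` have unique coefficients. -/
lemma eq_of_abs_sub_sum_range_le {f : ℝ → ℝ} {b d : ℕ → ℝ} {ε : ℝ} (hε : 0 < ε)
    (hb : ∀ N, ∃ C : ℝ, ∀ a ∈ Set.Ioo 0 ε, |f a - ∑ j ∈ Finset.range N, b j * a ^ j| ≤ C * a ^ N)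
    (hd : ∀ N, ∃ C : ℝ, ∀ a ∈ Set.Ioo 0 ε, |f a - ∑ j ∈ Finset.range N, d j * a ^ j| ≤ C * a ^ N) :
    b = d := by
  funext n
  induction n using Nat.strong_induction_on with
  | _ n ih =>
    obtain ⟨C, hC⟩ := hb (n + 1)
    obtain ⟨D, hD⟩ := hd (n + 1)
    have hsum (a : ℝ) : ∑ j ∈ Finset.range n, b j * a ^ j = ∑ j ∈ Finset.range n, d j * a ^ j :=
      Finset.sum_congr rfl fun j hj => by rw [ih j (Finset.mem_range.1 hj)]
    have hle : ∀ a ∈ Set.Ioo 0 ε, |b n - d n| ≤ (C + D) * a := fun a ha => by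
      have hpos : 0 < a ^ n := pow_pos ha.1 n
      have h1 := hC a ha
      have h2 := hD a ha
      rw [Finset.sum_range_succ, hsum] at h1
      rw [Finset.sum_range_succ] at h2
      refine le_of_mul_le_mul_right ?_ hpos
      calc |b n - d n| * a ^ n = |(f a - (∑ j ∈ Finset.range n, d j * a ^ j + d n * a ^ n))
            - (f a - (∑ j ∈ Finset.range n, d j * a ^ j + b n * a ^ n))| := by
            rw [← abs_of_pos hpos, ← abs_mul, abs_of_pos hpos]; ring_nf
        _ ≤ D * a ^ (n + 1) + C * a ^ (n + 1) := (abs_sub _ _).trans (add_le_add h2 h1)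
        _ = (C + D) * a * a ^ n := by ring
    have hlim : Filter.Tendsto (fun a : ℝ => (C + D) * a) (nhdsWithin 0 (Set.Ioi 0)) (nhds 0) := by
      have h : Filter.Tendsto (fun a : ℝ => (C + D) * a) (nhds 0) (nhds ((C + D) * 0)) :=
        Filter.Tendsto.const_mul _ Filter.tendsto_id
      simpa using h.mono_left nhdsWithin_le_nhds
    have h0 : |b n - d n| ≤ 0 := ge_of_tendsto hlim (by
      filter_upwards [Ioo_mem_nhdsGT hε] with a ha using hle a ha)
    exact sub_eq_zero.1 (abs_nonpos_iff.1 h0)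

/-- the coefficients `c_j` of the formal power series of the Gaussian-mixture
Kullback–Leibler divergence `H_X` at `a = 0` grow so fast that the series has radius of
convergence zero; consequently `H_X` admits no power-series representation on any `[0,δ)`,
and in particular `H_X` is not real-analytic at `a = 0`. -/
theorem gaussian_mixture_KL_not_analytic
    (c : ℕ → ℝ)
    (hc : ∀ j : ℕ, 1 ≤ j → c j = (1 / (j : ℝ)) *
      ∫ x : ℝ, (1 - Real.exp (2 * x - 2)) ^ j *
        ((2 * Real.pi) ^ (-(1 : ℝ) / 2) * Real.exp (-x ^ 2 / 2)))
    (HX : ℝ → ℝ)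
    (hHX : ∀ a : ℝ, HX a = -∫ x : ℝ,
      (2 * Real.pi) ^ (-(1 : ℝ) / 2) * Real.exp (-x ^ 2 / 2) *
        Real.log (1 + a * (Real.exp (2 * x - 2) - 1))) :
    -- the radius of convergence of Σ c_j a^j is zero:
    -- for every r > 0 the sequence |c_j| r^j is unbounded
    (∀ r : ℝ, 0 < r → ¬ BddAbove (Set.range fun j : ℕ => |c j| * r ^ j)) ∧
    -- H_X admits no power-series representation valid on any interval [0,δ), δ > 0
    (¬ ∃ (γ : ℕ → ℝ) (δ : ℝ), 0 < δ ∧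
      ∀ a ∈ Set.Ico (0 : ℝ) δ, HasSum (fun j : ℕ => γ j * a ^ j) (HX a)) ∧
    -- in particular, H_X is not real-analytic at a = 0
    ¬ AnalyticAt ℝ HX 0 := by
  have hK : (0 : ℝ) < (2 * Real.pi) ^ (-(1 : ℝ) / 2) := by positivity
  generalize (2 * Real.pi) ^ (-(1 : ℝ) / 2) = K at hc hHX hK
  have hunb : ∀ r : ℝ, 0 < r → ¬ BddAbove (Set.range fun j : ℕ => |c j| * r ^ j) :=
    fun r hr => not_bddAbove_range_abs_mul_pow hK hc hr
  have hseries : ¬ ∃ (γ : ℕ → ℝ) (δ : ℝ), 0 < δ ∧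
      ∀ a ∈ Set.Ico (0 : ℝ) δ, HasSum (fun j : ℕ => γ j * a ^ j) (HX a) := by
    rintro ⟨γ, δ, hδ, hγ⟩
    have hr : 0 < δ / 2 := by positivity
    obtain ⟨M, hM⟩ :=
      (hγ (δ / 2) ⟨hr.le, by linarith⟩).summable.tendsto_atTop_zero.norm.bddAbove_range
    have hM' : ∀ j, |γ j| * (δ / 2) ^ j ≤ M := fun j => by
      have h := hM ⟨j, rfl⟩
      simpa [abs_mul, abs_of_pos hδ] using h
    have hcoef : γ = fun j => if j = 0 then 0 else c j := by
      refine eq_of_abs_sub_sum_range_le (f := HX) (ε := min (1 / 2) (δ / 4)) (by positivity) ?_ ?_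
      · intro N
        obtain ⟨C, hC⟩ := exists_abs_sub_sum_le_of_hasSum hr hM' N
        refine ⟨C, fun a ha => ?_⟩
        have ha' := lt_min_iff.1 ha.2
        exact hC a ⟨ha.1.le, by linarith⟩ _ (hγ a ⟨ha.1.le, by linarith⟩)
      · rintro (_ | N)
        · obtain ⟨C, hC⟩ := exists_abs_integral_log_add_sum_le hK.le 0
          refine ⟨|C|, fun a ha => ?_⟩
          have ha' := lt_min_iff.1 ha.2
          have h := hC a ⟨ha.1.le, ha'.1.le⟩
          rw [← hHX] at h
          simp only [Finset.range_zero, Finset.sum_empty, sub_zero, zero_add, pow_one,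
            pow_zero, mul_one] at h ⊢
          nlinarith [le_abs_self C, abs_nonneg C, ha.1]
        · obtain ⟨C, hC⟩ := exists_abs_integral_log_add_sum_le hK.le N
          refine ⟨C, fun a ha => ?_⟩
          have ha' := lt_min_iff.1 ha.2
          have h := hC a ⟨ha.1.le, ha'.1.le⟩
          rw [← hHX] at h
          convert h using 3
          rw [Finset.sum_range_succ']
          simp [hc]
    refine hunb (δ / 2) hr ⟨max M |c 0|, ?_⟩
    rintro _ ⟨_ | j, rfl⟩
    · simp
    · have h := hM' (j + 1)
      simp only [hcoef, Nat.succ_ne_zero, if_false] at h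
      exact h.trans (le_max_left _ _)
  refine ⟨hunb, hseries, ?_⟩
  rintro ⟨p, hp⟩
  obtain ⟨δ, hδ, hball⟩ := Metric.eventually_nhds_iff.1 (hasFPowerSeriesAt_iff.1 hp)
  refine hseries ⟨p.coeff, δ, hδ, fun a ha => ?_⟩
  have h := hball (y := a) (by simpa [abs_of_nonneg ha.1] using ha.2)
  simpa [mul_comm] using h
end

section
/- Set λ_X = (1+η₁)/2 if η₁ ≤ 1/2 and λ_X = 3/4 if η₁ > 1/2, and set m_X = 2 if η₁ = 1/2 and m_X = 1 otherwise. Then the zeta function ζ_X(z) = ∫_{[0,1]^3} H_X(a,b_1,b_2)^z φ(a,b_1,b_2) da db_1 db_2, which is holomorphic on {Re z > 0}, admits for some ε > 0 a meromorphic continuation to {Re z > −λ_X − ε} whose only pole in that region is at z = −λ_X, and that pole has order m_X. (The convention H^z := 0 is used at the measure-zero set of parameters where H_X ∈ {0, +∞}.) -/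
open MeasureTheory

/-- Binomial probability mass function. -/
noncomputable def binPMF (M : ℕ) (b : ℝ) (m : ℕ) : ℝ :=
  (M.choose m : ℝ) * b ^ m * (1 - b) ^ (M - m)

/-- Mixture pmf `p(m|a,b₁,b₂) = a f(m|b₁) + (1−a) f(m|b₂)`, with `w = (a,b₁,b₂)`. -/
noncomputable def binMix (M : ℕ) (w : ℝ × ℝ × ℝ) (m : ℕ) : ℝ :=
  w.1 * binPMF M w.2.1 m + (1 - w.1) * binPMF M w.2.2 m

/-- Kullback–Leibler divergence `H_X(a,b₁,b₂)` of the two-component binomial mixture from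
the true pmf `f(·|b*)`. -/
noncomputable def binMixKL (M : ℕ) (bstar : ℝ) (w : ℝ × ℝ × ℝ) : ℝ :=
  ∑ m ∈ Finset.range (M + 1),
    binPMF M bstar m * Real.log (binPMF M bstar m / binMix M w m)

/-- The zeta function `ζ_X(z) = ∫_{[0,1]³} H_X(w)^z φ(w) dw`, with the Dirichlet-type prior
`φ(a,b₁,b₂) = [Γ(2η₁)/Γ(η₁)²] a^{η₁−1}(1−a)^{η₁−1} ψ(b₁,b₂)` and the convention
`H^z := 0` where `H_X ∈ {0, +∞}` (the latter being where the mixture pmf vanishes). -/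
noncomputable def binMixZeta (M : ℕ) (bstar η₁ : ℝ) (ψ : ℝ × ℝ → ℝ) (z : ℂ) : ℂ :=
  ∫ w in Set.Icc (0 : ℝ) 1 ×ˢ Set.Icc (0 : ℝ) 1 ×ˢ Set.Icc (0 : ℝ) 1,
    (if (∀ m ∈ Finset.range (M + 1), 0 < binMix M w m) ∧ binMixKL M bstar w ≠ 0 then
        (binMixKL M bstar w : ℂ) ^ z
      else 0) *
    ((Real.Gamma (2 * η₁) / Real.Gamma η₁ ^ 2 * w.1 ^ (η₁ - 1) * (1 - w.1) ^ (η₁ - 1) *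
        ψ w.2 : ℝ) : ℂ)

open Set Filter Topology

theorem differentiableOn_integral_of_dominated {α : Type*} [MeasurableSpace α] {μ : Measure α}
    {U : Set ℂ} (hU : IsOpen U) {F : ℂ → α → ℂ}
    (hmeas : ∀ z ∈ U, AEStronglyMeasurable (F z) μ)
    (hdiff : ∀ᵐ w ∂μ, DifferentiableOn ℂ (fun z => F z w) U)
    (hbound : ∀ z₀ ∈ U, ∃ V ∈ 𝓝 z₀, ∃ g : α → ℝ, Integrable g μ ∧
      ∀ᵐ w ∂μ, ∀ z ∈ V, ‖F z w‖ ≤ g w) :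
    DifferentiableOn ℂ (fun z => ∫ w, F z w ∂μ) U := by
  intro z₀ hz₀
  obtain ⟨V, hV, g, hg, hFg⟩ := hbound z₀ hz₀
  obtain ⟨R, hR, hball⟩ := Metric.mem_nhds_iff.1 (inter_mem hV (hU.mem_nhds hz₀))
  set r := R / 2 with hr
  have hr0 : 0 < r := by positivity
  have hsub : ∀ z ∈ Metric.ball z₀ r, Metric.closedBall z r ⊆ V ∩ U := by
    intro z hz y hy
    apply hball
    rw [Metric.mem_ball] at hz ⊢
    rw [Metric.mem_closedBall] at hy
    linarith [dist_triangle y z z₀]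
  have hz₀b : z₀ ∈ Metric.ball z₀ r := Metric.mem_ball_self hr0
  have hderiv : ∀ᵐ w ∂μ, ∀ z ∈ Metric.ball z₀ r,
      HasDerivAt (fun z => F z w) (deriv (fun z => F z w) z) z := by
    filter_upwards [hdiff] with w hw z hz
    have hzU : z ∈ U := (hsub z hz (Metric.mem_closedBall_self hr0.le)).2
    exact ((hw z hzU).differentiableAt (hU.mem_nhds hzU)).hasDerivAt
  have key := hasDerivAt_integral_of_dominated_loc_of_deriv_le (μ := μ) (F := F) (x₀ := z₀)
    (s := Metric.ball z₀ r) (bound := fun w => g w / r)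
    (F' := fun z w => deriv (fun z => F z w) z) (Metric.ball_mem_nhds z₀ hr0)
    (by filter_upwards [hU.mem_nhds hz₀] with z hz using hmeas z hz)
    (hg.mono' (hmeas z₀ hz₀) (by
      filter_upwards [hFg] with w hw using hw z₀ (mem_of_mem_nhds hV)))
    ?_ ?_ (hg.div_const r) hderiv
  · exact key.2.differentiableAt.differentiableWithinAt
  · have hlim : ∀ᵐ w ∂μ, Tendsto (fun n : ℕ =>
        (((r / 2) / (n + 1) : ℝ) : ℂ)⁻¹ * (F (z₀ + (((r / 2) / (n + 1) : ℝ) : ℂ)) w - F z₀ w))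
        atTop (𝓝 (deriv (fun z => F z w) z₀)) := by
      filter_upwards [hderiv] with w hw
      have h := (hw z₀ hz₀b).tendsto_slope_zero
      have ht : Tendsto (fun n : ℕ => (((r / 2) / (n + 1) : ℝ) : ℂ)) atTop (𝓝[≠] 0) := by
        refine tendsto_nhdsWithin_iff.2 ⟨?_, Eventually.of_forall fun n => ?_⟩
        · have : Tendsto (fun n : ℕ => (r / 2) / ((n : ℝ) + 1)) atTop (𝓝 0) :=
            tendsto_const_nhds.div_atTop
              (tendsto_atTop_add_const_right _ 1 tendsto_natCast_atTop_atTop)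
          simpa [Function.comp_def] using (Complex.continuous_ofReal.tendsto 0).comp this
        · simp only [mem_compl_iff, mem_singleton_iff, Complex.ofReal_eq_zero]
          positivity
      simpa [Function.comp_def, smul_eq_mul] using h.comp ht
    refine aestronglyMeasurable_of_tendsto_ae atTop (fun n => ?_) hlim
    refine ((hmeas _ ?_).sub (hmeas _ hz₀)).const_mul _
    apply (hsub z₀ hz₀b _).2
    rw [Metric.mem_closedBall, dist_eq_norm, add_sub_cancel_left, Complex.norm_real,
      Real.norm_of_nonneg (by positivity)]
    have : r / 2 / ((n : ℝ) + 1) ≤ r / 2 := div_le_self (by positivity) (by simp)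
    linarith
  · filter_upwards [hdiff, hFg] with w hw hwg z hz
    refine Complex.norm_deriv_le_of_forall_mem_sphere_norm_le hr0 ?_ ?_
    · refine DifferentiableOn.diffContOnCl ?_
      rw [closure_ball _ hr0.ne']
      exact hw.mono fun y hy => (hsub z hz hy).2
    · intro y hy
      exact hwg y (hsub z hz (Metric.sphere_subset_closedBall hy)).1

theorem norm_cpow_sub_cpow_le {A B : ℝ} (hA : 0 < A) (hB : 0 < B) (z : ℂ) :
    ‖(A : ℂ) ^ z - (B : ℂ) ^ z‖ ≤
      B ^ z.re * (‖z‖ * |Real.log (A / B)| * Real.exp (‖z‖ * |Real.log (A / B)|)) := by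
  have hAB : (A : ℂ) = (B : ℂ) * ((A / B : ℝ) : ℂ) := by
    rw [← Complex.ofReal_mul, mul_div_cancel₀ _ hB.ne']
  have h1 : (A : ℂ) ^ z - (B : ℂ) ^ z =
      (B : ℂ) ^ z * (Complex.exp (Real.log (A / B) * z) - 1) := by
    conv_lhs => rw [hAB]
    rw [Complex.mul_cpow_ofReal_nonneg hB.le (by positivity),
      Complex.cpow_def_of_ne_zero (x := ((A / B : ℝ) : ℂ))
      (by exact_mod_cast (div_pos hA hB).ne'), Complex.ofReal_log (by positivity)]
    ring
  rw [h1, norm_mul, Complex.norm_cpow_eq_rpow_re_of_pos hB]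
  gcongr
  have h2 := Complex.norm_exp_sub_sum_le_norm_mul_exp (Real.log (A / B) * z) 1
  simp only [Finset.range_one, Finset.sum_singleton, pow_zero, Nat.factorial_zero, Nat.cast_one,
    div_one, norm_mul, Complex.norm_real, Real.norm_eq_abs, pow_one] at h2
  simpa only [mul_comm ‖z‖] using h2

theorem abs_log_div_le {A B m : ℝ} (hm : 0 < m) (hA : m ≤ A) (hB : m ≤ B) :
    |Real.log (A / B)| ≤ |A - B| / m := by
  have hA0 := hm.trans_le hA
  have hB0 := hm.trans_le hB
  have key : ∀ {A B : ℝ}, m ≤ A → m ≤ B → Real.log (A / B) ≤ |A - B| / m := by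
    intro A B hA hB
    have hB0 := hm.trans_le hB
    have h := Real.log_le_sub_one_of_pos (div_pos (hm.trans_le hA) hB0)
    have h2 : A / B - 1 = (A - B) / B := by field_simp
    calc Real.log (A / B) ≤ (A - B) / B := by linarith
      _ ≤ |A - B| / B := by gcongr; exact le_abs_self _
      _ ≤ |A - B| / m := by gcongr
  rw [abs_le]
  refine ⟨?_, key hA hB⟩
  have := key hB hA
  rw [← inv_div, Real.log_inv, abs_sub_comm] at this
  linarith

theorem rpow_le_rpow_add_rpow {t s₁ s s₂ : ℝ} (ht : 0 < t) (h₁ : s₁ ≤ s) (h₂ : s ≤ s₂) :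
    t ^ s ≤ t ^ s₁ + t ^ s₂ := by
  rcases le_total t 1 with h | h
  · have := Real.rpow_le_rpow_of_exponent_ge ht h h₁
    have := Real.rpow_pos_of_pos ht s₂
    linarith
  · have := Real.rpow_le_rpow_of_exponent_le h h₂
    have := Real.rpow_pos_of_pos ht s₁
    linarith

theorem ofReal_cpow_eq_exp {t : ℝ} (ht : 0 < t) (z : ℂ) :
    (t : ℂ) ^ z = Complex.exp (Real.log t * z) := by
  rw [Complex.cpow_def_of_ne_zero (by exact_mod_cast ht.ne'), Complex.ofReal_log ht.le]

theorem differentiable_ofReal_cpow {t : ℝ} (ht : 0 < t) :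
    Differentiable ℂ fun z : ℂ => (t : ℂ) ^ z := by
  simp_rw [ofReal_cpow_eq_exp ht]
  fun_prop

theorem integrable_one_add_sq_rpow {s : ℝ} (hs : s < -1 / 2) :
    Integrable fun t : ℝ => (1 + t ^ 2) ^ s := by
  have h := integrable_rpow_neg_one_add_norm_sq (E := ℝ) (μ := volume) (r := -2 * s)
    (by simp; linarith)
  refine h.congr (Eventually.of_forall fun t => ?_)
  simp only [Real.norm_eq_abs, sq_abs]
  congr 1
  ring

/-- The integral of `(1 + t²) ^ z` over the real line. -/
noncomputable def lineBeta (z : ℂ) : ℂ := ∫ t : ℝ, ((1 + t ^ 2 : ℝ) : ℂ) ^ z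

theorem differentiableOn_lineBeta : DifferentiableOn ℂ lineBeta {z | z.re < -1 / 2} := by
  refine differentiableOn_integral_of_dominated
    (isOpen_lt Complex.continuous_re continuous_const) ?_ ?_ ?_
  · intro z _
    exact Measurable.aestronglyMeasurable (by fun_prop)
  · exact Eventually.of_forall fun t => (differentiable_ofReal_cpow (by positivity)).differentiableOn
  · intro z₀ hz₀
    simp only [mem_ofPred_eq] at hz₀
    refine ⟨{z | z.re < (z₀.re + -1 / 2) / 2}, (isOpen_lt Complex.continuous_re
      continuous_const).mem_nhds (by simp; linarith), _,
      integrable_one_add_sq_rpow (s := (z₀.re + -1 / 2) / 2) (by linarith),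
      Eventually.of_forall fun t z hz => ?_⟩
    rw [Complex.norm_cpow_eq_rpow_re_of_pos (by positivity)]
    exact Real.rpow_le_rpow_of_exponent_le (by nlinarith [sq_nonneg t]) (le_of_lt hz)

theorem lineBeta_ofReal (s : ℝ) :
    lineBeta s = ((∫ t : ℝ, (1 + t ^ 2) ^ s : ℝ) : ℂ) := by
  rw [lineBeta, ← integral_complex_ofReal]
  congr 1
  ext t
  rw [Complex.ofReal_cpow (by positivity)]

theorem integral_one_add_sq_rpow_pos {s : ℝ} (hs : s < -1 / 2) :
    0 < ∫ t : ℝ, (1 + t ^ 2 : ℝ) ^ s := by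
  rw [integral_pos_iff_support_of_nonneg (fun t => by positivity) (integrable_one_add_sq_rpow hs)]
  have : Function.support (fun t : ℝ => (1 + t ^ 2 : ℝ) ^ s) = univ := by
    ext t
    simp only [Function.mem_support, mem_univ, iff_true]
    positivity
  simp [this]

theorem lineBeta_re_pos {s : ℝ} (hs : s < -1 / 2) : 0 < (lineBeta s).re := by
  rw [lineBeta_ofReal, Complex.ofReal_re]
  exact integral_one_add_sq_rpow_pos hs

theorem integral_quadratic_cpow {k d : ℝ} (hk : 0 < k) (hd : 0 < d) (s : ℝ) (z : ℂ) :
    ∫ b : ℝ, ((k ^ 2 * (b + s) ^ 2 + d ^ 2 : ℝ) : ℂ) ^ z =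
      (k : ℂ)⁻¹ * (d : ℂ) ^ (2 * z + 1) * lineBeta z := by
  have h1 : ∀ b : ℝ, ((k ^ 2 * (b + s) ^ 2 + d ^ 2 : ℝ) : ℂ) ^ z =
      (d : ℂ) ^ (2 * z) * ((1 + (k / d * (b + s)) ^ 2 : ℝ) : ℂ) ^ z := by
    intro b
    have : k ^ 2 * (b + s) ^ 2 + d ^ 2 = d ^ 2 * (1 + (k / d * (b + s)) ^ 2) := by
      field_simp
      ring
    rw [this, Complex.ofReal_mul, Complex.mul_cpow_ofReal_nonneg (by positivity) (by positivity),
      ofReal_cpow_eq_exp (t := d ^ 2) (by positivity), ofReal_cpow_eq_exp hd, Real.log_pow]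
    push_cast
    ring_nf
  simp_rw [h1]
  rw [integral_const_mul,
    integral_add_right_eq_self (fun b : ℝ => ((1 + (k / d * b) ^ 2 : ℝ) : ℂ) ^ z),
    Measure.integral_comp_mul_left (fun b : ℝ => ((1 + b ^ 2 : ℝ) : ℂ) ^ z), lineBeta,
    abs_of_pos (by positivity), Complex.cpow_add _ _ (by exact_mod_cast hd.ne'), Complex.cpow_one]
  simp only [Complex.real_smul, inv_div]
  push_cast
  ring

theorem quadratic_rpow_eq {k d : ℝ} (hd : 0 < d) (s b σ : ℝ) :
    (k ^ 2 * (b + s) ^ 2 + d ^ 2) ^ σ = d ^ (2 * σ) * (1 + (k / d * (b + s)) ^ 2) ^ σ := by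
  have : k ^ 2 * (b + s) ^ 2 + d ^ 2 = d ^ 2 * (1 + (k / d * (b + s)) ^ 2) := by
    field_simp
    ring
  rw [this, Real.mul_rpow (by positivity) (by positivity), Real.rpow_mul hd.le, Real.rpow_two]

theorem integrable_quadratic_rpow {k d σ : ℝ} (hk : 0 < k) (hd : 0 < d) (hσ : σ < -1 / 2) (s : ℝ) :
    Integrable fun b : ℝ => (k ^ 2 * (b + s) ^ 2 + d ^ 2) ^ σ := by
  simp_rw [quadratic_rpow_eq hd s _ σ]
  exact (((integrable_one_add_sq_rpow hσ).comp_mul_left' (by positivity)).comp_add_right s).const_mul _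

theorem integral_quadratic_rpow {k d σ : ℝ} (hk : 0 < k) (hd : 0 < d) (s : ℝ) :
    ∫ b : ℝ, (k ^ 2 * (b + s) ^ 2 + d ^ 2) ^ σ =
      k⁻¹ * d ^ (2 * σ + 1) * ∫ t : ℝ, (1 + t ^ 2) ^ σ := by
  simp_rw [quadratic_rpow_eq hd s _ σ]
  rw [integral_const_mul,
    integral_add_right_eq_self (fun b : ℝ => (1 + (k / d * b) ^ 2) ^ σ),
    Measure.integral_comp_mul_left (fun b : ℝ => (1 + b ^ 2) ^ σ),
    abs_of_pos (by positivity), Real.rpow_add hd, Real.rpow_one]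
  simp only [smul_eq_mul, inv_div]
  ring

/-- The one-dimensional Mellin-type integral `∫ (s^p d(s))^Z s^(q-1) k(s) ds` has, to the left of
its half-plane of convergence, only a simple pole at `Z = -q/p`. -/
theorem exists_mellin_continuation {c p q : ℝ} (hc : 0 < c) {d k : ℝ → ℝ}
    {Kd Kk : NNReal} (hd : LipschitzOnWith Kd d (Icc 0 c)) (hk : LipschitzOnWith Kk k (Icc 0 c))
    (hd0 : ∀ s ∈ Icc 0 c, 0 < d s) (hk0 : ∀ s ∈ Icc 0 c, 0 < k s) :
    ∃ g : ℂ → ℂ, DifferentiableOn ℂ g {Z | -1 < p * Z.re + q} ∧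
      (∀ Z : ℂ, 0 < p * Z.re + q →
        ∫ s in Ioo 0 c, ((s ^ p * d s : ℝ) : ℂ) ^ Z * ((s ^ (q - 1) * k s : ℝ) : ℂ) =
          g Z / (p * Z + q)) ∧
      ∀ t : ℝ, 0 ≤ p * t + q → 0 < (g t).re := by
  have h0 : (0 : ℝ) ∈ Icc 0 c := ⟨le_rfl, hc.le⟩
  obtain ⟨s₀, hs₀, hmin⟩ := isCompact_Icc.exists_isMinOn ⟨0, h0⟩ hd.continuousOn
  set m := d s₀ with hm_def
  have hm : 0 < m := hd0 s₀ hs₀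
  have hmd : ∀ s ∈ Icc 0 c, m ≤ d s := fun s hs => hmin hs
  have hlipd : ∀ s ∈ Icc 0 c, |d s - d 0| ≤ Kd * s := by
    intro s hs
    have := hd.dist_le_mul s hs 0 h0
    rwa [Real.dist_eq, Real.dist_eq, sub_zero, abs_of_nonneg hs.1] at this
  have hlipk : ∀ s ∈ Icc 0 c, |k s - k 0| ≤ Kk * s := by
    intro s hs
    have := hk.dist_le_mul s hs 0 h0
    rwa [Real.dist_eq, Real.dist_eq, sub_zero, abs_of_nonneg hs.1] at this
  set e : ℂ → ℝ → ℂ := fun Z s => (d s : ℂ) ^ Z * (k s : ℂ) with he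
  have hediff : ∀ Z : ℂ, ∀ s ∈ Icc 0 c, ‖e Z s - e Z 0‖ ≤
      ((d 0 ^ Z.re * (‖Z‖ * (Kd / m) * Real.exp (‖Z‖ * (Kd * c / m)))) * (k 0 + Kk * c) +
        d 0 ^ Z.re * Kk) * s := by
    intro Z s hs
    have hds := hd0 s hs
    have hd00 := hd0 0 h0
    have e1 : e Z s - e Z 0 = ((d s : ℂ) ^ Z - (d 0 : ℂ) ^ Z) * (k s : ℂ) +
        (d 0 : ℂ) ^ Z * ((k s - k 0 : ℝ) : ℂ) := by
      simp only [he]; push_cast; ring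
    have hL : |Real.log (d s / d 0)| ≤ Kd / m * s := by
      refine (abs_log_div_le hm (hmd s hs) (hmd 0 h0)).trans ?_
      rw [div_mul_eq_mul_div]
      gcongr
      exact hlipd s hs
    have hL' : |Real.log (d s / d 0)| ≤ Kd * c / m := by
      refine hL.trans ?_
      rw [div_mul_eq_mul_div]
      gcongr
      exact hs.2
    have hks : |k s| ≤ k 0 + Kk * c := by
      have h1 := hlipk s hs
      have h2 : (Kk : ℝ) * s ≤ Kk * c := by gcongr; exact hs.2
      have h3 := hk0 0 h0
      rw [abs_of_pos (hk0 s hs)]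
      linarith [le_abs_self (k s - k 0)]
    have hkp : 0 ≤ k 0 + Kk * c := (abs_nonneg _).trans hks
    rw [e1]
    refine (norm_add_le _ _).trans ?_
    rw [norm_mul, norm_mul, Complex.norm_real, Complex.norm_real, Real.norm_eq_abs,
      Real.norm_eq_abs, Complex.norm_cpow_eq_rpow_re_of_pos hd00, add_mul]
    refine add_le_add ?_ ?_
    · calc ‖(d s : ℂ) ^ Z - (d 0 : ℂ) ^ Z‖ * |k s| ≤
          (d 0 ^ Z.re * (‖Z‖ * (Kd / m * s) * Real.exp (‖Z‖ * (Kd * c / m)))) *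
            (k 0 + Kk * c) := by
            refine mul_le_mul ((norm_cpow_sub_cpow_le hds hd00 Z).trans ?_) hks (abs_nonneg _) ?_
            · have := hs.1
              gcongr
            · have := hs.1
              positivity
        _ = _ := by ring
    · rw [mul_assoc]
      gcongr
      exact hlipk s hs
  have hcontd : ContinuousOn d (Ioo 0 c) := hd.continuousOn.mono Ioo_subset_Icc_self
  have hcontk : ContinuousOn k (Ioo 0 c) := hk.continuousOn.mono Ioo_subset_Icc_self
  have hcpow : ∀ r : ℂ, ContinuousOn (fun s : ℝ => (s : ℂ) ^ r) (Ioo 0 c) := fun r s hs =>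
    (Complex.continuousAt_ofReal_cpow_const s r (Or.inr hs.1.ne')).continuousWithinAt
  have hcontdZ : ∀ Z : ℂ, ContinuousOn (fun s => (d s : ℂ) ^ Z) (Ioo 0 c) := by
    intro Z s hs
    exact (Complex.continuousAt_ofReal_cpow_const (d s) Z
      (Or.inr (hd0 s (Ioo_subset_Icc_self hs)).ne')).comp_continuousWithinAt (hcontd s hs)
  have hconte : ∀ Z : ℂ, ContinuousOn (e Z) (Ioo 0 c) := fun Z =>
    (hcontdZ Z).mul (Complex.continuous_ofReal.comp_continuousOn hcontk)
  set Rm : ℂ → ℂ := fun Z => ∫ s in Ioo 0 c, (s : ℂ) ^ (p * Z + q - 1) * (e Z s - e Z 0) with hRm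
  have hre : ∀ Z : ℂ, (p * Z + q - 1 : ℂ).re = p * Z.re + q - 1 := by intro Z; simp
  have hintpow : ∀ r : ℝ, -1 < r → IntegrableOn (fun s : ℝ => s ^ r) (Ioo 0 c) := fun r hr =>
    (intervalIntegral.integrableOn_Ioo_rpow_iff hc).2 hr
  have hUopen : IsOpen {Z : ℂ | -1 < p * Z.re + q} :=
    isOpen_lt continuous_const (by fun_prop)
  have hmeasR : ∀ Z : ℂ, AEStronglyMeasurable
      (fun s : ℝ => (s : ℂ) ^ (p * Z + q - 1) * (e Z s - e Z 0)) (volume.restrict (Ioo 0 c)) :=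
    fun Z => ContinuousOn.aestronglyMeasurable
      ((hcpow _).mul ((hconte Z).sub continuousOn_const)) measurableSet_Ioo
  have hRbound : ∀ Z₀ ∈ {Z : ℂ | -1 < p * Z.re + q}, ∃ V ∈ 𝓝 Z₀, ∃ g : ℝ → ℝ,
      Integrable g (volume.restrict (Ioo 0 c)) ∧ ∀ᵐ s : ℝ ∂(volume.restrict (Ioo 0 c)), ∀ Z ∈ V,
        ‖(s : ℂ) ^ (p * Z + q - 1) * (e Z s - e Z 0)‖ ≤ g s := by
    intro Z₀ hZ₀
    simp only [mem_ofPred_eq] at hZ₀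
    set C : ℂ → ℝ := fun Z =>
      ((d 0 ^ Z.re * (‖Z‖ * (Kd / m) * Real.exp (‖Z‖ * (Kd * c / m)))) * (k 0 + Kk * c) +
        d 0 ^ Z.re * Kk) with hC
    have hCcont : Continuous C := by
      have : Continuous fun Z : ℂ => d 0 ^ Z.re :=
        (Real.continuous_const_rpow (hd0 0 h0).ne').comp Complex.continuous_re
      fun_prop
    set r₁ : ℝ := (p * Z₀.re + q - 1) / 2 with hr₁
    set r₂ : ℝ := p * Z₀.re + q + 1 with hr₂
    refine ⟨{Z | C Z < C Z₀ + 1} ∩ {Z | r₁ < p * Z.re + q} ∩ {Z | p * Z.re + q < r₂}, ?_,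
      fun s => (s ^ r₁ + s ^ r₂) * (C Z₀ + 1), ?_, ?_⟩
    · refine IsOpen.mem_nhds (((isOpen_lt hCcont continuous_const).inter
        (isOpen_lt continuous_const (by fun_prop))).inter
        (isOpen_lt (by fun_prop) continuous_const)) ⟨⟨?_, ?_⟩, ?_⟩
      · simp
      · simp only [mem_ofPred_eq, hr₁]; linarith
      · simp only [mem_ofPred_eq, hr₂]; linarith
    · exact ((hintpow _ (by rw [hr₁]; linarith)).add
        (hintpow _ (by rw [hr₂]; linarith))).mul_const _
    · refine (ae_restrict_iff' measurableSet_Ioo).2 (Eventually.of_forall fun s hs Z hZ => ?_)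
      obtain ⟨⟨hZ1, hZ2⟩, hZ3⟩ := hZ
      simp only [mem_ofPred_eq] at hZ1 hZ2 hZ3
      rw [norm_mul, Complex.norm_cpow_eq_rpow_re_of_pos hs.1, hre]
      have h1 := hediff Z s (Ioo_subset_Icc_self hs)
      have hs0 := hs.1
      calc s ^ (p * Z.re + q - 1) * ‖e Z s - e Z 0‖ ≤ s ^ (p * Z.re + q - 1) * (C Z * s) := by
            gcongr
        _ = s ^ (p * Z.re + q) * C Z := by
            rw [Real.rpow_sub_one hs0.ne']; field_simp
        _ ≤ s ^ (p * Z.re + q) * (C Z₀ + 1) :=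
            mul_le_mul_of_nonneg_left hZ1.le (Real.rpow_nonneg hs0.le _)
        _ ≤ _ := by
            have : 0 ≤ C Z₀ := by
              have := (hd0 0 h0).le; have := (hk0 0 h0).le
              positivity
            exact mul_le_mul_of_nonneg_right (rpow_le_rpow_add_rpow hs0 hZ2.le hZ3.le)
              (by linarith)
  have hRdiff : DifferentiableOn ℂ Rm {Z | -1 < p * Z.re + q} := by
    refine differentiableOn_integral_of_dominated hUopen (fun Z _ => hmeasR Z) ?_ hRbound
    refine (ae_restrict_iff' measurableSet_Ioo).2 (Eventually.of_forall fun s hs => ?_)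
    refine Differentiable.differentiableOn (Differentiable.mul ?_ ?_)
    · exact (differentiable_ofReal_cpow hs.1).comp (f := fun Z : ℂ => p * Z + q - 1) (by fun_prop)
    · exact ((differentiable_ofReal_cpow (hd0 s (Ioo_subset_Icc_self hs))).mul_const _).sub
        ((differentiable_ofReal_cpow (hd0 0 h0)).mul_const _)
  set g : ℂ → ℂ := fun Z => e Z 0 * (c : ℂ) ^ (p * Z + q) + (p * Z + q) * Rm Z with hg
  have hgform : ∀ Z : ℂ, 0 < p * Z.re + q →
      ∫ s in Ioo 0 c, ((s ^ p * d s : ℝ) : ℂ) ^ Z * ((s ^ (q - 1) * k s : ℝ) : ℂ) =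
        g Z / (p * Z + q) := by
    intro Z hZ
    have hne : (p * Z + q : ℂ) ≠ 0 := by
      intro h
      have := congrArg Complex.re h
      simp at this
      linarith
    have e1 : ∀ s ∈ Ioo 0 c, ((s ^ p * d s : ℝ) : ℂ) ^ Z * ((s ^ (q - 1) * k s : ℝ) : ℂ) =
        (s : ℂ) ^ (p * Z + q - 1) * e Z 0 +
          (s : ℂ) ^ (p * Z + q - 1) * (e Z s - e Z 0) := by
      intro s hs
      have hs0 := hs.1
      have hds := hd0 s (Ioo_subset_Icc_self hs)
      have : (s : ℂ) ^ (p * Z + q - 1) = ((s ^ p : ℝ) : ℂ) ^ Z * ((s ^ (q - 1) : ℝ) : ℂ) := by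
        rw [ofReal_cpow_eq_exp hs0, ofReal_cpow_eq_exp (by positivity), Real.log_rpow hs0,
          Complex.ofReal_cpow hs0.le, ofReal_cpow_eq_exp hs0, ← Complex.exp_add]
        push_cast
        ring_nf
      rw [← mul_add, add_sub_cancel, this, Complex.ofReal_mul,
        Complex.mul_cpow_ofReal_nonneg (by positivity) hds.le]
      simp only [he]
      push_cast
      ring
    rw [setIntegral_congr_fun measurableSet_Ioo e1, integral_add, integral_mul_const]
    · have hI : ∫ s in Ioo 0 c, (s : ℂ) ^ (p * Z + q - 1 : ℂ) =
          (c : ℂ) ^ (p * Z + q) / (p * Z + q) := by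
        rw [← integral_Ioc_eq_integral_Ioo, ← intervalIntegral.integral_of_le hc.le,
          integral_cpow (Or.inl (by rw [hre]; linarith))]
        simp [Complex.zero_cpow hne]
      rw [hI]
      simp only [hg]
      field_simp
      simp only [hRm]
    · refine Integrable.mul_const ?_ _
      refine (hintpow (p * Z.re + q - 1) (by linarith)).mono'
        ((hcpow _).aestronglyMeasurable measurableSet_Ioo) ?_
      refine (ae_restrict_iff' measurableSet_Ioo).2 (Eventually.of_forall fun s hs => ?_)
      rw [Complex.norm_cpow_eq_rpow_re_of_pos hs.1, hre]
    · obtain ⟨V, hV, G, hG, hVG⟩ := hRbound Z (by simp only [mem_ofPred_eq]; linarith)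
      exact hG.mono' (hmeasR Z) (hVG.mono fun s hs => hs Z (mem_of_mem_nhds hV))
  refine ⟨g, ?_, hgform, ?_⟩
  · refine DifferentiableOn.add (Differentiable.differentiableOn (Differentiable.mul ?_ ?_))
      (DifferentiableOn.mul (by fun_prop) hRdiff)
    · exact (differentiable_ofReal_cpow (hd0 0 h0)).mul_const _
    · exact (differentiable_ofReal_cpow hc).comp (f := fun Z : ℂ => p * Z + q) (by fun_prop)
  · intro t ht
    rcases ht.eq_or_lt with ht | ht
    · have : (p * (t : ℂ) + q) = 0 := by exact_mod_cast ht.symm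
      simp only [hg, this, Complex.cpow_zero, zero_mul, add_zero, mul_one, he]
      rw [← Complex.ofReal_cpow (hd0 0 h0).le, ← Complex.ofReal_mul, Complex.ofReal_re]
      have := hd0 0 h0
      have := hk0 0 h0
      positivity
    · have h1 := hgform t (by simpa using ht)
      have hne : (p * (t : ℂ) + q) ≠ 0 := by exact_mod_cast ht.ne'
      have h2 : g t = (((p * t + q) *
          ∫ s in Ioo 0 c, (s ^ p * d s) ^ t * (s ^ (q - 1) * k s) : ℝ) : ℂ) := by
        rw [eq_div_iff hne] at h1
        rw [← h1, Complex.ofReal_mul, mul_comm, ← integral_complex_ofReal]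
        congr 1
        · push_cast
          rfl
        · refine setIntegral_congr_fun measurableSet_Ioo fun s hs => ?_
          have hs0 := hs.1
          have hds := hd0 s (Ioo_subset_Icc_self hs)
          rw [Complex.ofReal_mul ((s ^ p * d s) ^ t), Complex.ofReal_cpow (by positivity)]
      rw [h2, Complex.ofReal_re]
      refine mul_pos ht ?_
      have hpos : ∀ s ∈ Ioo 0 c, 0 < (s ^ p * d s) ^ t * (s ^ (q - 1) * k s) := by
        intro s hs
        have hs0 := hs.1
        have hds := hd0 s (Ioo_subset_Icc_self hs)
        have hks := hk0 s (Ioo_subset_Icc_self hs)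
        positivity
      rw [setIntegral_pos_iff_support_of_nonneg_ae]
      · have : Ioo 0 c ⊆ Function.support
            (fun s => (s ^ p * d s) ^ t * (s ^ (q - 1) * k s)) ∩ Ioo 0 c :=
          fun s hs => ⟨(hpos s hs).ne', hs⟩
        refine lt_of_lt_of_le ?_ (measure_mono this)
        simpa using hc
      · exact (ae_restrict_iff' measurableSet_Ioo).2
          (Eventually.of_forall fun s hs => (hpos s hs).le)
      · obtain ⟨Cd, hCd⟩ := isCompact_Icc.exists_bound_of_continuousOn
          (f := fun s => d s ^ t * k s) (s := Icc 0 c)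
          ((hd.continuousOn.rpow_const fun s hs => Or.inl (hd0 s hs).ne').mul hk.continuousOn)
        have e2 : ∀ s ∈ Ioo 0 c, (s ^ p * d s) ^ t * (s ^ (q - 1) * k s) =
            s ^ (p * t + q - 1) * (d s ^ t * k s) := by
          intro s hs
          have hs0 := hs.1
          have hds := hd0 s (Ioo_subset_Icc_self hs)
          rw [Real.mul_rpow (by positivity) hds.le, ← Real.rpow_mul hs0.le,
            show p * t + q - 1 = p * t + (q - 1) by ring, Real.rpow_add hs0]
          ring
        refine IntegrableOn.congr_fun ?_ (fun s hs => (e2 s hs).symm) measurableSet_Ioo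
        refine Integrable.mul_bdd (c := Cd) (hintpow _ (by linarith)) ?_ ?_
        · exact ContinuousOn.aestronglyMeasurable ((hcontd.rpow_const fun s hs =>
            Or.inl (hd0 s (Ioo_subset_Icc_self hs)).ne').mul hcontk) measurableSet_Ioo
        · exact (ae_restrict_iff' measurableSet_Ioo).2
            (Eventually.of_forall fun s hs => hCd s (Ioo_subset_Icc_self hs))

open Polynomial in
theorem binPMF_eq_eval (M : ℕ) (b : ℝ) (m : ℕ) :
    binPMF M b m = (bernsteinPolynomial ℝ M m).eval b := by
  simp [binPMF, bernsteinPolynomial]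

theorem cast_mul_pred (m : ℕ) : ((m * (m - 1) : ℕ) : ℝ) = m * (m - 1) := by
  cases m <;> simp

theorem sum_binPMF (M : ℕ) (b : ℝ) : ∑ m ∈ Finset.range (M + 1), binPMF M b m = 1 := by
  simp_rw [binPMF_eq_eval, ← Polynomial.eval_finsetSum, bernsteinPolynomial.sum]
  simp

theorem sum_mul_binPMF (M : ℕ) (b : ℝ) :
    ∑ m ∈ Finset.range (M + 1), (m : ℝ) * binPMF M b m = M * b := by
  have h := congrArg (Polynomial.eval b) (bernsteinPolynomial.sum_smul ℝ M)
  simpa [Polynomial.eval_finsetSum, binPMF_eq_eval] using h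

theorem sum_mul_pred_binPMF (M : ℕ) (b : ℝ) :
    ∑ m ∈ Finset.range (M + 1), (m * (m - 1) : ℝ) * binPMF M b m = M * (M - 1) * b ^ 2 := by
  have h := congrArg (Polynomial.eval b) (bernsteinPolynomial.sum_mul_smul ℝ M)
  rw [Polynomial.eval_finsetSum] at h
  simpa only [nsmul_eq_mul, Polynomial.eval_mul, Polynomial.eval_natCast, Polynomial.eval_pow,
    Polynomial.eval_X, cast_mul_pred, ← binPMF_eq_eval] using h

theorem binPMF_nonneg (M m : ℕ) {b : ℝ} (hb : b ∈ Icc (0 : ℝ) 1) : 0 ≤ binPMF M b m := by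
  have := hb.1
  have := sub_nonneg.2 hb.2
  rw [binPMF]
  positivity

theorem binPMF_pos {M m : ℕ} (hm : m ≤ M) {b : ℝ} (hb : b ∈ Ioo (0 : ℝ) 1) :
    0 < binPMF M b m := by
  have := hb.1
  have := sub_pos.2 hb.2
  have : 0 < M.choose m := Nat.choose_pos hm
  rw [binPMF]
  positivity

/-- First-order Taylor coefficient of `b ↦ binPMF M b m` at `bs`. -/
noncomputable def binSlope (M : ℕ) (bs : ℝ) (m : ℕ) : ℝ :=
  (Polynomial.derivative (bernsteinPolynomial ℝ M m)).eval bs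

/-- Second-order Taylor remainder quotient of `b ↦ binPMF M b m` at `bs`. -/
noncomputable def binRem (M : ℕ) (bs : ℝ) (m : ℕ) : Polynomial ℝ :=
  (Polynomial.taylor bs (bernsteinPolynomial ℝ M m)).divX.divX

theorem binPMF_taylor (M : ℕ) (bs b : ℝ) (m : ℕ) :
    binPMF M b m = binPMF M bs m + (b - bs) * binSlope M bs m +
      (b - bs) ^ 2 * (binRem M bs m).eval (b - bs) := by
  set f := Polynomial.taylor bs (bernsteinPolynomial ℝ M m) with hf
  have h1 : f.eval (b - bs) = binPMF M b m := by
    rw [hf, Polynomial.taylor_eval, sub_add_cancel, binPMF_eq_eval]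
  have h2 : f = (f.divX.divX * Polynomial.X + Polynomial.C (f.coeff 1)) * Polynomial.X +
      Polynomial.C (f.coeff 0) := by
    conv_lhs => rw [← Polynomial.divX_mul_X_add f, ← Polynomial.divX_mul_X_add f.divX]
    rw [Polynomial.coeff_divX]
  rw [← h1]
  conv_lhs => rw [h2]
  simp only [Polynomial.eval_add, Polynomial.eval_mul, Polynomial.eval_X, Polynomial.eval_C]
  rw [hf, Polynomial.taylor_coeff_one, Polynomial.taylor_coeff_zero, ← binPMF_eq_eval, binSlope,
    binRem]
  ring

theorem sum_mul_binSlope (M : ℕ) (bs : ℝ) :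
    ∑ m ∈ Finset.range (M + 1), (m : ℝ) * binSlope M bs m = M := by
  have h := congrArg (fun f => (Polynomial.derivative f).eval bs)
    (bernsteinPolynomial.sum_smul ℝ M)
  simpa [Polynomial.eval_finsetSum, binSlope] using h

theorem sum_mul_pred_binSlope (M : ℕ) (bs : ℝ) :
    ∑ m ∈ Finset.range (M + 1), (m * (m - 1) : ℝ) * binSlope M bs m = M * (M - 1) * (2 * bs) := by
  have h := congrArg (fun f => (Polynomial.derivative f).eval bs)
    (bernsteinPolynomial.sum_mul_smul ℝ M)
  simp only [Polynomial.derivative_sum, map_nsmul, Polynomial.eval_finsetSum] at h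
  simp only [nsmul_eq_mul, Polynomial.eval_mul, Polynomial.eval_natCast, cast_mul_pred,
    Polynomial.derivative_X_pow, Polynomial.eval_pow, Polynomial.eval_X, Polynomial.eval_C] at h
  simpa [binSlope] using h

theorem sum_mul_binRem (M : ℕ) (bs u : ℝ) :
    ∑ m ∈ Finset.range (M + 1), (m : ℝ) * (binRem M bs m).eval u = 0 := by
  refine congrFun (Continuous.ext_on (dense_compl_singleton (0 : ℝ))
    (f := fun u => ∑ m ∈ Finset.range (M + 1), (m : ℝ) * (binRem M bs m).eval u)
    (g := fun _ => 0) (by fun_prop) continuous_const fun u hu => ?_) u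
  rw [mem_compl_singleton_iff] at hu
  beta_reduce
  have h := sum_mul_binPMF M (bs + u)
  simp_rw [binPMF_taylor M bs (bs + u), add_sub_cancel_left, mul_add, Finset.sum_add_distrib,
    mul_left_comm _ u, mul_left_comm _ (u ^ 2), ← Finset.mul_sum, sum_mul_binPMF,
    sum_mul_binSlope] at h
  have h2 : u ^ 2 * ∑ m ∈ Finset.range (M + 1), (m : ℝ) * (binRem M bs m).eval u = 0 := by
    linarith
  simpa [hu] using h2

theorem sum_mul_pred_binRem (M : ℕ) (bs u : ℝ) :
    ∑ m ∈ Finset.range (M + 1), (m * (m - 1) : ℝ) * (binRem M bs m).eval u = M * (M - 1) := by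
  refine congrFun (Continuous.ext_on (dense_compl_singleton (0 : ℝ))
    (f := fun u => ∑ m ∈ Finset.range (M + 1), (m * (m - 1) : ℝ) * (binRem M bs m).eval u)
    (g := fun _ => (M * (M - 1) : ℝ)) (by fun_prop) continuous_const fun u hu => ?_) u
  rw [mem_compl_singleton_iff] at hu
  beta_reduce
  have h := sum_mul_pred_binPMF M (bs + u)
  simp_rw [binPMF_taylor M bs (bs + u), add_sub_cancel_left, mul_add, Finset.sum_add_distrib,
    mul_left_comm _ u, mul_left_comm _ (u ^ 2), ← Finset.mul_sum, sum_mul_pred_binPMF,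
    sum_mul_pred_binSlope] at h
  have h2 : u ^ 2 * ∑ m ∈ Finset.range (M + 1), (m * (m - 1) : ℝ) * (binRem M bs m).eval u =
      u ^ 2 * (M * (M - 1)) := by
    linarith
  exact mul_left_cancel₀ (pow_ne_zero 2 hu) h2

/-- A vector is bounded below by its first two factorial moments. -/
theorem exists_moment_lower_bound {M : ℕ} (hM : 2 ≤ M) {bs : ℝ} (hbs : bs ∈ Icc (0 : ℝ) 1) :
    ∃ c > 0, ∀ (t : ℕ → ℝ) (X Y : ℝ),
      ∑ m ∈ Finset.range (M + 1), (m : ℝ) * t m = M * X →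
      ∑ m ∈ Finset.range (M + 1), (m * (m - 1) : ℝ) * t m = M * (M - 1) * (Y + 2 * bs * X) →
      c * (X ^ 2 + Y ^ 2) ≤ ∑ m ∈ Finset.range (M + 1), t m ^ 2 := by
  set S₁ : ℝ := ∑ m ∈ Finset.range (M + 1), (m : ℝ) ^ 2
  set S₂ : ℝ := ∑ m ∈ Finset.range (M + 1), (m * (m - 1) : ℝ) ^ 2
  have hS₁ : 0 ≤ S₁ := by positivity
  have hS₂ : 0 ≤ S₂ := by positivity
  refine ⟨1 / (2 * S₂ + 9 * S₁ + 1), by positivity, fun t X Y h1 h2 => ?_⟩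
  set T := ∑ m ∈ Finset.range (M + 1), t m ^ 2
  have hT : 0 ≤ T := by positivity
  have hM' : (2 : ℝ) ≤ M := by exact_mod_cast hM
  have b1 : (M * X) ^ 2 ≤ S₁ * T := by
    rw [← h1]
    exact Finset.sum_mul_sq_le_sq_mul_sq _ _ _
  have b2 : (M * (M - 1) * (Y + 2 * bs * X)) ^ 2 ≤ S₂ * T := by
    rw [← h2]
    exact Finset.sum_mul_sq_le_sq_mul_sq _ _ _
  have c1 : X ^ 2 ≤ S₁ * T := by
    refine le_trans ?_ b1
    rw [mul_pow]
    exact le_mul_of_one_le_left (sq_nonneg _) (by nlinarith)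
  have c2 : (Y + 2 * bs * X) ^ 2 ≤ S₂ * T := by
    refine le_trans ?_ b2
    rw [mul_pow (M * (M - 1) : ℝ)]
    exact le_mul_of_one_le_left (sq_nonneg _) (one_le_pow₀ (by nlinarith))
  have c3 : (2 * bs * X) ^ 2 ≤ 4 * X ^ 2 := by
    have : bs ^ 2 ≤ 1 := pow_le_one₀ hbs.1 hbs.2
    nlinarith [sq_nonneg X]
  have c4 : Y ^ 2 ≤ 2 * (Y + 2 * bs * X) ^ 2 + 2 * (2 * bs * X) ^ 2 := by
    nlinarith [sq_nonneg (Y + 2 * (2 * bs * X))]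
  rw [div_mul_eq_mul_div, one_mul, div_le_iff₀ (by positivity)]
  nlinarith

theorem sq_sub_le_kl_term {p q : ℝ} (hp : 0 < p) (hp1 : p ≤ 1) (hq : 0 < q) (hq1 : q ≤ 1) :
    (p - q) ^ 2 / 4 ≤ q * Real.log (q / p) - q + p := by
  obtain ⟨P, hP, rfl⟩ : ∃ P : ℝ, 0 < P ∧ p = P ^ 2 :=
    ⟨√p, Real.sqrt_pos.2 hp, (Real.sq_sqrt hp.le).symm⟩
  obtain ⟨Q, hQ, rfl⟩ : ∃ Q : ℝ, 0 < Q ∧ q = Q ^ 2 :=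
    ⟨√q, Real.sqrt_pos.2 hq, (Real.sq_sqrt hq.le).symm⟩
  have hP1 : P ≤ 1 := by nlinarith
  have hQ1 : Q ≤ 1 := by nlinarith
  have h1 := Real.log_le_sub_one_of_pos (div_pos hP hQ)
  have h2 : Real.log (Q ^ 2 / P ^ 2) = -2 * Real.log (P / Q) := by
    rw [← div_pow, Real.log_pow, ← inv_div, Real.log_inv]
    push_cast
    ring
  have h3 : Q ^ 2 * (P / Q) = Q * P := by field_simp
  have h4 : (P - Q) ^ 2 ≤ Q ^ 2 * Real.log (Q ^ 2 / P ^ 2) - Q ^ 2 + P ^ 2 := by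
    rw [h2]
    nlinarith [mul_le_mul_of_nonneg_left h1 (sq_nonneg Q)]
  refine le_trans ?_ h4
  have h5 : (P + Q) ^ 2 ≤ 4 := by nlinarith
  have h6 : (P ^ 2 - Q ^ 2) ^ 2 = (P - Q) ^ 2 * (P + Q) ^ 2 := by ring
  rw [h6]
  nlinarith [sq_nonneg (P - Q)]

theorem abs_kl_term_sub_le {p q : ℝ} (hq : 0 < q) (h : |p - q| ≤ q / 2) :
    |q * Real.log (q / p) - q + p - (p - q) ^ 2 / (2 * q)| ≤ 2 * |p - q| ^ 3 / q ^ 2 := by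
  set s := (q - p) / q with hs
  have hs1 : |s| ≤ 1 / 2 := by
    rw [hs, abs_div, abs_of_pos hq, abs_sub_comm, div_le_iff₀ hq]
    linarith
  have hp : p = q * (1 - s) := by rw [hs]; field_simp; ring
  have h1 := Real.abs_log_sub_add_sum_range_le (x := s) (by linarith) 2
  have h2 : Real.log (q / p) = -Real.log (1 - s) := by
    rw [hp, ← Real.log_inv]
    congr 1
    field_simp
  have h3 : q * Real.log (q / p) - q + p - (p - q) ^ 2 / (2 * q) =
      -q * ((∑ i ∈ Finset.range 2, s ^ (i + 1) / (i + 1)) + Real.log (1 - s)) := by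
    rw [h2, hp]
    simp [Finset.sum_range_succ]
    field_simp
    ring
  have h4 : |p - q| = q * |s| := by
    rw [hp, show q * (1 - s) - q = -(q * s) by ring, abs_neg, abs_mul, abs_of_pos hq]
  rw [h3, abs_mul, abs_neg, abs_of_pos hq, h4]
  have h5 : |s| ^ (2 + 1) / (1 - |s|) ≤ 2 * |s| ^ 3 := by
    rw [div_le_iff₀ (by linarith)]
    have h6 : 0 ≤ |s| ^ 3 * (1 / 2 - |s|) :=
      mul_nonneg (pow_nonneg (abs_nonneg s) 3) (sub_nonneg.2 hs1)
    have h7 : |s| ^ (2 + 1) = 2 * |s| ^ 3 * (1 - |s|) - 2 * (|s| ^ 3 * (1 / 2 - |s|)) := by ring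
    rw [h7]
    linarith
  calc _ ≤ q * (2 * |s| ^ 3) := by
        gcongr
        exact h1.trans h5
    _ = _ := by field_simp

theorem sum_binMix (M : ℕ) (w : ℝ × ℝ × ℝ) : ∑ m ∈ Finset.range (M + 1), binMix M w m = 1 := by
  simp_rw [binMix, Finset.sum_add_distrib, ← Finset.mul_sum, sum_binPMF]
  ring

theorem binMix_nonneg (M m : ℕ) {w : ℝ × ℝ × ℝ} (ha : w.1 ∈ Icc (0 : ℝ) 1)
    (h₁ : w.2.1 ∈ Icc (0 : ℝ) 1) (h₂ : w.2.2 ∈ Icc (0 : ℝ) 1) : 0 ≤ binMix M w m := by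
  have := ha.1
  have := sub_nonneg.2 ha.2
  have := binPMF_nonneg M m h₁
  have := binPMF_nonneg M m h₂
  rw [binMix]
  positivity

theorem binMixKL_eq_sum (M : ℕ) (bs : ℝ) (w : ℝ × ℝ × ℝ) :
    binMixKL M bs w = ∑ m ∈ Finset.range (M + 1),
      (binPMF M bs m * Real.log (binPMF M bs m / binMix M w m) - binPMF M bs m + binMix M w m) := by
  rw [Finset.sum_add_distrib, Finset.sum_sub_distrib, sum_binPMF, sum_binMix, binMixKL]
  ring

theorem binPMF_le_one {M m : ℕ} (hm : m ∈ Finset.range (M + 1)) {b : ℝ} (hb : b ∈ Icc (0 : ℝ) 1) :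
    binPMF M b m ≤ 1 := by
  rw [← sum_binPMF M b]
  exact Finset.single_le_sum (f := fun m => binPMF M b m) (fun i _ => binPMF_nonneg M i hb) hm

theorem binMix_le_one {M m : ℕ} (hm : m ∈ Finset.range (M + 1)) {w : ℝ × ℝ × ℝ}
    (ha : w.1 ∈ Icc (0 : ℝ) 1) (h₁ : w.2.1 ∈ Icc (0 : ℝ) 1) (h₂ : w.2.2 ∈ Icc (0 : ℝ) 1) :
    binMix M w m ≤ 1 := by
  rw [← sum_binMix M w]
  exact Finset.single_le_sum (f := fun m => binMix M w m)
    (fun i _ => binMix_nonneg M i ha h₁ h₂) hm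

theorem sum_sq_le_binMixKL {M : ℕ} {bs : ℝ} (hbs : bs ∈ Ioo (0 : ℝ) 1) {w : ℝ × ℝ × ℝ}
    (ha : w.1 ∈ Icc (0 : ℝ) 1) (h₁ : w.2.1 ∈ Icc (0 : ℝ) 1) (h₂ : w.2.2 ∈ Icc (0 : ℝ) 1)
    (hpos : ∀ m ∈ Finset.range (M + 1), 0 < binMix M w m) :
    (∑ m ∈ Finset.range (M + 1), (binMix M w m - binPMF M bs m) ^ 2) / 4 ≤ binMixKL M bs w := by
  rw [binMixKL_eq_sum, Finset.sum_div]
  exact Finset.sum_le_sum fun m hm => sq_sub_le_kl_term (hpos m hm) (binMix_le_one hm ha h₁ h₂)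
    (binPMF_pos (by simpa [Nat.lt_succ_iff] using hm) hbs)
    (binPMF_le_one hm (Ioo_subset_Icc_self hbs))

/-- First-moment coordinate of the mixture at `bs`. -/
noncomputable def mixX (bs : ℝ) (w : ℝ × ℝ × ℝ) : ℝ :=
  w.1 * (w.2.1 - bs) + (1 - w.1) * (w.2.2 - bs)

/-- Second-moment coordinate of the mixture along `mixX = 0`. -/
noncomputable def mixY (bs : ℝ) (w : ℝ × ℝ × ℝ) : ℝ := w.1 * (w.2.1 - bs) ^ 2 / (1 - w.1)

/-- Size of the mixture parameters, measuring the quality of the quadratic approximation. -/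
noncomputable def mixR (bs : ℝ) (w : ℝ × ℝ × ℝ) : ℝ := |mixX bs w| + w.1 * |w.2.1 - bs|

/-- Quadratic lower bound for the divergence, up to a constant. -/
noncomputable def mixQ (bs : ℝ) (w : ℝ × ℝ × ℝ) : ℝ :=
  mixX bs w ^ 2 + (w.1 * (w.2.1 - bs) ^ 2) ^ 2

/-- Coefficient of `x ^ 2` in the quadratic model. -/
noncomputable def modelA (M : ℕ) (bs : ℝ) : ℝ :=
  ∑ m ∈ Finset.range (M + 1), binSlope M bs m ^ 2 / (2 * binPMF M bs m)

/-- Half of the coefficient of `x * y` in the quadratic model. -/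
noncomputable def modelB (M : ℕ) (bs u : ℝ) : ℝ :=
  ∑ m ∈ Finset.range (M + 1), binSlope M bs m * (binRem M bs m).eval u / (2 * binPMF M bs m)

/-- Coefficient of `y ^ 2` in the quadratic model. -/
noncomputable def modelC (M : ℕ) (bs u : ℝ) : ℝ :=
  ∑ m ∈ Finset.range (M + 1), (binRem M bs m).eval u ^ 2 / (2 * binPMF M bs m)

/-- Reduced discriminant of the quadratic model. -/
noncomputable def modelD (M : ℕ) (bs u : ℝ) : ℝ :=
  modelC M bs u - modelB M bs u ^ 2 / modelA M bs

/-- Quadratic model of the divergence. -/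
noncomputable def modelForm (M : ℕ) (bs u x y : ℝ) : ℝ :=
  ∑ m ∈ Finset.range (M + 1),
    (x * binSlope M bs m + y * (binRem M bs m).eval u) ^ 2 / (2 * binPMF M bs m)

theorem modelForm_eq (M : ℕ) (bs u x y : ℝ) :
    modelForm M bs u x y =
      modelA M bs * x ^ 2 + 2 * modelB M bs u * x * y + modelC M bs u * y ^ 2 := by
  simp only [modelForm, modelA, modelB, modelC, Finset.sum_mul, Finset.mul_sum,
    ← Finset.sum_add_distrib]
  refine Finset.sum_congr rfl fun m _ => ?_
  ring

theorem mem_range_succ_le {M m : ℕ} (hm : m ∈ Finset.range (M + 1)) : m ≤ M :=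
  Nat.lt_succ_iff.1 (Finset.mem_range.1 hm)

theorem exists_modelForm_lower_bound {M : ℕ} (hM : 2 ≤ M) {bs : ℝ} (hbs : bs ∈ Ioo (0 : ℝ) 1) :
    ∃ c > 0, ∀ u x y : ℝ, c * (x ^ 2 + y ^ 2) ≤ modelForm M bs u x y := by
  obtain ⟨c, hc, h⟩ := exists_moment_lower_bound hM (Ioo_subset_Icc_self hbs)
  refine ⟨c / 2, by positivity, fun u x y => ?_⟩
  have h1 := h (fun m => x * binSlope M bs m + y * (binRem M bs m).eval u) x y
    (by
      simp_rw [mul_add, mul_left_comm _ x, mul_left_comm _ y, Finset.sum_add_distrib,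
        ← Finset.mul_sum, sum_mul_binSlope, sum_mul_binRem]
      ring)
    (by
      simp_rw [mul_add, mul_left_comm _ x, mul_left_comm _ y, Finset.sum_add_distrib,
        ← Finset.mul_sum, sum_mul_pred_binSlope, sum_mul_pred_binRem]
      ring)
  have h2 : (∑ m ∈ Finset.range (M + 1),
      (x * binSlope M bs m + y * (binRem M bs m).eval u) ^ 2) / 2 ≤ modelForm M bs u x y := by
    rw [modelForm, Finset.sum_div]
    refine Finset.sum_le_sum fun m hm => ?_
    have := binPMF_pos (mem_range_succ_le hm) hbs
    have := binPMF_le_one hm (Ioo_subset_Icc_self hbs)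
    gcongr
    linarith
  linarith

theorem modelA_pos {M : ℕ} (hM : 2 ≤ M) {bs : ℝ} (hbs : bs ∈ Ioo (0 : ℝ) 1) :
    0 < modelA M bs := by
  obtain ⟨c, hc, h⟩ := exists_modelForm_lower_bound hM hbs
  have := h 0 1 0
  rw [modelForm_eq] at this
  linarith

theorem modelD_pos {M : ℕ} (hM : 2 ≤ M) {bs : ℝ} (hbs : bs ∈ Ioo (0 : ℝ) 1) (u : ℝ) :
    0 < modelD M bs u := by
  obtain ⟨c, hc, h⟩ := exists_modelForm_lower_bound hM hbs
  have hA := modelA_pos hM hbs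
  have h1 := h u (-(modelB M bs u / modelA M bs)) 1
  rw [modelForm_eq] at h1
  have h2 : modelD M bs u = modelA M bs * (-(modelB M bs u / modelA M bs)) ^ 2 +
      2 * modelB M bs u * (-(modelB M bs u / modelA M bs)) * 1 + modelC M bs u * 1 ^ 2 := by
    rw [modelD]
    field_simp
    ring
  rw [h2]
  refine lt_of_lt_of_le ?_ h1
  positivity

theorem contDiff_modelD (M : ℕ) (bs : ℝ) : ContDiff ℝ 1 (modelD M bs) := by
  have h : ∀ m, ContDiff ℝ 1 fun u => (binRem M bs m).eval u := fun m =>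
    (binRem M bs m).contDiff_aeval 1
  unfold modelD modelC modelB
  fun_prop

theorem modelForm_mix_eq {M : ℕ} (hM : 2 ≤ M) {bs : ℝ} (hbs : bs ∈ Ioo (0 : ℝ) 1) {a b₁ b₂ : ℝ}
    (ha : a < 1) :
    modelForm M bs (b₁ - bs) (mixX bs (a, b₁, b₂)) (mixY bs (a, b₁, b₂)) =
      (√(modelA M bs) * (1 - a)) ^ 2 * (b₂ + ((a * (b₁ - bs) + modelB M bs (b₁ - bs) *
        mixY bs (a, b₁, 0) / modelA M bs) / (1 - a) - bs)) ^ 2 +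
        (√(modelD M bs (b₁ - bs)) * mixY bs (a, b₁, 0)) ^ 2 := by
  have hA := modelA_pos hM hbs
  have hD := modelD_pos hM hbs (b₁ - bs)
  have h1 : 1 - a ≠ 0 := by linarith
  rw [modelForm_eq, mul_pow, mul_pow, Real.sq_sqrt hA.le, Real.sq_sqrt hD.le, modelD]
  simp only [mixX, mixY]
  field_simp
  ring

theorem exists_binMixKL_lower_bound {M : ℕ} (hM : 2 ≤ M) {bs : ℝ} (hbs : bs ∈ Ioo (0 : ℝ) 1) :
    ∃ c > 0, ∀ w : ℝ × ℝ × ℝ, w.1 ∈ Icc (0 : ℝ) 1 → w.2.1 ∈ Icc (0 : ℝ) 1 →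
      w.2.2 ∈ Icc (0 : ℝ) 1 → (∀ m ∈ Finset.range (M + 1), 0 < binMix M w m) →
      c * mixQ bs w ≤ binMixKL M bs w := by
  obtain ⟨c, hc, h⟩ := exists_moment_lower_bound hM (Ioo_subset_Icc_self hbs)
  refine ⟨c / 4, by positivity, fun w ha h₁ h₂ hpos => ?_⟩
  have h1 := h (fun m => binMix M w m - binPMF M bs m) (mixX bs w)
    (w.1 * (w.2.1 - bs) ^ 2 + (1 - w.1) * (w.2.2 - bs) ^ 2)
    (by
      simp_rw [binMix, mul_sub, mul_add, mul_left_comm _ w.1, mul_left_comm _ (1 - w.1),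
        Finset.sum_sub_distrib, Finset.sum_add_distrib, ← Finset.mul_sum, sum_mul_binPMF, mixX]
      ring)
    (by
      simp_rw [binMix, mul_sub (_ * _ : ℝ) (_ + _ : ℝ), mul_add, mul_left_comm _ w.1,
        mul_left_comm _ (1 - w.1),
        Finset.sum_sub_distrib, Finset.sum_add_distrib, ← Finset.mul_sum, sum_mul_pred_binPMF, mixX]
      ring)
  have h2 := sum_sq_le_binMixKL hbs ha h₁ h₂ hpos
  have h3 : mixQ bs w ≤ mixX bs w ^ 2 +
      (w.1 * (w.2.1 - bs) ^ 2 + (1 - w.1) * (w.2.2 - bs) ^ 2) ^ 2 := by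
    have := ha.1
    have := sub_nonneg.2 ha.2
    rw [mixQ]
    gcongr
    exact le_add_of_nonneg_right (by positivity)
  have h4 := mul_le_mul_of_nonneg_left h3 hc.le
  linarith

theorem exists_binRem_bound (M : ℕ) (bs : ℝ) :
    ∃ K ≥ 1, ∀ m ∈ Finset.range (M + 1), |binSlope M bs m| ≤ K ∧
      ∀ u ∈ Icc (-1 : ℝ) 1, |(binRem M bs m).eval u| ≤ K ∧
        |(binRem M bs m).eval u - (binRem M bs m).eval 0| ≤ K * |u| := by
  have hpoly : ∀ p : Polynomial ℝ, ∃ K ≥ 0, ∀ u ∈ Icc (-1 : ℝ) 1, |p.eval u| ≤ K := by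
    intro p
    obtain ⟨K, hK⟩ := isCompact_Icc.exists_bound_of_continuousOn
      (p.continuous.continuousOn (s := Icc (-1 : ℝ) 1))
    exact ⟨max K 0, le_max_right _ _, fun u hu => (hK u hu).trans (le_max_left _ _)⟩
  choose K₁ hK₁ hK₁' using fun m => hpoly (binRem M bs m)
  choose K₂ hK₂ hK₂' using fun m => hpoly (binRem M bs m).divX
  have hsum : 0 ≤ ∑ m ∈ Finset.range (M + 1), (|binSlope M bs m| + K₁ m + K₂ m) :=
    Finset.sum_nonneg fun m _ => by have := hK₁ m; have := hK₂ m; positivity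
  refine ⟨1 + ∑ m ∈ Finset.range (M + 1), (|binSlope M bs m| + K₁ m + K₂ m), by linarith,
    fun m hm => ?_⟩
  have h1 : |binSlope M bs m| + K₁ m + K₂ m ≤
      ∑ m ∈ Finset.range (M + 1), (|binSlope M bs m| + K₁ m + K₂ m) :=
    Finset.single_le_sum (f := fun m => |binSlope M bs m| + K₁ m + K₂ m)
      (fun m _ => by have := hK₁ m; have := hK₂ m; positivity) hm
  have h2 := hK₁ m
  have h3 := hK₂ m
  have h4 := abs_nonneg (binSlope M bs m)
  refine ⟨by linarith, fun u hu => ⟨by linarith [hK₁' m u hu], ?_⟩⟩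
  have h5 : (binRem M bs m).eval u - (binRem M bs m).eval 0 = (binRem M bs m).divX.eval u * u := by
    conv_lhs => rw [← Polynomial.divX_mul_X_add (binRem M bs m)]
    simp
  rw [h5, abs_mul]
  gcongr
  linarith [hK₂' m u hu]

theorem abs_quadratic_remainder_le {K a u v x y r Wu Wv W0 : ℝ} (ha : 0 ≤ a) (ha2 : a ≤ 1 / 2)
    (hK : 1 ≤ K) (hx : x = a * u + (1 - a) * v) (hy : y = a * u ^ 2 / (1 - a))
    (hr : r = |x| + a * |u|) (hWv : |Wv| ≤ K)
    (hWu0 : |Wu - W0| ≤ K * |u|) (hWv0 : |Wv - W0| ≤ K * |v|) :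
    |a * u ^ 2 * Wu + (1 - a) * v ^ 2 * Wv - y * Wu| ≤ 4 * K * r * (|x| + y) := by
  have ha1 : (0 : ℝ) < 1 - a := by linarith
  have hy0 : 0 ≤ y := by rw [hy]; positivity
  have hr0 : 0 ≤ r := by rw [hr]; positivity
  have hv : v = (x - a * u) / (1 - a) := by rw [hx]; field_simp; ring
  have hvr : |v| ≤ 2 * r := by
    rw [hv, abs_div, abs_of_pos ha1, div_le_iff₀ ha1]
    have h1 : |x - a * u| ≤ r := by
      rw [hr]
      refine (abs_sub _ _).trans_eq ?_
      rw [abs_mul, abs_of_nonneg ha]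
    nlinarith
  have e1 : a * u ^ 2 * Wu + (1 - a) * v ^ 2 * Wv - y * Wu =
      x * (x - 2 * (a * u)) / (1 - a) * Wv + a * y * (Wv - Wu) := by
    rw [hy, hv]
    field_simp
    ring
  have h1 : |x * (x - 2 * (a * u)) / (1 - a)| ≤ 4 * r * |x| := by
    rw [abs_div, abs_of_pos ha1, div_le_iff₀ ha1, abs_mul]
    have h2 : |x - 2 * (a * u)| ≤ 2 * r := by
      refine (abs_sub _ _).trans ?_
      rw [abs_mul, abs_mul, abs_of_nonneg ha, hr, abs_two]
      linarith [abs_nonneg x]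
    have h3 := mul_le_mul_of_nonneg_left h2 (abs_nonneg x)
    nlinarith [mul_nonneg hr0 (abs_nonneg x)]
  have h2 : a * |Wv - Wu| ≤ 2 * K * r := by
    have h3 : |Wv - Wu| ≤ K * |v| + K * |u| := by
      have := abs_sub_le Wv W0 Wu
      rw [abs_sub_comm W0] at this
      linarith
    have h4 : a * |v| ≤ r := by nlinarith [abs_nonneg v]
    have h5 : a * |u| ≤ r := by rw [hr]; linarith [abs_nonneg x]
    calc a * |Wv - Wu| ≤ a * (K * |v| + K * |u|) := by gcongr
      _ = K * (a * |v|) + K * (a * |u|) := by ring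
      _ ≤ K * r + K * r := by gcongr
      _ = _ := by ring
  rw [e1]
  calc _ ≤ |x * (x - 2 * (a * u)) / (1 - a) * Wv| + |a * y * (Wv - Wu)| := abs_add_le _ _
    _ = |x * (x - 2 * (a * u)) / (1 - a)| * |Wv| + y * (a * |Wv - Wu|) := by
      rw [abs_mul, abs_mul (a * y), abs_of_nonneg (by positivity : 0 ≤ a * y)]
      ring
    _ ≤ 4 * r * |x| * K + y * (2 * K * r) := by gcongr
    _ ≤ _ := by nlinarith [mul_nonneg (mul_nonneg hy0 hr0) (by linarith : 0 ≤ K)]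

/-- Quadratic model of the divergence of the mixture. -/
noncomputable def modelKL (M : ℕ) (bs : ℝ) (w : ℝ × ℝ × ℝ) : ℝ :=
  modelForm M bs (w.2.1 - bs) (mixX bs w) (mixY bs w)

theorem exists_abs_binMixKL_sub_modelKL_le {M : ℕ} (hM : 2 ≤ M) {bs : ℝ}
    (hbs : bs ∈ Ioo (0 : ℝ) 1) :
    ∃ C > 0, ∃ δ > 0, ∀ w : ℝ × ℝ × ℝ, w.1 ∈ Icc (0 : ℝ) (1 / 2) → w.2.1 ∈ Icc (0 : ℝ) 1 →
      w.2.2 ∈ Icc (0 : ℝ) 1 → mixR bs w ≤ δ →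
      |binMixKL M bs w - modelKL M bs w| ≤ C * mixR bs w * modelKL M bs w := by
  obtain ⟨K, hK, hKb⟩ := exists_binRem_bound M bs
  obtain ⟨c, hc, hcb⟩ := exists_modelForm_lower_bound hM hbs
  obtain ⟨κ, hκ, hκb⟩ : ∃ κ > 0, ∀ m ∈ Finset.range (M + 1), κ ≤ binPMF M bs m := by
    obtain ⟨m₀, hm₀, h⟩ := Finset.exists_min_image (Finset.range (M + 1)) (binPMF M bs)
      ⟨0, by simp⟩
    exact ⟨_, binPMF_pos (mem_range_succ_le hm₀) hbs, h⟩
  have hK0 : 0 < K := by linarith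
  refine ⟨(M + 1) * (48 * K ^ 3 / κ ^ 2 + 6 * K ^ 2 / κ) * (2 / c), by positivity,
    min (1 / 4) (κ / (12 * K)), by positivity, fun ⟨a, b₁, b₂⟩ ha h₁ h₂ hr => ?_⟩
  simp only at ha h₁ h₂
  set x := mixX bs (a, b₁, b₂) with hx
  set y := mixY bs (a, b₁, b₂) with hy
  set r := mixR bs (a, b₁, b₂) with hrdef
  have ha1 : (0 : ℝ) < 1 - a := by linarith [ha.2]
  have hy0 : 0 ≤ y := by
    have := ha.1
    simp only [hy, mixY]
    positivity
  have hu : b₁ - bs ∈ Icc (-1 : ℝ) 1 := ⟨by linarith [h₁.1, hbs.2], by linarith [h₁.2, hbs.1]⟩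
  have hv : b₂ - bs ∈ Icc (-1 : ℝ) 1 := ⟨by linarith [h₂.1, hbs.2], by linarith [h₂.2, hbs.1]⟩
  have hr1 : r ≤ 1 / 4 := hr.trans (min_le_left _ _)
  have hr2 : 12 * K * r ≤ κ := by
    have := hr.trans (min_le_right _ _)
    rw [le_div_iff₀ (by positivity)] at this
    linarith
  have hr0 : 0 ≤ r := by
    have := ha.1
    simp only [hrdef, mixR]
    positivity
  have hyr : y ≤ 2 * (a * |b₁ - bs|) := by
    simp only [hy, mixY]
    rw [div_le_iff₀ ha1, ← sq_abs]
    have h1 : |b₁ - bs| ≤ 1 := abs_le.2 hu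
    have h2 := mul_nonneg ha.1 (abs_nonneg (b₁ - bs))
    nlinarith [ha.2]
  have hNr : |x| + y ≤ 3 * r := by
    have : r = |x| + a * |b₁ - bs| := rfl
    have := abs_nonneg x
    have := mul_nonneg ha.1 (abs_nonneg (b₁ - bs))
    linarith
  set N := |x| + y with hN
  have hN0 : 0 ≤ N := by positivity
  have hterm : ∀ m ∈ Finset.range (M + 1),
      |binPMF M bs m * Real.log (binPMF M bs m / binMix M (a, b₁, b₂) m) - binPMF M bs m +
        binMix M (a, b₁, b₂) m -
        (x * binSlope M bs m + y * (binRem M bs m).eval (b₁ - bs)) ^ 2 / (2 * binPMF M bs m)| ≤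
      (48 * K ^ 3 / κ ^ 2 + 6 * K ^ 2 / κ) * (r * N ^ 2) := by
    intro m hm
    obtain ⟨hd, hW⟩ := hKb m hm
    have hq := hκb m hm
    have hq0 := hκ.trans_le hq
    set q := binPMF M bs m
    set p := binMix M (a, b₁, b₂) m with hp
    set L := x * binSlope M bs m + y * (binRem M bs m).eval (b₁ - bs) with hL
    have hLN : |L| ≤ K * N := by
      rw [hL, hN, mul_add]
      refine (abs_add_le _ _).trans ?_
      rw [abs_mul, abs_mul, abs_of_nonneg hy0, mul_comm K, mul_comm K]
      have := (hW _ hu).1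
      gcongr
    have he : |p - q - L| ≤ 4 * K * r * N := by
      have h := abs_quadratic_remainder_le ha.1 ha.2 hK (x := x) (y := y) (r := r)
        (u := b₁ - bs) (v := b₂ - bs) rfl rfl rfl
        (hW _ hv).1 (hW _ hu).2 (hW _ hv).2
      convert h using 2
      rw [hp, hL, binMix]
      simp only
      rw [binPMF_taylor M bs b₁, binPMF_taylor M bs b₂, hx, mixX]
      ring
    have h4 : 4 * K * r * N ≤ K * N := by
      have := mul_nonneg hK0.le hN0
      nlinarith
    have hpq : |p - q| ≤ 2 * K * N := by
      have h3 : |p - q| ≤ |p - q - L| + |L| := by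
        simpa using abs_add_le (p - q - L) L
      linarith
    have hpq2 : |p - q| ≤ q / 2 := by nlinarith
    have hsum : |p - q + L| ≤ 3 * K * N := by
      refine (abs_add_le _ _).trans ?_
      linarith
    have t1 : |q * Real.log (q / p) - q + p - (p - q) ^ 2 / (2 * q)| ≤
        48 * K ^ 3 / κ ^ 2 * (r * N ^ 2) := by
      refine (abs_kl_term_sub_le hq0 hpq2).trans ?_
      calc 2 * |p - q| ^ 3 / q ^ 2 ≤ 2 * (2 * K * N) ^ 3 / κ ^ 2 := by gcongr
        _ = 16 * K ^ 3 / κ ^ 2 * (N * N ^ 2) := by ring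
        _ ≤ 16 * K ^ 3 / κ ^ 2 * (3 * r * N ^ 2) := by gcongr
        _ = _ := by ring
    have t2 : |((p - q) ^ 2 - L ^ 2) / (2 * q)| ≤ 6 * K ^ 2 / κ * (r * N ^ 2) := by
      rw [show (p - q) ^ 2 - L ^ 2 = (p - q - L) * (p - q + L) by ring, abs_div, abs_mul,
        abs_of_pos (by positivity : 0 < 2 * q)]
      calc _ ≤ (4 * K * r * N) * (3 * K * N) / (2 * κ) := by gcongr
        _ = _ := by field_simp; ring
    have e : q * Real.log (q / p) - q + p - L ^ 2 / (2 * q) =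
        (q * Real.log (q / p) - q + p - (p - q) ^ 2 / (2 * q)) +
          ((p - q) ^ 2 - L ^ 2) / (2 * q) := by ring
    rw [e, add_mul]
    exact (abs_add_le _ _).trans (add_le_add t1 t2)
  have hN2 : N ^ 2 ≤ 2 / c * modelKL M bs (a, b₁, b₂) := by
    have h1 : N ^ 2 ≤ 2 * (x ^ 2 + y ^ 2) := by
      rw [hN, ← sq_abs x]
      nlinarith [sq_nonneg (|x| - y)]
    have h2 : c * (x ^ 2 + y ^ 2) ≤ modelKL M bs (a, b₁, b₂) := hcb (b₁ - bs) x y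
    rw [div_mul_eq_mul_div, le_div_iff₀ hc]
    nlinarith
  have hKL : binMixKL M bs (a, b₁, b₂) - modelKL M bs (a, b₁, b₂) =
      ∑ m ∈ Finset.range (M + 1),
      (binPMF M bs m * Real.log (binPMF M bs m / binMix M (a, b₁, b₂) m) - binPMF M bs m +
        binMix M (a, b₁, b₂) m -
        (x * binSlope M bs m + y * (binRem M bs m).eval (b₁ - bs)) ^ 2 /
          (2 * binPMF M bs m)) := by
    rw [Finset.sum_sub_distrib, ← binMixKL_eq_sum]
    rfl
  rw [hKL]
  refine (Finset.abs_sum_le_sum_abs _ _).trans ((Finset.sum_le_sum hterm).trans ?_)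
  rw [Finset.sum_const, Finset.card_range, nsmul_eq_mul]
  push_cast
  calc _ ≤ (M + 1 : ℝ) * ((48 * K ^ 3 / κ ^ 2 + 6 * K ^ 2 / κ) *
        (r * (2 / c * modelKL M bs (a, b₁, b₂)))) := by gcongr
    _ = _ := by ring

theorem exists_modelKL_lower_bound {M : ℕ} (hM : 2 ≤ M) {bs : ℝ} (hbs : bs ∈ Ioo (0 : ℝ) 1) :
    ∃ c > 0, ∀ w : ℝ × ℝ × ℝ, w.1 ∈ Ico (0 : ℝ) 1 → c * mixQ bs w ≤ modelKL M bs w := by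
  obtain ⟨c, hc, h⟩ := exists_modelForm_lower_bound hM hbs
  refine ⟨c, hc, fun w hw => le_trans ?_ (h _ _ _)⟩
  rw [mixQ]
  have h0 := hw.1
  have h1 := sub_pos.2 hw.2
  gcongr
  rw [mixY]
  exact le_div_self (by positivity) h1 (by linarith)

theorem binMix_pos {M m : ℕ} (hm : m ∈ Finset.range (M + 1)) {w : ℝ × ℝ × ℝ}
    (ha : w.1 ∈ Ico (0 : ℝ) 1) (h₁ : w.2.1 ∈ Icc (0 : ℝ) 1) (h₂ : w.2.2 ∈ Ioo (0 : ℝ) 1) :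
    0 < binMix M w m :=
  add_pos_of_nonneg_of_pos (mul_nonneg ha.1 (binPMF_nonneg M m h₁))
    (mul_pos (sub_pos.2 ha.2) (binPMF_pos (mem_range_succ_le hm) h₂))

theorem binMixKL_le {M : ℕ} {bs : ℝ} (hbs : bs ∈ Ioo (0 : ℝ) 1) {w : ℝ × ℝ × ℝ}
    (ha : w.1 ∈ Icc (0 : ℝ) (1 / 2)) (h₁ : w.2.1 ∈ Icc (0 : ℝ) 1) (h₂ : w.2.2 ∈ Ioo (0 : ℝ) 1) :
    binMixKL M bs w ≤ (M + 1) * (Real.log 2 - M * Real.log (w.2.2 * (1 - w.2.2))) := by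
  have hb := h₂.1
  have hb' := sub_pos.2 h₂.2
  set t := w.2.2 * (1 - w.2.2) with ht
  have ht0 : 0 < t := mul_pos hb hb'
  have hL : 0 ≤ Real.log 2 - M * Real.log t := by
    have h1 : Real.log t ≤ 0 := Real.log_nonpos ht0.le (by rw [ht]; nlinarith [h₂.2])
    have h2 : 0 ≤ Real.log 2 := Real.log_nonneg (by norm_num)
    have h3 := mul_nonneg (Nat.cast_nonneg (α := ℝ) M) (neg_nonneg.2 h1)
    linarith
  have hterm : ∀ m ∈ Finset.range (M + 1),
      binPMF M bs m * Real.log (binPMF M bs m / binMix M w m) ≤ Real.log 2 - M * Real.log t := by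
    intro m hm
    have hq0 := binPMF_pos (mem_range_succ_le hm) hbs
    have hq1 := binPMF_le_one hm (Ioo_subset_Icc_self hbs)
    have hp : t ^ M / 2 ≤ binMix M w m := by
      have h1 : t ^ M ≤ binPMF M w.2.2 m := by
        rw [ht, mul_pow, binPMF, mul_assoc]
        have hch : (1 : ℝ) ≤ M.choose m := by
          exact_mod_cast Nat.choose_pos (mem_range_succ_le hm)
        have h3 : w.2.2 ^ M ≤ w.2.2 ^ m :=
          pow_le_pow_of_le_one hb.le h₂.2.le (mem_range_succ_le hm)
        have h4 : (1 - w.2.2) ^ M ≤ (1 - w.2.2) ^ (M - m) :=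
          pow_le_pow_of_le_one hb'.le (by linarith) (Nat.sub_le _ _)
        refine le_trans ?_ (le_mul_of_one_le_left (by positivity) hch)
        gcongr
      have h2 := mul_nonneg ha.1 (binPMF_nonneg M m h₁)
      have h5 : 0 ≤ t ^ M := by positivity
      rw [binMix]
      nlinarith [ha.2]
    have hlog : Real.log (binPMF M bs m / binMix M w m) ≤ Real.log 2 - M * Real.log t := by
      have h1 : binPMF M bs m / binMix M w m ≤ 2 / t ^ M := by
        have : (0 : ℝ) < t ^ M / 2 := by positivity
        calc _ ≤ 1 / (t ^ M / 2) := by gcongr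
          _ = _ := by field_simp
      have h2 := Real.log_le_log (div_pos hq0 (lt_of_lt_of_le (by positivity) hp)) h1
      rwa [Real.log_div (x := 2) (by norm_num) (by positivity), Real.log_pow] at h2
    calc _ ≤ binPMF M bs m * (Real.log 2 - M * Real.log t) := by gcongr
      _ ≤ 1 * (Real.log 2 - M * Real.log t) := by gcongr
      _ = _ := one_mul _
  rw [binMixKL]
  refine (Finset.sum_le_sum hterm).trans_eq ?_
  rw [Finset.sum_const, Finset.card_range, nsmul_eq_mul]
  push_cast
  rfl

theorem integrable_comp_abs_of_integrableOn_Ioi {f : ℝ → ℝ} (hf : IntegrableOn f (Ioi 0)) :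
    Integrable fun x => f |x| := by
  rw [← integrableOn_univ, ← Iio_union_Ici (a := (0 : ℝ)), integrableOn_union,
    integrableOn_Ici_iff_integrableOn_Ioi]
  constructor
  · have h := (Measure.measurePreserving_neg (volume : Measure ℝ)).integrableOn_comp_preimage
      (MeasurableEquiv.neg ℝ).measurableEmbedding (f := f) (s := Ioi 0)
    have h2 := h.2 hf
    simp only [neg_preimage, neg_Ioi, neg_zero] at h2
    refine h2.congr_fun (fun x hx => ?_) measurableSet_Iio
    simp [abs_of_neg (mem_Iio.1 hx)]
  · exact hf.congr_fun (fun x hx => by rw [abs_of_pos hx]) measurableSet_Ioi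

theorem integrableOn_abs_sub_rpow {bs s : ℝ} (hbs : bs ∈ Ioo (0 : ℝ) 1) (hs : -1 < s) :
    IntegrableOn (fun b => |b - bs| ^ s) (Ioo 0 1 \ {bs}) := by
  have h1 : IntegrableOn ((Ioc (0 : ℝ) 1).indicator fun x => x ^ s) (Ioi 0) := by
    refine (IntegrableOn.integrable_indicator ?_ measurableSet_Ioc).integrableOn
    exact (intervalIntegrable_iff_integrableOn_Ioc_of_le zero_le_one).1
      (intervalIntegral.intervalIntegrable_rpow' hs)
  have h2 := ((integrable_comp_abs_of_integrableOn_Ioi h1).comp_sub_right bs).integrableOn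
    (s := Ioo 0 1 \ {bs})
  refine h2.congr_fun (fun b hb => ?_) (measurableSet_Ioo.diff (measurableSet_singleton _))
  have hb1 : 0 < |b - bs| := abs_pos.2 (sub_ne_zero.2 hb.2)
  have hb2 : |b - bs| ≤ 1 := abs_le.2 ⟨by linarith [hb.1.1, hbs.2], by linarith [hb.1.2, hbs.1]⟩
  simp [indicator_of_mem (show |b - bs| ∈ Ioc (0 : ℝ) 1 from ⟨hb1, hb2⟩)]

theorem integrable_min_one_abs_mul_rpow {s : ℝ} (hs : -2 < s) (hs' : s < -1) :
    Integrable fun t : ℝ => min 1 |t| * |t| ^ s := by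
  refine integrable_comp_abs_of_integrableOn_Ioi (f := fun t => min 1 t * t ^ s) ?_
  rw [← Ioc_union_Ioi_eq_Ioi (zero_le_one (α := ℝ)), integrableOn_union]
  constructor
  · have h : IntegrableOn (fun t : ℝ => t ^ (1 + s)) (Ioc 0 1) :=
      (intervalIntegrable_iff_integrableOn_Ioc_of_le zero_le_one).1
        (intervalIntegral.intervalIntegrable_rpow' (by linarith))
    refine h.congr_fun (fun t ht => ?_) measurableSet_Ioc
    simp only [min_eq_right ht.2]
    rw [Real.rpow_add ht.1, Real.rpow_one]
  · refine (integrableOn_Ioi_rpow_of_lt hs' zero_lt_one).congr_fun (fun t ht => ?_)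
      measurableSet_Ioi
    simp [min_eq_left (le_of_lt (mem_Ioi.1 ht))]

/-- Lebesgue measure on the half domain `0 < a < 1/2`, `b₁ ≠ bs`, with the second component
unrestricted. -/
noncomputable def mixMeasure (bs : ℝ) : Measure (ℝ × ℝ × ℝ) :=
  volume.restrict (Ioo 0 (1 / 2) ×ˢ (Ioo 0 1 \ {bs}) ×ˢ univ)

theorem mixMeasure_eq (bs : ℝ) :
    mixMeasure bs = (volume.restrict (Ioo (0 : ℝ) (1 / 2))).prod
      ((volume.restrict (Ioo (0 : ℝ) 1 \ {bs})).prod volume) := by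
  rw [mixMeasure, Measure.volume_eq_prod, ← Measure.prod_restrict, Measure.volume_eq_prod,
    ← Measure.prod_restrict, Measure.restrict_univ]

theorem ae_mixMeasure (bs : ℝ) :
    ∀ᵐ w ∂mixMeasure bs, w.1 ∈ Ioo (0 : ℝ) (1 / 2) ∧ w.2.1 ∈ Ioo (0 : ℝ) 1 ∧ w.2.1 ≠ bs := by
  have hm : MeasurableSet (Ioo (0 : ℝ) (1 / 2) ×ˢ (Ioo (0 : ℝ) 1 \ {bs}) ×ˢ (univ : Set ℝ)) :=
    measurableSet_Ioo.prod ((measurableSet_Ioo.diff (measurableSet_singleton _)).prod .univ)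
  filter_upwards [ae_restrict_mem hm] with w hw
  exact ⟨hw.1, hw.2.1.1, hw.2.1.2⟩

theorem integrable_mixMeasure_of_fiber {bs : ℝ} {f : ℝ × ℝ × ℝ → ℝ} (hf : Measurable f)
    (hf0 : ∀ w, w.1 ∈ Ioo (0 : ℝ) (1 / 2) → 0 ≤ f w) {g₁ g₂ : ℝ → ℝ}
    (hg₁ : IntegrableOn g₁ (Ioo 0 (1 / 2))) (hg₂ : IntegrableOn g₂ (Ioo 0 1 \ {bs}))
    (hint : ∀ a ∈ Ioo (0 : ℝ) (1 / 2), ∀ b₁ ∈ Ioo (0 : ℝ) 1 \ {bs},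
      Integrable fun b₂ => f (a, b₁, b₂))
    (hle : ∀ a ∈ Ioo (0 : ℝ) (1 / 2), ∀ b₁ ∈ Ioo (0 : ℝ) 1 \ {bs},
      ∫ b₂, f (a, b₁, b₂) ≤ g₁ a * g₂ b₁) :
    Integrable f (mixMeasure bs) := by
  have hB : MeasurableSet (Ioo (0 : ℝ) 1 \ {bs}) :=
    measurableSet_Ioo.diff (measurableSet_singleton _)
  refine ⟨hf.aestronglyMeasurable, ?_⟩
  rw [hasFiniteIntegral_iff_ofReal
    (by filter_upwards [ae_mixMeasure bs] with w hw using hf0 w hw.1), mixMeasure_eq,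
    lintegral_prod _ hf.ennreal_ofReal.aemeasurable]
  calc ∫⁻ a in Ioo (0 : ℝ) (1 / 2), ∫⁻ y : ℝ × ℝ, ENNReal.ofReal (f (a, y))
        ∂((volume.restrict (Ioo (0 : ℝ) 1 \ {bs})).prod volume)
      ≤ ∫⁻ a in Ioo (0 : ℝ) (1 / 2), ∫⁻ b in Ioo (0 : ℝ) 1 \ {bs}, ‖g₁ a‖ₑ * ‖g₂ b‖ₑ := by
        refine setLIntegral_mono_ae' measurableSet_Ioo (Eventually.of_forall fun a ha => ?_)
        rw [lintegral_prod (fun y : ℝ × ℝ => ENNReal.ofReal (f (a, y)))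
          (hf.comp measurable_prodMk_left).ennreal_ofReal.aemeasurable]
        refine setLIntegral_mono_ae' hB (Eventually.of_forall fun b hb => ?_)
        rw [← ofReal_integral_eq_lintegral_ofReal (hint a ha b hb)
          (Eventually.of_forall fun _ => hf0 _ ha), ← enorm_mul]
        exact (ENNReal.ofReal_le_ofReal (hle a ha b hb)).trans (Real.ofReal_le_enorm _)
    _ = (∫⁻ a in Ioo (0 : ℝ) (1 / 2), ‖g₁ a‖ₑ) * ∫⁻ b in Ioo (0 : ℝ) 1 \ {bs}, ‖g₂ b‖ₑ := by
        simp_rw [lintegral_const_mul'' _ hg₂.aestronglyMeasurable.enorm]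
        rw [lintegral_mul_const'' _ hg₁.aestronglyMeasurable.enorm]
    _ < ⊤ := ENNReal.mul_lt_top hg₁.2 hg₂.2

theorem integrableOn_Ioo_rpow {s : ℝ} (hs : -1 < s) {c : ℝ} (hc : 0 ≤ c) :
    IntegrableOn (fun a : ℝ => a ^ s) (Ioo 0 c) :=
  ((intervalIntegrable_iff_integrableOn_Ioc_of_le hc).1
    (intervalIntegral.intervalIntegrable_rpow' hs)).mono_set Ioo_subset_Ioc_self

theorem measurable_mixX (bs : ℝ) : Measurable (mixX bs) := by
  unfold mixX
  fun_prop

theorem measurable_mixQ (bs : ℝ) : Measurable (mixQ bs) := by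
  unfold mixQ mixX
  fun_prop

theorem mixX_eq {bs a b₁ b₂ : ℝ} (ha : a < 1) :
    mixX bs (a, b₁, b₂) = (1 - a) * (b₂ + (a * (b₁ - bs) / (1 - a) - bs)) := by
  have : 1 - a ≠ 0 := by linarith
  simp only [mixX]
  field_simp
  ring

theorem mixQ_pos {bs : ℝ} {w : ℝ × ℝ × ℝ} (ha : 0 < w.1) (h : w.2.1 ≠ bs) : 0 < mixQ bs w := by
  have := sub_ne_zero.2 h
  rw [mixQ]
  positivity

theorem mixQ_nonneg (bs : ℝ) (w : ℝ × ℝ × ℝ) : 0 ≤ mixQ bs w := by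
  rw [mixQ]
  positivity

theorem integrable_mixQ_rpow {bs σ e f : ℝ} (hbs : bs ∈ Ioo (0 : ℝ) 1) (hσ : σ < -1 / 2)
    (he : -2 < 2 * σ + e) (hf : -3 < 4 * σ + f) :
    Integrable (fun w : ℝ × ℝ × ℝ => mixQ bs w ^ σ * (w.1 ^ e * |w.2.1 - bs| ^ f))
      (mixMeasure bs) := by
  have hmeas := measurable_mixQ bs
  set J := ∫ t : ℝ, (1 + t ^ 2) ^ σ with hJ
  have hJ0 : 0 ≤ J := (integral_one_add_sq_rpow_pos hσ).le
  have hQ : ∀ a ∈ Ioo (0 : ℝ) (1 / 2), ∀ b₁ b₂ : ℝ, mixQ bs (a, b₁, b₂) =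
      (1 - a) ^ 2 * (b₂ + (a * (b₁ - bs) / (1 - a) - bs)) ^ 2 + (a * (b₁ - bs) ^ 2) ^ 2 := by
    intro a ha b₁ b₂
    rw [mixQ, mixX_eq (by linarith [ha.2]), mul_pow]
  refine integrable_mixMeasure_of_fiber (g₁ := fun a => 2 * J * a ^ (2 * σ + 1 + e))
    (g₂ := fun b => |b - bs| ^ (4 * σ + 2 + f)) (by fun_prop) ?_
    ((integrableOn_Ioo_rpow (by linarith) (by norm_num)).const_mul _)
    (integrableOn_abs_sub_rpow hbs (by linarith)) ?_ ?_
  · intro w hw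
    have := hw.1
    have := mixQ_nonneg bs w
    positivity
  · intro a ha b₁ hb₁
    have h1 := ha.1
    have h2 := sub_ne_zero.2 hb₁.2
    simp_rw [hQ a ha b₁]
    exact (integrable_quadratic_rpow (by linarith [ha.2]) (by positivity) hσ _).mul_const _
  · intro a ha b₁ hb₁
    have h1 := ha.1
    have h2 : 0 < |b₁ - bs| := abs_pos.2 (sub_ne_zero.2 hb₁.2)
    have h3 : 0 < 1 - a := by linarith [ha.2]
    simp_rw [hQ a ha b₁]
    rw [integral_mul_const, ← sq_abs (b₁ - bs), integral_quadratic_rpow h3 (by positivity)]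
    have h4 : (1 - a)⁻¹ ≤ 2 := inv_le_of_inv_le₀ two_pos (by linarith [ha.2])
    have h5 : (a * |b₁ - bs| ^ 2) ^ (2 * σ + 1) =
        a ^ (2 * σ + 1) * |b₁ - bs| ^ (4 * σ + 2) := by
      rw [Real.mul_rpow h1.le (by positivity), ← Real.rpow_natCast, ← Real.rpow_mul h2.le]
      congr 2
      push_cast
      ring
    rw [h5, Real.rpow_add h1 (2 * σ + 1), Real.rpow_add h2 (4 * σ + 2), ← hJ]
    calc _ = (1 - a)⁻¹ * (J * (a ^ (2 * σ + 1) * a ^ e) *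
          (|b₁ - bs| ^ (4 * σ + 2) * |b₁ - bs| ^ f)) := by ring
      _ ≤ 2 * (J * (a ^ (2 * σ + 1) * a ^ e) *
          (|b₁ - bs| ^ (4 * σ + 2) * |b₁ - bs| ^ f)) := by gcongr
      _ = _ := by ring

theorem integrable_min_one_mixX {bs σ e : ℝ} (hσ : -1 < σ) (hσ' : σ < -1 / 2) (he : -1 < e) :
    Integrable (fun w : ℝ × ℝ × ℝ => min 1 |mixX bs w| * |mixX bs w| ^ (2 * σ) * w.1 ^ e)
      (mixMeasure bs) := by
  have hmeas := measurable_mixX bs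
  have hI := integrable_min_one_abs_mul_rpow (s := 2 * σ) (by linarith) (by linarith)
  set J := ∫ t : ℝ, min 1 |t| * |t| ^ (2 * σ) with hJ
  have hJ0 : 0 ≤ J := integral_nonneg fun t => by positivity
  refine integrable_mixMeasure_of_fiber (g₁ := fun a => 2 * J * a ^ e)
    (g₂ := fun _ => 1) (by fun_prop) ?_
    ((integrableOn_Ioo_rpow he (by norm_num)).const_mul _)
    (integrableOn_const (measure_ne_top_of_subset sdiff_subset (by simp)) (by simp)) ?_ ?_
  · intro w hw
    have := hw.1
    positivity
  · intro a ha b₁ hb₁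
    have h3 : 0 < 1 - a := by linarith [ha.2]
    simp_rw [mixX_eq (bs := bs) (b₁ := b₁) (by linarith : a < 1)]
    exact ((hI.comp_mul_left' h3.ne').comp_add_right (a * (b₁ - bs) / (1 - a) - bs)).mul_const _
  · intro a ha b₁ hb₁
    have h1 := ha.1
    have h3 : 0 < 1 - a := by linarith [ha.2]
    have h4 : (1 - a)⁻¹ ≤ 2 := inv_le_of_inv_le₀ two_pos (by linarith [ha.2])
    simp_rw [mixX_eq (bs := bs) (b₁ := b₁) (by linarith : a < 1)]
    rw [integral_mul_const,
      integral_add_right_eq_self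
        (fun b : ℝ => min 1 |(1 - a) * b| * |(1 - a) * b| ^ (2 * σ)),
      Measure.integral_comp_mul_left (fun b : ℝ => min 1 |b| * |b| ^ (2 * σ)),
      abs_of_pos (by positivity), smul_eq_mul, ← hJ, mul_one]
    gcongr

theorem integrable_min_mixR_mixQ {bs σ e : ℝ} (hbs : bs ∈ Ioo (0 : ℝ) 1) (hσ : -1 < σ)
    (hσ' : σ < -1 / 2) (he : -1 < e) :
    Integrable (fun w : ℝ × ℝ × ℝ => min 1 (mixR bs w) * mixQ bs w ^ σ * w.1 ^ e)
      (mixMeasure bs) := by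
  have hmX := measurable_mixX bs
  have hmQ := measurable_mixQ bs
  refine ((integrable_min_one_mixX (bs := bs) hσ hσ' he).add (integrable_mixQ_rpow hbs hσ'
    (e := 1 + e) (f := 1) (by linarith) (by linarith))).mono'
    (Measurable.aestronglyMeasurable (by unfold mixR; fun_prop)) ?_
  filter_upwards [ae_mixMeasure bs] with w ⟨ha, _, hb⟩
  have h0 := ha.1
  have hQ := mixQ_pos ha.1 hb
  have hR : 0 ≤ mixR bs w := by rw [mixR]; positivity
  rw [Real.norm_of_nonneg (by positivity), Pi.add_apply, Real.rpow_add h0, Real.rpow_one,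
    Real.rpow_one]
  have h1 : min 1 (mixR bs w) ≤ min 1 |mixX bs w| + w.1 * |w.2.1 - bs| := by
    rw [mixR]
    have : 0 ≤ w.1 * |w.2.1 - bs| := by positivity
    rcases le_total 1 |mixX bs w| with h | h
    · rw [min_eq_left h]
      exact (min_le_left _ _).trans (by linarith)
    · rw [min_eq_right h]
      exact min_le_right _ _
  have h2 : min 1 |mixX bs w| * mixQ bs w ^ σ ≤ min 1 |mixX bs w| * |mixX bs w| ^ (2 * σ) := by
    rcases eq_or_ne (mixX bs w) 0 with h | h
    · simp [h]
    · gcongr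
      rw [Real.rpow_mul (abs_nonneg _), Real.rpow_two, sq_abs]
      refine Real.rpow_le_rpow_of_nonpos (by positivity) ?_ (by linarith)
      rw [mixQ]
      exact le_add_of_nonneg_right (by positivity)
  calc _ ≤ (min 1 |mixX bs w| + w.1 * |w.2.1 - bs|) * mixQ bs w ^ σ * w.1 ^ e := by gcongr
    _ = min 1 |mixX bs w| * mixQ bs w ^ σ * w.1 ^ e +
        mixQ bs w ^ σ * (w.1 * w.1 ^ e * |w.2.1 - bs|) := by ring
    _ ≤ _ := by gcongr

/-- The Dirichlet-type weight in the mixing ratio. -/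
noncomputable def mixWeight (η : ℝ) (a : ℝ) : ℝ := a ^ (η - 1) * (1 - a) ^ (η - 1)

/-- The zeta integrand on the half domain. -/
noncomputable def zetaIntegrand (M : ℕ) (bs η : ℝ) (ψ : ℝ × ℝ → ℝ) (z : ℂ) (w : ℝ × ℝ × ℝ) : ℂ :=
  {w : ℝ × ℝ × ℝ | w.2.2 ∈ Ioo (0 : ℝ) 1}.indicator
    (fun w => (binMixKL M bs w : ℂ) ^ z * ((mixWeight η w.1 * ψ w.2 : ℝ) : ℂ)) w

/-- The integrand with the divergence replaced by its quadratic model. -/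
noncomputable def modelIntegrand (M : ℕ) (bs η : ℝ) (ψ : ℝ × ℝ → ℝ) (z : ℂ)
    (w : ℝ × ℝ × ℝ) : ℂ :=
  (modelKL M bs w : ℂ) ^ z * ((mixWeight η w.1 * ψ (w.2.1, bs) : ℝ) : ℂ)

theorem measurable_binMixKL (M : ℕ) (bs : ℝ) : Measurable (binMixKL M bs) := by
  unfold binMixKL binMix binPMF
  fun_prop

theorem measurable_modelKL (M : ℕ) (bs : ℝ) : Measurable (modelKL M bs) := by
  have h : ∀ m, Measurable fun u => (binRem M bs m).eval u := fun m =>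
    (binRem M bs m).continuous.measurable
  have h2 : ∀ m, Measurable fun w : ℝ × ℝ × ℝ => (binRem M bs m).eval (w.2.1 - bs) := fun m =>
    (h m).comp (by fun_prop)
  unfold modelKL modelForm mixX mixY
  fun_prop

theorem measurable_zetaIntegrand (M : ℕ) (bs η : ℝ) {ψ : ℝ × ℝ → ℝ} (hψ : Measurable ψ) (z : ℂ) :
    Measurable (zetaIntegrand M bs η ψ z) := by
  have h := measurable_binMixKL M bs
  refine Measurable.indicator ?_ (measurableSet_Ioo.preimage (by fun_prop))
  unfold mixWeight
  fun_prop

theorem measurable_modelIntegrand (M : ℕ) (bs η : ℝ) {ψ : ℝ × ℝ → ℝ} (hψ : Measurable ψ) (z : ℂ) :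
    Measurable (modelIntegrand M bs η ψ z) := by
  have h := measurable_modelKL M bs
  unfold modelIntegrand mixWeight
  fun_prop

theorem mixWeight_le {η a : ℝ} (hη : 0 < η) (ha : a ∈ Ioo (0 : ℝ) (1 / 2)) :
    mixWeight η a ≤ 2 * a ^ (η - 1) := by
  have h0 := ha.1
  have h1 : (0 : ℝ) < 1 - a := by linarith [ha.2]
  have h2 : (1 - a) ^ (η - 1) ≤ 2 := by
    have h3 : (1 - a) ^ (η - 1) ≤ (1 - a) ^ (-1 : ℝ) :=
      Real.rpow_le_rpow_of_exponent_ge h1 (by linarith) (by linarith)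
    rw [Real.rpow_neg_one] at h3
    exact h3.trans (inv_le_of_inv_le₀ two_pos (by linarith [ha.2]))
  rw [mixWeight, mul_comm]
  gcongr

theorem mixWeight_pos {η a : ℝ} (ha : a ∈ Ioo (0 : ℝ) (1 / 2)) : 0 < mixWeight η a := by
  have h0 := ha.1
  have h1 : (0 : ℝ) < 1 - a := by linarith [ha.2]
  rw [mixWeight]
  positivity

theorem exists_common_lower_bound {M : ℕ} (hM : 2 ≤ M) {bs : ℝ} (hbs : bs ∈ Ioo (0 : ℝ) 1) :
    ∃ c > 0, c ≤ 1 ∧ ∀ w : ℝ × ℝ × ℝ, w.1 ∈ Ioo (0 : ℝ) (1 / 2) → w.2.1 ∈ Ioo (0 : ℝ) 1 →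
      c * mixQ bs w ≤ modelKL M bs w ∧
      (w.2.2 ∈ Ioo (0 : ℝ) 1 → c * mixQ bs w ≤ binMixKL M bs w) := by
  obtain ⟨c₁, hc₁, h₁⟩ := exists_binMixKL_lower_bound hM hbs
  obtain ⟨c₂, hc₂, h₂⟩ := exists_modelKL_lower_bound hM hbs
  refine ⟨min 1 (min c₁ c₂), by positivity, min_le_left _ _, fun w ha hb => ?_⟩
  have hQ := mixQ_nonneg bs w
  have ha' : w.1 ∈ Ico (0 : ℝ) 1 := ⟨ha.1.le, by linarith [ha.2]⟩
  constructor
  · refine le_trans ?_ (h₂ w ha')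
    gcongr
    exact (min_le_right _ _).trans (min_le_right _ _)
  · intro hb₂
    refine le_trans ?_ (h₁ w (Ico_subset_Icc_self ha') (Ioo_subset_Icc_self hb)
      (Ioo_subset_Icc_self hb₂)
      fun m hm => binMix_pos hm ha' (Ioo_subset_Icc_self hb) hb₂)
    gcongr
    exact (min_le_right _ _).trans (min_le_left _ _)

theorem rpow_le_inv_mul_rpow {c Q A s : ℝ} (hc : 0 < c) (hc1 : c ≤ 1) (hQ : 0 < Q)
    (hA : c * Q ≤ A) (hs : -1 ≤ s) (hs0 : s ≤ 0) : A ^ s ≤ c⁻¹ * Q ^ s := by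
  calc A ^ s ≤ (c * Q) ^ s := Real.rpow_le_rpow_of_nonpos (by positivity) hA hs0
    _ = c ^ s * Q ^ s := Real.mul_rpow hc.le hQ.le
    _ ≤ c⁻¹ * Q ^ s := by
      gcongr
      rw [← Real.rpow_neg_one]
      exact Real.rpow_le_rpow_of_exponent_ge hc hc1 hs

theorem exists_norm_integrand_le {M : ℕ} (hM : 2 ≤ M) {bs : ℝ} (hbs : bs ∈ Ioo (0 : ℝ) 1)
    {η : ℝ} (hη : 0 < η) {ψ : ℝ × ℝ → ℝ} {Cψ : ℝ} (hψB : ∀ b, |ψ b| ≤ Cψ) :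
    ∃ C ≥ 0, ∀ z : ℂ, -1 ≤ z.re → z.re ≤ 0 → ∀ w : ℝ × ℝ × ℝ, w.1 ∈ Ioo (0 : ℝ) (1 / 2) →
      w.2.1 ∈ Ioo (0 : ℝ) 1 → w.2.1 ≠ bs →
      ‖zetaIntegrand M bs η ψ z w‖ ≤ C * (mixQ bs w ^ z.re * w.1 ^ (η - 1)) ∧
      ‖modelIntegrand M bs η ψ z w‖ ≤ C * (mixQ bs w ^ z.re * w.1 ^ (η - 1)) := by
  obtain ⟨c, hc, hc1, h⟩ := exists_common_lower_bound hM hbs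
  have hCψ : 0 ≤ Cψ := (abs_nonneg _).trans (hψB 0)
  refine ⟨c⁻¹ * 2 * Cψ, by positivity, fun z hz hz0 w ha hb hb' => ?_⟩
  have hQ := mixQ_pos ha.1 hb'
  obtain ⟨hm, hk⟩ := h w ha hb
  have h0 := ha.1
  have key : ∀ A b, c * mixQ bs w ≤ A →
      ‖(A : ℂ) ^ z * ((mixWeight η w.1 * ψ b : ℝ) : ℂ)‖ ≤
        c⁻¹ * 2 * Cψ * (mixQ bs w ^ z.re * w.1 ^ (η - 1)) := by
    intro A b hA
    have hA0 : 0 < A := lt_of_lt_of_le (by positivity) hA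
    have hw := mixWeight_pos (η := η) ha
    rw [norm_mul, Complex.norm_cpow_eq_rpow_re_of_pos hA0, Complex.norm_real, Real.norm_eq_abs,
      abs_mul, abs_of_pos hw]
    calc _ ≤ (c⁻¹ * mixQ bs w ^ z.re) * ((2 * w.1 ^ (η - 1)) * Cψ) := by
          gcongr
          · exact rpow_le_inv_mul_rpow hc hc1 hQ hA hz hz0
          · exact mixWeight_le hη ha
          · exact hψB b
      _ = _ := by ring
  refine ⟨?_, key _ _ hm⟩
  by_cases hb₂ : w.2.2 ∈ Ioo (0 : ℝ) 1
  · rw [zetaIntegrand, indicator_of_mem (by exact hb₂)]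
    exact key _ _ (hk hb₂)
  · rw [zetaIntegrand, indicator_of_notMem (by exact hb₂), norm_zero]
    positivity

theorem abs_sub_le_two_mul_mixR {bs : ℝ} {w : ℝ × ℝ × ℝ} (ha : w.1 ∈ Ioo (0 : ℝ) (1 / 2)) :
    |w.2.2 - bs| ≤ 2 * mixR bs w := by
  have h1 : (0 : ℝ) < 1 - w.1 := by linarith [ha.2]
  have h2 : (1 - w.1) * |w.2.2 - bs| ≤ mixR bs w := by
    rw [← abs_of_pos h1, ← abs_mul, mixR]
    have : (1 - w.1) * (w.2.2 - bs) = mixX bs w - w.1 * (w.2.1 - bs) := by rw [mixX]; ring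
    rw [this]
    refine (abs_sub _ _).trans_eq ?_
    rw [abs_mul, abs_of_pos ha.1]
  nlinarith [abs_nonneg (w.2.2 - bs), ha.2]

theorem exists_norm_integrand_sub_le {M : ℕ} (hM : 2 ≤ M) {bs : ℝ} (hbs : bs ∈ Ioo (0 : ℝ) 1)
    {η : ℝ} (hη : 0 < η) {ψ : ℝ × ℝ → ℝ} {Cψ : ℝ} (hψB : ∀ b, |ψ b| ≤ Cψ) {L : NNReal}
    (hψL : LipschitzWith L ψ) {Z : ℝ} (hZ : 0 ≤ Z) :
    ∃ C ≥ 0, ∀ z : ℂ, ‖z‖ ≤ Z → -1 ≤ z.re → z.re ≤ 0 → ∀ w : ℝ × ℝ × ℝ,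
      w.1 ∈ Ioo (0 : ℝ) (1 / 2) → w.2.1 ∈ Ioo (0 : ℝ) 1 → w.2.1 ≠ bs →
      ‖zetaIntegrand M bs η ψ z w - modelIntegrand M bs η ψ z w‖ ≤
        C * (min 1 (mixR bs w) * mixQ bs w ^ z.re * w.1 ^ (η - 1)) := by
  obtain ⟨c, hc, hc1, h⟩ := exists_common_lower_bound hM hbs
  obtain ⟨C₁, hC₁, hb₁⟩ := exists_norm_integrand_le hM hbs hη hψB
  obtain ⟨C₂, hC₂, δ₂, hδ₂, hb₂⟩ := exists_abs_binMixKL_sub_modelKL_le hM hbs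
  have hCψ : 0 ≤ Cψ := (abs_nonneg _).trans (hψB 0)
  have hbs0 := hbs.1
  have hbs1 := sub_pos.2 hbs.2
  obtain ⟨δ, hδ, hδ1, hδ2, hδC, hδl, hδr⟩ : ∃ δ > 0, δ ≤ 1 ∧ δ ≤ δ₂ ∧ C₂ * δ ≤ 1 / 2 ∧
      2 * δ < bs ∧ 2 * δ < 1 - bs := by
    refine ⟨min (min 1 δ₂) (min (1 / (2 * C₂)) (min (bs / 3) ((1 - bs) / 3))), by positivity,
      (min_le_left _ _).trans (min_le_left _ _), (min_le_left _ _).trans (min_le_right _ _),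
      ?_, ?_, ?_⟩
    · have : min (min 1 δ₂) (min (1 / (2 * C₂)) (min (bs / 3) ((1 - bs) / 3))) ≤ 1 / (2 * C₂) :=
        (min_le_right _ _).trans (min_le_left _ _)
      calc _ ≤ C₂ * (1 / (2 * C₂)) := by gcongr
        _ = 1 / 2 := by field_simp
    · have : min (min 1 δ₂) (min (1 / (2 * C₂)) (min (bs / 3) ((1 - bs) / 3))) ≤ bs / 3 :=
        (min_le_right _ _).trans ((min_le_right _ _).trans (min_le_left _ _))
      linarith
    · have : min (min 1 δ₂) (min (1 / (2 * C₂)) (min (bs / 3) ((1 - bs) / 3))) ≤ (1 - bs) / 3 :=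
        (min_le_right _ _).trans ((min_le_right _ _).trans (min_le_right _ _))
      linarith
  set E := c⁻¹ * 2 * (Z * (2 * C₂) * Real.exp Z * Cψ + L * 2) with hE
  have hE0 : 0 ≤ E := by positivity
  refine ⟨2 * C₁ / δ + E, by positivity, fun z hzZ hz hz0 w ha hb hb' => ?_⟩
  have hQ := mixQ_pos ha.1 hb'
  have h0 := ha.1
  have hR : 0 ≤ mixR bs w := by rw [mixR]; positivity
  have hT : 0 ≤ min 1 (mixR bs w) * mixQ bs w ^ z.re * w.1 ^ (η - 1) := by positivity
  rw [add_mul]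
  rcases le_total (mixR bs w) δ with hr | hr
  · refine le_trans ?_ (le_add_of_nonneg_left (by positivity))
    have hv := abs_sub_le_two_mul_mixR (bs := bs) ha
    have hb₂' : w.2.2 ∈ Ioo (0 : ℝ) 1 := by
      have := abs_le.1 (hv.trans (by linarith : 2 * mixR bs w ≤ 2 * δ))
      exact ⟨by linarith [this.1], by linarith [this.2]⟩
    have hdiff := hb₂ w ⟨ha.1.le, ha.2.le⟩ (Ioo_subset_Icc_self hb) (Ioo_subset_Icc_self hb₂')
      (hr.trans hδ2)
    obtain ⟨hm, hk⟩ := h w ha hb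
    have hA0 : 0 < modelKL M bs w := lt_of_lt_of_le (by positivity) hm
    have hH0 : 0 < binMixKL M bs w := lt_of_lt_of_le (by positivity) (hk hb₂')
    have hCr : C₂ * mixR bs w ≤ 1 / 2 := by
      refine le_trans ?_ hδC
      gcongr
    set A := modelKL M bs w
    set H := binMixKL M bs w
    have hH2 : A / 2 ≤ H := by
      have := (abs_le.1 hdiff).1
      nlinarith
    have hlog : |Real.log (H / A)| ≤ 2 * C₂ * mixR bs w := by
      refine (abs_log_div_le (m := A / 2) (by positivity) hH2 (by linarith)).trans ?_
      rw [div_le_iff₀ (by positivity)]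
      linarith
    have hlog1 : |Real.log (H / A)| ≤ 1 := by linarith
    have hpow : ‖(H : ℂ) ^ z - (A : ℂ) ^ z‖ ≤
        A ^ z.re * (Z * (2 * C₂ * mixR bs w) * Real.exp Z) := by
      refine (norm_cpow_sub_cpow_le hH0 hA0 z).trans ?_
      gcongr
      calc ‖z‖ * |Real.log (H / A)| ≤ Z * 1 := by gcongr
        _ = Z := mul_one Z
    have hψd : |ψ w.2 - ψ (w.2.1, bs)| ≤ L * (2 * mixR bs w) := by
      have h1 := hψL.dist_le_mul w.2 (w.2.1, bs)
      rw [Real.dist_eq, Prod.dist_eq, dist_self, max_eq_right dist_nonneg, Real.dist_eq] at h1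
      refine h1.trans ?_
      gcongr
    have hw := mixWeight_pos (η := η) ha
    have hww := mixWeight_le hη ha
    rw [zetaIntegrand, indicator_of_mem (by exact hb₂'), modelIntegrand,
      min_eq_right (hr.trans hδ1)]
    have e : (H : ℂ) ^ z * ((mixWeight η w.1 * ψ w.2 : ℝ) : ℂ) -
        (A : ℂ) ^ z * ((mixWeight η w.1 * ψ (w.2.1, bs) : ℝ) : ℂ) =
        (mixWeight η w.1 : ℂ) * (((H : ℂ) ^ z - (A : ℂ) ^ z) * (ψ w.2 : ℂ) +
          (A : ℂ) ^ z * ((ψ w.2 - ψ (w.2.1, bs) : ℝ) : ℂ)) := by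
      push_cast
      ring
    change ‖(H : ℂ) ^ z * ((mixWeight η w.1 * ψ w.2 : ℝ) : ℂ) -
        (A : ℂ) ^ z * ((mixWeight η w.1 * ψ (w.2.1, bs) : ℝ) : ℂ)‖ ≤ _
    rw [e, norm_mul, Complex.norm_real, Real.norm_of_nonneg hw.le]
    have hsum : ‖((H : ℂ) ^ z - (A : ℂ) ^ z) * (ψ w.2 : ℂ) +
          (A : ℂ) ^ z * ((ψ w.2 - ψ (w.2.1, bs) : ℝ) : ℂ)‖ ≤
        A ^ z.re * (Z * (2 * C₂ * mixR bs w) * Real.exp Z) * Cψ +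
          A ^ z.re * (L * (2 * mixR bs w)) := by
      refine (norm_add_le _ _).trans ?_
      rw [norm_mul, norm_mul, Complex.norm_real, Complex.norm_real, Real.norm_eq_abs,
        Real.norm_eq_abs, Complex.norm_cpow_eq_rpow_re_of_pos hA0]
      gcongr
      exact hψB _
    calc _ ≤ (2 * w.1 ^ (η - 1)) * (A ^ z.re * (Z * (2 * C₂ * mixR bs w) * Real.exp Z) * Cψ +
          A ^ z.re * (L * (2 * mixR bs w))) := by gcongr
      _ = A ^ z.re * (2 * (Z * (2 * C₂) * Real.exp Z * Cψ + L * 2) *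
          (mixR bs w * w.1 ^ (η - 1))) := by ring
      _ ≤ (c⁻¹ * mixQ bs w ^ z.re) * (2 * (Z * (2 * C₂) * Real.exp Z * Cψ + L * 2) *
          (mixR bs w * w.1 ^ (η - 1))) := by
        gcongr
        exact rpow_le_inv_mul_rpow hc hc1 hQ hm hz hz0
      _ = _ := by rw [hE]; ring
  · refine le_trans ?_ (le_add_of_nonneg_right (by positivity))
    obtain ⟨k1, k2⟩ := hb₁ z hz hz0 w ha hb hb'
    have hmin : δ ≤ min 1 (mixR bs w) := le_min hδ1 hr
    calc _ ≤ C₁ * (mixQ bs w ^ z.re * w.1 ^ (η - 1)) + C₁ * (mixQ bs w ^ z.re * w.1 ^ (η - 1)) :=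
          (norm_sub_le _ _).trans (add_le_add k1 k2)
      _ = 2 * C₁ / δ * (δ * mixQ bs w ^ z.re * w.1 ^ (η - 1)) := by field_simp; ring
      _ ≤ _ := by gcongr

theorem ae_differentiable_integrands {M : ℕ} (hM : 2 ≤ M) {bs : ℝ} (hbs : bs ∈ Ioo (0 : ℝ) 1)
    (η : ℝ) (ψ : ℝ × ℝ → ℝ) :
    ∀ᵐ w ∂mixMeasure bs, Differentiable ℂ (fun z => zetaIntegrand M bs η ψ z w) ∧
      Differentiable ℂ (fun z => modelIntegrand M bs η ψ z w) := by
  obtain ⟨c, hc, -, h⟩ := exists_common_lower_bound hM hbs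
  filter_upwards [ae_mixMeasure bs] with w ⟨ha, hb, hb'⟩
  have hQ := mixQ_pos ha.1 hb'
  obtain ⟨hm, hk⟩ := h w ha hb
  constructor
  · by_cases hb₂ : w.2.2 ∈ Ioo (0 : ℝ) 1
    · simp only [zetaIntegrand, indicator_of_mem
        (show w ∈ {w : ℝ × ℝ × ℝ | w.2.2 ∈ Ioo (0 : ℝ) 1} from hb₂)]
      exact (differentiable_ofReal_cpow (lt_of_lt_of_le (by positivity) (hk hb₂))).mul_const _
    · simp only [zetaIntegrand, indicator_of_notMem
        (show w ∉ {w : ℝ × ℝ × ℝ | w.2.2 ∈ Ioo (0 : ℝ) 1} from hb₂)]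
      fun_prop
  · exact (differentiable_ofReal_cpow (lt_of_lt_of_le (by positivity) hm)).mul_const _

theorem integrable_mixQ_rpow_mul {bs σ η : ℝ} (hbs : bs ∈ Ioo (0 : ℝ) 1) (hσ : σ < -1 / 2)
    (h₁ : -((1 + η) / 2) < σ) (h₂ : -(3 / 4) < σ) :
    Integrable (fun w : ℝ × ℝ × ℝ => mixQ bs w ^ σ * w.1 ^ (η - 1)) (mixMeasure bs) := by
  simpa using integrable_mixQ_rpow hbs hσ (e := η - 1) (f := 0) (by linarith) (by linarith)

theorem integrable_integrands {M : ℕ} (hM : 2 ≤ M) {bs : ℝ} (hbs : bs ∈ Ioo (0 : ℝ) 1)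
    {η : ℝ} (hη : 0 < η) {ψ : ℝ × ℝ → ℝ} (hψm : Measurable ψ) {Cψ : ℝ} (hψB : ∀ b, |ψ b| ≤ Cψ)
    {z : ℂ} (h₁ : -((1 + η) / 2) < z.re) (h₂ : -(3 / 4) < z.re) (h₃ : z.re < -1 / 2) :
    Integrable (zetaIntegrand M bs η ψ z) (mixMeasure bs) ∧
      Integrable (modelIntegrand M bs η ψ z) (mixMeasure bs) := by
  obtain ⟨C, -, h⟩ := exists_norm_integrand_le hM hbs hη hψB
  have hg := (integrable_mixQ_rpow_mul hbs h₃ h₁ h₂).const_mul C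
  constructor
  · refine hg.mono' (measurable_zetaIntegrand M bs η hψm z).aestronglyMeasurable ?_
    filter_upwards [ae_mixMeasure bs] with w ⟨ha, hb, hb'⟩
    exact (h z (by linarith) (by linarith) w ha hb hb').1
  · refine hg.mono' (measurable_modelIntegrand M bs η hψm z).aestronglyMeasurable ?_
    filter_upwards [ae_mixMeasure bs] with w ⟨ha, hb, hb'⟩
    exact (h z (by linarith) (by linarith) w ha hb hb').2

theorem differentiableOn_integral_sub {M : ℕ} (hM : 2 ≤ M) {bs : ℝ} (hbs : bs ∈ Ioo (0 : ℝ) 1)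
    {η : ℝ} (hη : 0 < η) {ψ : ℝ × ℝ → ℝ} {Cψ : ℝ} (hψB : ∀ b, |ψ b| ≤ Cψ) {L : NNReal}
    (hψL : LipschitzWith L ψ) :
    DifferentiableOn ℂ (fun z => ∫ w, (zetaIntegrand M bs η ψ z w - modelIntegrand M bs η ψ z w)
      ∂mixMeasure bs) {z | -1 < z.re ∧ z.re < -1 / 2} := by
  have hψm := hψL.continuous.measurable
  refine differentiableOn_integral_of_dominated
    ((isOpen_lt continuous_const Complex.continuous_re).inter
      (isOpen_lt Complex.continuous_re continuous_const)) ?_ ?_ ?_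
  · intro z _
    exact ((measurable_zetaIntegrand M bs η hψm z).sub
      (measurable_modelIntegrand M bs η hψm z)).aestronglyMeasurable
  · filter_upwards [ae_differentiable_integrands hM hbs η ψ] with w hw
    exact (hw.1.sub hw.2).differentiableOn
  · rintro z₀ ⟨hz₀, hz₀'⟩
    simp only [mem_ofPred_eq] at hz₀ hz₀'
    obtain ⟨s₁, hs₁, hs₁'⟩ := exists_between hz₀
    obtain ⟨s₂, hs₂, hs₂'⟩ := exists_between hz₀'
    obtain ⟨C, hC, h⟩ := exists_norm_integrand_sub_le hM hbs hη hψB hψL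
      (Z := ‖z₀‖ + 1) (by positivity)
    refine ⟨{z | s₁ < z.re} ∩ {z | z.re < s₂} ∩ Metric.ball z₀ 1,
      inter_mem (inter_mem
        ((isOpen_lt continuous_const Complex.continuous_re).mem_nhds hs₁')
        ((isOpen_lt Complex.continuous_re continuous_const).mem_nhds hs₂))
        (Metric.ball_mem_nhds _ one_pos), _,
      ((integrable_min_mixR_mixQ hbs hs₁ (by linarith) (e := η - 1) (by linarith)).add
        (integrable_min_mixR_mixQ hbs (σ := s₂) (by linarith) (by linarith) (e := η - 1)
          (by linarith))).const_mul C, ?_⟩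
    filter_upwards [ae_mixMeasure bs] with w ⟨ha, hb, hb'⟩
    rintro z ⟨⟨hz1, hz2⟩, hz3⟩
    simp only [mem_ofPred_eq] at hz1 hz2
    have hzn : ‖z‖ ≤ ‖z₀‖ + 1 := by
      rw [mem_ball_iff_norm] at hz3
      have := norm_le_norm_add_norm_sub' z z₀
      linarith
    refine (h z hzn (by linarith) (by linarith) w ha hb hb').trans ?_
    have hQ := mixQ_pos ha.1 hb'
    have h0 := ha.1
    have hR : 0 ≤ mixR bs w := by rw [mixR]; positivity
    have := rpow_le_rpow_add_rpow hQ hz1.le hz2.le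
    simp only [Pi.add_apply]
    calc _ ≤ C * (min 1 (mixR bs w) * (mixQ bs w ^ s₁ + mixQ bs w ^ s₂) * w.1 ^ (η - 1)) := by
          gcongr
      _ = _ := by ring

theorem integrableOn_mul_one_sub_rpow :
    IntegrableOn (fun b : ℝ => (b * (1 - b)) ^ (-1 / 2 : ℝ)) (Ioo 0 1) := by
  have h := (Complex.betaIntegral_convergent (u := 1 / 2) (v := 1 / 2) (by norm_num)
    (by norm_num)).norm
  rw [intervalIntegrable_iff_integrableOn_Ioo_of_le zero_le_one] at h
  refine h.congr_fun (fun b hb => ?_) measurableSet_Ioo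
  have h1 := hb.1
  have h2 : 0 < 1 - b := sub_pos.2 hb.2
  have e1 : (1 - (b : ℂ)) = ((1 - b : ℝ) : ℂ) := by push_cast; rfl
  simp only
  rw [norm_mul, e1, Complex.norm_cpow_eq_rpow_re_of_pos h1,
    Complex.norm_cpow_eq_rpow_re_of_pos h2, ← Real.mul_rpow h1.le h2.le]
  norm_num

theorem exists_binMixKL_rpow_le {M : ℕ} {bs : ℝ} (hbs : bs ∈ Ioo (0 : ℝ) 1) {s : ℝ} (hs : 0 < s) :
    ∃ C ≥ 0, ∀ w : ℝ × ℝ × ℝ, w.1 ∈ Icc (0 : ℝ) (1 / 2) → w.2.1 ∈ Icc (0 : ℝ) 1 →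
      w.2.2 ∈ Ioo (0 : ℝ) 1 → 0 ≤ binMixKL M bs w →
      binMixKL M bs w ^ s ≤ C * (w.2.2 * (1 - w.2.2)) ^ (-1 / 2 : ℝ) := by
  refine ⟨((M + 1) * (1 + M * (2 * s))) ^ s, by positivity, fun w ha h₁ h₂ hH => ?_⟩
  have hb := h₂.1
  have hb' := sub_pos.2 h₂.2
  have hle := binMixKL_le (M := M) hbs ha h₁ h₂
  set t := w.2.2 * (1 - w.2.2) with ht
  have ht0 : 0 < t := mul_pos hb hb'
  have ht1 : t ≤ 1 := by rw [ht]; nlinarith [h₂.2]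
  have hlog : -Real.log t ≤ t ^ (-(1 / (2 * s))) * (2 * s) := by
    have h := Real.log_le_rpow_div (x := t⁻¹) (by positivity) (ε := 1 / (2 * s)) (by positivity)
    rw [Real.log_inv, Real.inv_rpow ht0.le, ← Real.rpow_neg ht0.le] at h
    rwa [div_div_eq_mul_div, div_one] at h
  have hone : Real.log 2 ≤ t ^ (-(1 / (2 * s))) := by
    have h1 : (1 : ℝ) ≤ t ^ (-(1 / (2 * s))) :=
      Real.one_le_rpow_of_pos_of_le_one_of_nonpos ht0 ht1
        (by rw [neg_nonpos]; positivity)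
    have h2 := Real.log_two_lt_d9
    linarith
  have hKL : binMixKL M bs w ≤ (M + 1) * (1 + M * (2 * s)) * t ^ (-(1 / (2 * s))) := by
    refine hle.trans ?_
    have h3 := mul_le_mul_of_nonneg_left hlog (Nat.cast_nonneg (α := ℝ) M)
    calc (M + 1 : ℝ) * (Real.log 2 - M * Real.log t)
        ≤ (M + 1) * (t ^ (-(1 / (2 * s))) + M * (t ^ (-(1 / (2 * s))) * (2 * s))) := by
          gcongr
          linarith
      _ = _ := by ring
  refine (Real.rpow_le_rpow hH hKL hs.le).trans_eq ?_
  rw [Real.mul_rpow (by positivity) (by positivity), ← Real.rpow_mul ht0.le]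
  congr 2
  field_simp

theorem integrable_mul_one_sub_indicator {η : ℝ} (hη : 0 < η) (bs : ℝ) :
    Integrable (fun w : ℝ × ℝ × ℝ => w.1 ^ (η - 1) *
      (Ioo (0 : ℝ) 1).indicator (fun b => (b * (1 - b)) ^ (-1 / 2 : ℝ)) w.2.2)
      (mixMeasure bs) := by
  rw [mixMeasure_eq]
  have h1 : IntegrableOn (fun a : ℝ => a ^ (η - 1)) (Ioo 0 (1 / 2)) :=
    integrableOn_Ioo_rpow (by linarith) (by norm_num)
  have h2 : IntegrableOn (fun _ : ℝ => (1 : ℝ)) (Ioo 0 1 \ {bs}) :=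
    integrableOn_const (measure_ne_top_of_subset sdiff_subset (by simp)) (by simp)
  have h3 := integrableOn_mul_one_sub_rpow.integrable_indicator measurableSet_Ioo
  simpa using h1.mul_prod (Integrable.mul_prod h2 h3)

theorem exists_zetaIntegrand_bound {M : ℕ} (hM : 2 ≤ M) {bs : ℝ} (hbs : bs ∈ Ioo (0 : ℝ) 1)
    {η : ℝ} (hη : 0 < η) {ψ : ℝ × ℝ → ℝ} {Cψ : ℝ} (hψB : ∀ b, |ψ b| ≤ Cψ) {z₀ : ℂ}
    (hz₀ : -((1 + η) / 2) < z₀.re) (hz₀' : -(3 / 4) < z₀.re) :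
    ∃ V ∈ 𝓝 z₀, ∃ bound : ℝ × ℝ × ℝ → ℝ, Integrable bound (mixMeasure bs) ∧
      ∀ᵐ w ∂mixMeasure bs, ∀ z ∈ V, ‖zetaIntegrand M bs η ψ z w‖ ≤ bound w := by
  have hCψ : 0 ≤ Cψ := (abs_nonneg _).trans (hψB 0)
  obtain ⟨s₁, hs₁, hs₁'⟩ := exists_between
    (show max (-((1 + η) / 2)) (-(3 / 4)) < min z₀.re (-1 / 2) by
      refine max_lt (lt_min hz₀ (by linarith)) (lt_min hz₀' (by norm_num)))
  rw [max_lt_iff] at hs₁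
  rw [lt_min_iff] at hs₁'
  obtain ⟨c, hc, hc1, h⟩ := exists_common_lower_bound hM hbs
  set s₂ := |z₀.re| + 1 with hs₂
  have hs₂0 : 0 < s₂ := by positivity
  obtain ⟨C₂, hC₂, h₂⟩ := exists_binMixKL_rpow_le (M := M) hbs hs₂0
  refine ⟨{z | s₁ < z.re} ∩ {z | z.re < s₂},
    inter_mem ((isOpen_lt continuous_const Complex.continuous_re).mem_nhds hs₁'.1)
      ((isOpen_lt Complex.continuous_re continuous_const).mem_nhds
        (by simp only [mem_ofPred_eq]; linarith [le_abs_self z₀.re])), _,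
    ((integrable_mixQ_rpow_mul hbs hs₁'.2 hs₁.1 hs₁.2).const_mul (c⁻¹ * 2 * Cψ)).add
      ((integrable_mul_one_sub_indicator hη bs).const_mul (C₂ * 2 * Cψ)), ?_⟩
  filter_upwards [ae_mixMeasure bs] with w ⟨ha, hb, hb'⟩
  rintro z ⟨hz1, hz2⟩
  simp only [mem_ofPred_eq] at hz1 hz2
  have hQ := mixQ_pos ha.1 hb'
  have h0 := ha.1
  simp only [Pi.add_apply]
  by_cases hb₂ : w.2.2 ∈ Ioo (0 : ℝ) 1
  · rw [zetaIntegrand, indicator_of_mem (by exact hb₂), indicator_of_mem hb₂]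
    have hk := (h w ha hb).2 hb₂
    have hH : 0 < binMixKL M bs w := lt_of_lt_of_le (by positivity) hk
    have hw := mixWeight_pos (η := η) ha
    have hww := mixWeight_le hη ha
    rw [norm_mul, Complex.norm_cpow_eq_rpow_re_of_pos hH, Complex.norm_real, Real.norm_eq_abs,
      abs_mul, abs_of_pos hw]
    have k1 := rpow_le_rpow_add_rpow hH hz1.le hz2.le
    have k2 := rpow_le_inv_mul_rpow hc hc1 hQ hk (s := s₁) (by linarith) (by linarith)
    have k3 := h₂ w ⟨ha.1.le, ha.2.le⟩ (Ioo_subset_Icc_self hb) hb₂ hH.le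
    have hb0 := hb₂.1
    have hb1 := sub_pos.2 hb₂.2
    calc _ ≤ (c⁻¹ * mixQ bs w ^ s₁ + C₂ * (w.2.2 * (1 - w.2.2)) ^ (-1 / 2 : ℝ)) *
          ((2 * w.1 ^ (η - 1)) * Cψ) := by
          gcongr
          · linarith
          · exact hψB _
      _ = _ := by ring
  · rw [zetaIntegrand, indicator_of_notMem (by exact hb₂), indicator_of_notMem hb₂, norm_zero]
    positivity

theorem integrable_zetaIntegrand {M : ℕ} (hM : 2 ≤ M) {bs : ℝ} (hbs : bs ∈ Ioo (0 : ℝ) 1)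
    {η : ℝ} (hη : 0 < η) {ψ : ℝ × ℝ → ℝ} (hψm : Measurable ψ) {Cψ : ℝ} (hψB : ∀ b, |ψ b| ≤ Cψ)
    {z : ℂ} (hz : -((1 + η) / 2) < z.re) (hz' : -(3 / 4) < z.re) :
    Integrable (zetaIntegrand M bs η ψ z) (mixMeasure bs) := by
  obtain ⟨V, hV, bound, hint, hle⟩ := exists_zetaIntegrand_bound hM hbs hη hψB hz hz'
  refine hint.mono' (measurable_zetaIntegrand M bs η hψm z).aestronglyMeasurable ?_
  filter_upwards [hle] with w hw
  exact hw z (mem_of_mem_nhds hV)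

theorem differentiableOn_integral_zetaIntegrand {M : ℕ} (hM : 2 ≤ M) {bs : ℝ}
    (hbs : bs ∈ Ioo (0 : ℝ) 1) {η : ℝ} (hη : 0 < η) {ψ : ℝ × ℝ → ℝ} (hψm : Measurable ψ)
    {Cψ : ℝ} (hψB : ∀ b, |ψ b| ≤ Cψ) :
    DifferentiableOn ℂ (fun z => ∫ w, zetaIntegrand M bs η ψ z w ∂mixMeasure bs)
      {z | -((1 + η) / 2) < z.re ∧ -(3 / 4) < z.re} := by
  refine differentiableOn_integral_of_dominated
    ((isOpen_lt continuous_const Complex.continuous_re).inter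
      (isOpen_lt continuous_const Complex.continuous_re)) ?_ ?_ ?_
  · intro z _
    exact (measurable_zetaIntegrand M bs η hψm z).aestronglyMeasurable
  · filter_upwards [ae_differentiable_integrands hM hbs η ψ] with w hw
    exact hw.1.differentiableOn
  · rintro z₀ ⟨hz₀, hz₀'⟩
    exact exists_zetaIntegrand_bound hM hbs hη hψB hz₀ hz₀'

theorem exists_lipschitzOnWith_of_contDiffAt {E : Type*} [NormedAddCommGroup E] [NormedSpace ℝ E]
    {f : E → ℝ} {s : Set E} (hs : IsCompact s) (hf : ∀ x ∈ s, ContDiffAt ℝ 1 f x) :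
    ∃ K, LipschitzOnWith K f s := by
  refine LocallyLipschitzOn.exists_lipschitzOnWith_of_compact hs fun x hx => ?_
  obtain ⟨K, t, ht, h⟩ := (hf x hx).exists_lipschitzOnWith
  exact ⟨K, t, mem_nhdsWithin_of_mem_nhds ht, h⟩

theorem integral_modelIntegrand_fiber {M : ℕ} (hM : 2 ≤ M) {bs : ℝ} (hbs : bs ∈ Ioo (0 : ℝ) 1)
    (η : ℝ) (ψ : ℝ × ℝ → ℝ) (z : ℂ) {a b₁ : ℝ} (ha : a ∈ Ioo (0 : ℝ) (1 / 2)) (hb : b₁ ≠ bs) :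
    ∫ b₂, modelIntegrand M bs η ψ z (a, b₁, b₂) =
      ((√(modelA M bs) : ℂ)⁻¹ * lineBeta z) *
        ((((a ^ (1 : ℝ) * (1 - a)⁻¹ : ℝ) : ℂ) ^ (2 * z + 1) *
          ((a ^ (η - 1) * (1 - a) ^ (η - 2) : ℝ) : ℂ)) *
        (((√(modelD M bs (b₁ - bs)) * (b₁ - bs) ^ 2 : ℝ) : ℂ) ^ (2 * z + 1) *
          (ψ (b₁, bs) : ℂ))) := by
  have h0 := ha.1
  have h1 : 0 < 1 - a := by linarith [ha.2]
  have hA := modelA_pos hM hbs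
  have hD := modelD_pos hM hbs (b₁ - bs)
  have hu := sub_ne_zero.2 hb
  have hy : 0 < mixY bs (a, b₁, 0) := by
    simp only [mixY]
    positivity
  have e1 : √(modelD M bs (b₁ - bs)) * mixY bs (a, b₁, 0) =
      (a ^ (1 : ℝ) * (1 - a)⁻¹) * (√(modelD M bs (b₁ - bs)) * (b₁ - bs) ^ 2) := by
    rw [mixY, Real.rpow_one]
    field_simp
  have e2 : (1 - a) ^ (η - 1) = (1 - a) * (1 - a) ^ (η - 2) := by
    rw [show η - 1 = 1 + (η - 2) by ring, Real.rpow_add h1, Real.rpow_one]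
  simp only [modelIntegrand, modelKL, modelForm_mix_eq hM hbs (by linarith : a < 1)]
  rw [integral_mul_const, integral_quadratic_cpow (by positivity) (by positivity), e1,
    Complex.ofReal_mul (a ^ (1 : ℝ) * (1 - a)⁻¹),
    Complex.mul_cpow_ofReal_nonneg (by positivity) (by positivity), mixWeight, e2]
  have h2 : (1 : ℂ) - a ≠ 0 := by exact_mod_cast h1.ne'
  have h3 : (√(modelA M bs) : ℂ) ≠ 0 := by exact_mod_cast (Real.sqrt_pos.2 hA).ne'
  push_cast
  field_simp

theorem integral_modelIntegrand_eq {M : ℕ} (hM : 2 ≤ M) {bs : ℝ} (hbs : bs ∈ Ioo (0 : ℝ) 1)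
    {η : ℝ} {ψ : ℝ × ℝ → ℝ} {z : ℂ}
    (hint : Integrable (modelIntegrand M bs η ψ z) (mixMeasure bs)) :
    ∫ w, modelIntegrand M bs η ψ z w ∂mixMeasure bs =
      ((√(modelA M bs) : ℂ)⁻¹ * lineBeta z) *
        ((∫ a in Ioo (0 : ℝ) (1 / 2), ((a ^ (1 : ℝ) * (1 - a)⁻¹ : ℝ) : ℂ) ^ (2 * z + 1) *
          ((a ^ (η - 1) * (1 - a) ^ (η - 2) : ℝ) : ℂ)) *
        ∫ b in Ioo (0 : ℝ) 1 \ {bs},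
          ((√(modelD M bs (b - bs)) * (b - bs) ^ 2 : ℝ) : ℂ) ^ (2 * z + 1) *
            (ψ (b, bs) : ℂ)) := by
  rw [mixMeasure_eq] at hint ⊢
  rw [integral_prod _ hint, ← integral_mul_const, ← integral_const_mul]
  refine integral_congr_ae ?_
  filter_upwards [hint.prod_right_ae, ae_restrict_mem measurableSet_Ioo] with a h ha
  rw [integral_prod _ h, ← integral_const_mul, ← integral_const_mul]
  refine setIntegral_congr_fun (measurableSet_Ioo.diff (measurableSet_singleton _)) fun b hb => ?_
  exact integral_modelIntegrand_fiber hM hbs η ψ z ha hb.2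

theorem integrableOn_modelD_cpow {M : ℕ} (hM : 2 ≤ M) {bs : ℝ} (hbs : bs ∈ Ioo (0 : ℝ) 1)
    {ψ : ℝ × ℝ → ℝ} (hψ : Continuous ψ) {Z : ℂ} (hZ : 0 < 2 * Z.re + 1) :
    IntegrableOn (fun b : ℝ => ((√(modelD M bs (b - bs)) * (b - bs) ^ 2 : ℝ) : ℂ) ^ Z *
      (ψ (b, bs) : ℂ)) (Ioo 0 1 \ {bs}) := by
  have hD := (contDiff_modelD M bs).continuous
  obtain ⟨C, hC⟩ := isCompact_Icc.exists_bound_of_continuousOn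
    (f := fun b => √(modelD M bs (b - bs)) ^ Z.re * ψ (b, bs)) (s := Icc (0 : ℝ) 1) (by
      refine ContinuousOn.mul (ContinuousOn.rpow_const (by fun_prop) fun b _ => ?_) (by fun_prop)
      exact Or.inl (Real.sqrt_pos.2 (modelD_pos hM hbs _)).ne')
  refine ((integrableOn_abs_sub_rpow hbs (s := 2 * Z.re) (by linarith)).const_mul C).mono'
    (Measurable.aestronglyMeasurable (by have := hD.measurable; fun_prop)) ?_
  filter_upwards [ae_restrict_mem (measurableSet_Ioo.diff (measurableSet_singleton bs))] with b hb
  have hu := sub_ne_zero.2 hb.2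
  have hs := Real.sqrt_pos.2 (modelD_pos hM hbs (b - bs))
  have h1 := hC b (Ioo_subset_Icc_self hb.1)
  rw [Real.norm_eq_abs, abs_mul, abs_of_pos (Real.rpow_pos_of_pos hs _)] at h1
  rw [norm_mul, Complex.norm_cpow_eq_rpow_re_of_pos (by positivity), Complex.norm_real,
    Real.norm_eq_abs, Real.mul_rpow hs.le (sq_nonneg _), Real.rpow_mul (abs_nonneg _),
    Real.rpow_two, sq_abs]
  calc _ = √(modelD M bs (b - bs)) ^ Z.re * |ψ (b, bs)| * ((b - bs) ^ 2) ^ Z.re := by ring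
    _ ≤ _ := by gcongr

theorem integral_modelD_cpow_split {M : ℕ} (hM : 2 ≤ M) {bs : ℝ} (hbs : bs ∈ Ioo (0 : ℝ) 1)
    {ψ : ℝ × ℝ → ℝ} (hψ : Continuous ψ) {Z : ℂ} (hZ : 0 < 2 * Z.re + 1) :
    ∫ b in Ioo (0 : ℝ) 1 \ {bs}, ((√(modelD M bs (b - bs)) * (b - bs) ^ 2 : ℝ) : ℂ) ^ Z *
        (ψ (b, bs) : ℂ) =
      (∫ s in Ioo (0 : ℝ) (1 - bs), ((s ^ (2 : ℝ) * √(modelD M bs s) : ℝ) : ℂ) ^ Z *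
        ((s ^ ((1 : ℝ) - 1) * ψ (bs + s, bs) : ℝ) : ℂ)) +
      ∫ s in Ioo (0 : ℝ) bs, ((s ^ (2 : ℝ) * √(modelD M bs (-s)) : ℝ) : ℂ) ^ Z *
        ((s ^ ((1 : ℝ) - 1) * ψ (bs - s, bs) : ℝ) : ℂ) := by
  set f : ℝ → ℂ := fun b => ((√(modelD M bs (b - bs)) * (b - bs) ^ 2 : ℝ) : ℂ) ^ Z *
        (ψ (b, bs) : ℂ) with hf
  have hint : IntegrableOn f (Ioo 0 1 \ {bs}) := integrableOn_modelD_cpow hM hbs hψ hZ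
  have hset : Ioo (0 : ℝ) 1 \ {bs} = Ioo bs 1 ∪ Ioo 0 bs := by
    have := hbs.1
    have := hbs.2
    ext b
    simp only [Set.mem_sdiff, mem_Ioo, mem_singleton_iff, mem_union]
    constructor
    · rintro ⟨⟨h1, h2⟩, h3⟩
      rcases lt_or_gt_of_ne h3 with h | h
      · exact Or.inr ⟨h1, h⟩
      · exact Or.inl ⟨h, h2⟩
    · rintro (⟨h1, h2⟩ | ⟨h1, h2⟩)
      · exact ⟨⟨by linarith, h2⟩, h1.ne'⟩
      · exact ⟨⟨h1, by linarith⟩, h2.ne⟩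
  rw [hset] at hint ⊢
  rw [setIntegral_union (by
      rw [Set.disjoint_left]
      exact fun b h1 h2 => lt_asymm h1.1 h2.2) measurableSet_Ioo
    (hint.mono_set subset_union_left) (hint.mono_set subset_union_right)]
  congr 1
  · have h := (measurePreserving_add_left volume bs).setIntegral_preimage_emb
      (measurableEmbedding_addLeft bs) f (Ioo bs 1)
    rw [← h]
    simp only [preimage_const_add_Ioo, sub_self]
    refine setIntegral_congr_fun measurableSet_Ioo fun s hs => ?_
    simp only [hf, add_sub_cancel_left, Real.rpow_zero, one_mul, Real.rpow_two]
    rw [mul_comm (√_)]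
  · have h := (Measure.measurePreserving_sub_left volume bs).setIntegral_preimage_emb
      (MeasurableEquiv.subLeft bs).measurableEmbedding f (Ioo 0 bs)
    rw [← h]
    simp only [preimage_const_sub_Ioo, sub_self, sub_zero]
    refine setIntegral_congr_fun measurableSet_Ioo fun s hs => ?_
    simp only [hf, sub_sub_cancel_left, Real.rpow_zero, one_mul, Real.rpow_two, neg_sq]
    rw [mul_comm (√_)]

theorem exists_integral_modelIntegrand_eq {M : ℕ} (hM : 2 ≤ M) {bs : ℝ}
    (hbs : bs ∈ Ioo (0 : ℝ) 1) {η : ℝ} (hη : 0 < η) {ψ : ℝ × ℝ → ℝ} (hψ0 : ∀ b, 0 < ψ b)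
    {Cψ : ℝ} (hψB : ∀ b, |ψ b| ≤ Cψ) {L : NNReal} (hψL : LipschitzWith L ψ) :
    ∃ N : ℂ → ℂ, DifferentiableOn ℂ N {z | -1 < z.re ∧ z.re < -1 / 2} ∧
      (∀ z : ℂ, -((1 + η) / 2) < z.re → -(3 / 4) < z.re → z.re < -1 / 2 →
        ∫ w, modelIntegrand M bs η ψ z w ∂mixMeasure bs =
          N z / ((2 * z + 1 + η) * (4 * z + 3))) ∧
      ∀ t : ℝ, -((1 + η) / 2) ≤ t → -(3 / 4) ≤ t → t < -1 / 2 → N t ≠ 0 := by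
  have hA := modelA_pos hM hbs
  have hD : ContDiff ℝ 1 fun u => √(modelD M bs u) :=
    (contDiff_modelD M bs).sqrt fun u => (modelD_pos hM hbs u).ne'
  have hDpos : ∀ u, 0 < √(modelD M bs u) := fun u => Real.sqrt_pos.2 (modelD_pos hM hbs u)
  have h1a : ∀ a ∈ Icc (0 : ℝ) (1 / 2), 0 < 1 - a := fun a ha => by linarith [ha.2]
  obtain ⟨K₁, hK₁⟩ := exists_lipschitzOnWith_of_contDiffAt (f := fun a : ℝ => (1 - a)⁻¹)
    (isCompact_Icc (a := (0 : ℝ)) (b := 1 / 2)) fun a ha =>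
      (contDiffAt_const.sub contDiffAt_id).inv (h1a a ha).ne'
  obtain ⟨K₂, hK₂⟩ := exists_lipschitzOnWith_of_contDiffAt (f := fun a : ℝ => (1 - a) ^ (η - 2))
    (isCompact_Icc (a := (0 : ℝ)) (b := 1 / 2)) fun a ha =>
      (contDiffAt_const.sub contDiffAt_id).rpow_const_of_ne (h1a a ha).ne'
  obtain ⟨gX, hgX, hgX', hgX0⟩ := exists_mellin_continuation (p := 1) (q := η) (c := 1 / 2)
    (by norm_num) hK₁ hK₂ (fun a ha => inv_pos.2 (h1a a ha))
    (fun a ha => Real.rpow_pos_of_pos (h1a a ha) _)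
  obtain ⟨K₃, hK₃⟩ := exists_lipschitzOnWith_of_contDiffAt (f := fun s => √(modelD M bs s))
    (isCompact_Icc (a := (0 : ℝ)) (b := 1 - bs)) fun a ha => hD.contDiffAt
  obtain ⟨K₄, hK₄⟩ := exists_lipschitzOnWith_of_contDiffAt (f := fun s => √(modelD M bs (-s)))
    (isCompact_Icc (a := (0 : ℝ)) (b := bs)) fun a ha => (hD.comp contDiff_neg).contDiffAt
  have hL₁ : LipschitzWith L fun s => ψ (bs + s, bs) := by
    refine LipschitzWith.of_dist_le_mul fun s t => ?_
    refine (hψL.dist_le_mul _ _).trans_eq ?_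
    rw [Prod.dist_eq, dist_self, max_eq_left dist_nonneg, dist_add_left]
  have hL₂ : LipschitzWith L fun s => ψ (bs - s, bs) := by
    refine LipschitzWith.of_dist_le_mul fun s t => ?_
    refine (hψL.dist_le_mul _ _).trans_eq ?_
    rw [Prod.dist_eq, dist_self, max_eq_left dist_nonneg, dist_sub_left]
  obtain ⟨gP, hgP, hgP', hgP0⟩ := exists_mellin_continuation (p := 2) (q := 1)
    (sub_pos.2 hbs.2) hK₃ hL₁.lipschitzOnWith (fun _ _ => hDpos _) (fun _ _ => hψ0 _)
  obtain ⟨gN, hgN, hgN', hgN0⟩ := exists_mellin_continuation (p := 2) (q := 1)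
    hbs.1 hK₄ hL₂.lipschitzOnWith (fun _ _ => hDpos _) (fun _ _ => hψ0 _)
  have hre : ∀ z : ℂ, (2 * z + 1).re = 2 * z.re + 1 := fun z => by simp
  refine ⟨fun z => ((√(modelA M bs) : ℂ)⁻¹ * lineBeta z) *
    (gX (2 * z + 1) * (gP (2 * z + 1) + gN (2 * z + 1))), ?_, ?_, ?_⟩
  · have hlin : DifferentiableOn ℂ (fun z : ℂ => 2 * z + 1) {z | -1 < z.re ∧ z.re < -1 / 2} := by
      fun_prop
    refine (((differentiableOn_lineBeta.mono fun z hz => hz.2).const_mul _)).mul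
      ((hgX.comp hlin fun z hz => ?_).mul
        ((hgP.comp hlin fun z hz => ?_).add (hgN.comp hlin fun z hz => ?_))) <;>
    · simp only [mem_ofPred_eq, hre] at hz ⊢
      linarith [hz.1]
  · intro z hz1 hz2 hz3
    have hint := (integrable_integrands hM hbs hη hψL.continuous.measurable hψB hz1 hz2 hz3).2
    have hZ : 0 < 2 * (2 * z + 1).re + 1 := by rw [hre]; linarith
    rw [integral_modelIntegrand_eq hM hbs hint,
      integral_modelD_cpow_split hM hbs hψL.continuous hZ,
      hgX' _ (by rw [hre]; linarith), hgP' _ hZ, hgN' _ hZ]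
    have e1 : ((1 : ℝ) : ℂ) * (2 * z + 1) + (η : ℂ) = 2 * z + 1 + η := by push_cast; ring
    have e2 : ((2 : ℝ) : ℂ) * (2 * z + 1) + ((1 : ℝ) : ℂ) = 4 * z + 3 := by push_cast; ring
    rw [e1, e2, ← add_div, div_mul_div_comm, mul_div_assoc']
  · intro t ht1 ht2 ht3
    have e : (2 * (t : ℂ) + 1) = ((2 * t + 1 : ℝ) : ℂ) := by push_cast; rfl
    have p1 := lineBeta_re_pos ht3
    have p2 := hgX0 (2 * t + 1) (by linarith)
    have p3 := hgP0 (2 * t + 1) (by linarith)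
    have p4 := hgN0 (2 * t + 1) (by linarith)
    have hne : ∀ {x : ℂ}, 0 < x.re → x ≠ 0 := by
      rintro x hx rfl
      simp at hx
    simp only
    rw [e]
    refine mul_ne_zero (mul_ne_zero (inv_ne_zero ?_) (hne p1))
      (mul_ne_zero (hne p2) (hne (by rw [Complex.add_re]; linarith)))
    exact_mod_cast (Real.sqrt_pos.2 hA).ne'

/-- The integrand of `binMixZeta`. -/
noncomputable def fullIntegrand (M : ℕ) (bs η : ℝ) (ψ : ℝ × ℝ → ℝ) (z : ℂ) (w : ℝ × ℝ × ℝ) : ℂ :=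
  (if (∀ m ∈ Finset.range (M + 1), 0 < binMix M w m) ∧ binMixKL M bs w ≠ 0 then
      (binMixKL M bs w : ℂ) ^ z
    else 0) *
  ((Real.Gamma (2 * η) / Real.Gamma η ^ 2 * w.1 ^ (η - 1) * (1 - w.1) ^ (η - 1) *
      ψ w.2 : ℝ) : ℂ)

/-- The symmetry exchanging the two mixture components. -/
def mixSwap : ℝ × ℝ × ℝ ≃ᵐ ℝ × ℝ × ℝ :=
  (MeasurableEquiv.subLeft 1).prodCongr MeasurableEquiv.prodComm

theorem mixSwap_apply (w : ℝ × ℝ × ℝ) : mixSwap w = (1 - w.1, w.2.2, w.2.1) := rfl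

theorem measurePreserving_mixSwap : MeasurePreserving mixSwap :=
  (Measure.measurePreserving_sub_left volume (1 : ℝ)).prod Measure.measurePreserving_swap

theorem binMix_mixSwap (M : ℕ) (w : ℝ × ℝ × ℝ) (m : ℕ) :
    binMix M (mixSwap w) m = binMix M w m := by
  simp only [binMix, mixSwap_apply]
  ring

theorem fullIntegrand_mixSwap (M : ℕ) (bs η : ℝ) (ψ : ℝ × ℝ → ℝ) (z : ℂ) (w : ℝ × ℝ × ℝ) :
    fullIntegrand M bs η ψ z (mixSwap w) = fullIntegrand M bs η (fun b => ψ b.swap) z w := by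
  have h : binMixKL M bs (mixSwap w) = binMixKL M bs w := by simp only [binMixKL, binMix_mixSwap]
  simp only [fullIntegrand, h, binMix_mixSwap]
  simp only [mixSwap_apply, sub_sub_cancel, Prod.swap]
  congr 2
  ring

/-- The half of the parameter cube on which the first component is the lighter one. -/
def halfCube (bs : ℝ) : Set (ℝ × ℝ × ℝ) :=
  Ioo (0 : ℝ) (1 / 2) ×ˢ (Ioo (0 : ℝ) 1 \ {bs}) ×ˢ Ioo (0 : ℝ) 1

theorem measurableSet_halfCube (bs : ℝ) : MeasurableSet (halfCube bs) :=
  measurableSet_Ioo.prod ((measurableSet_Ioo.diff (measurableSet_singleton _)).prod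
    measurableSet_Ioo)

theorem Icc_prod_ae_eq_halfCube_union (bs : ℝ) :
    (Icc (0 : ℝ) 1 ×ˢ Icc (0 : ℝ) 1 ×ˢ Icc (0 : ℝ) 1 : Set (ℝ × ℝ × ℝ)) =ᵐ[volume]
      (halfCube bs ∪ mixSwap ⁻¹' halfCube bs : Set (ℝ × ℝ × ℝ)) := by
  have hI : (Icc (0 : ℝ) 1 : Set ℝ) =ᵐ[volume] (Ioo (0 : ℝ) 1 : Set ℝ) := Ioo_ae_eq_Icc.symm
  have hb : (Icc (0 : ℝ) 1 : Set ℝ) =ᵐ[volume] (Ioo (0 : ℝ) 1 \ {bs} : Set ℝ) :=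
    hI.trans (sdiff_null_ae_eq_self (by simp)).symm
  have hu : (Icc (0 : ℝ) 1 : Set ℝ) = Icc 0 (1 / 2) ∪ Icc (1 / 2) 1 :=
    (Icc_union_Icc_eq_Icc (by norm_num) (by norm_num)).symm
  have hpre : mixSwap ⁻¹' halfCube bs =
      Ioo (1 / 2 : ℝ) 1 ×ˢ Ioo (0 : ℝ) 1 ×ˢ (Ioo (0 : ℝ) 1 \ {bs}) := by
    ext w
    simp only [halfCube, mem_preimage, mixSwap_apply, mem_prod, mem_Ioo]
    constructor
    · rintro ⟨⟨h1, h2⟩, h3, h4⟩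
      exact ⟨⟨by linarith, by linarith⟩, h4, h3⟩
    · rintro ⟨⟨h1, h2⟩, h3, h4⟩
      exact ⟨⟨by linarith, by linarith⟩, h4, h3⟩
  rw [hpre, halfCube]
  nth_rewrite 1 [hu]
  rw [union_prod]
  exact (Measure.set_prod_ae_eq Ioo_ae_eq_Icc.symm (Measure.set_prod_ae_eq hb hI)).union
    (Measure.set_prod_ae_eq Ioo_ae_eq_Icc.symm (Measure.set_prod_ae_eq hI hb))

theorem fullIntegrand_eqOn {M : ℕ} (hM : 2 ≤ M) {bs : ℝ} (hbs : bs ∈ Ioo (0 : ℝ) 1)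
    {η : ℝ} {ψ ψ₁ : ℝ × ℝ → ℝ} (hψ₁ : ∀ b ∈ Icc (0 : ℝ) 1 ×ˢ Icc (0 : ℝ) 1,
      ψ₁ b = Real.Gamma (2 * η) / Real.Gamma η ^ 2 * ψ b) (z : ℂ) :
    EqOn (fullIntegrand M bs η ψ z) (zetaIntegrand M bs η ψ₁ z) (halfCube bs) := by
  rintro w ⟨ha, ⟨hb, hb'⟩, hb₂⟩
  obtain ⟨c, hc, -, h⟩ := exists_common_lower_bound hM hbs
  have hQ := mixQ_pos ha.1 hb'
  have hH : 0 < binMixKL M bs w := lt_of_lt_of_le (by positivity) ((h w ha hb).2 hb₂)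
  have hpos : ∀ m ∈ Finset.range (M + 1), 0 < binMix M w m := fun m hm =>
    binMix_pos hm ⟨ha.1.le, by linarith [ha.2]⟩ (Ioo_subset_Icc_self hb) hb₂
  rw [fullIntegrand, if_pos ⟨hpos, hH.ne'⟩, zetaIntegrand, indicator_of_mem (by exact hb₂),
    hψ₁ _ ⟨Ioo_subset_Icc_self hb, Ioo_subset_Icc_self hb₂⟩, mixWeight]
  congr 2
  ring

theorem mixMeasure_restrict (bs : ℝ) :
    (mixMeasure bs).restrict {w : ℝ × ℝ × ℝ | w.2.2 ∈ Ioo (0 : ℝ) 1} =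
      volume.restrict (halfCube bs) := by
  have h : MeasurableSet {w : ℝ × ℝ × ℝ | w.2.2 ∈ Ioo (0 : ℝ) 1} :=
    measurableSet_Ioo.preimage (by fun_prop)
  rw [mixMeasure, Measure.restrict_restrict h]
  congr 1
  ext w
  simp only [halfCube, mem_inter_iff, mem_prod, mem_ofPred_eq, mem_univ]
  tauto

theorem integral_zetaIntegrand_eq (M : ℕ) (bs η : ℝ) (ψ : ℝ × ℝ → ℝ) (z : ℂ) :
    ∫ w, zetaIntegrand M bs η ψ z w ∂mixMeasure bs =
      ∫ w in halfCube bs, zetaIntegrand M bs η ψ z w := by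
  rw [← mixMeasure_restrict, setIntegral_eq_integral_of_forall_compl_eq_zero fun w hw => ?_]
  exact indicator_of_notMem hw _

theorem binMixZeta_eq_integral_zetaIntegrand {M : ℕ} (hM : 2 ≤ M) {bs : ℝ}
    (hbs : bs ∈ Ioo (0 : ℝ) 1) {η : ℝ} (hη : 0 < η) {ψ ψ₁ ψ₂ : ℝ × ℝ → ℝ}
    (hψ₁ : ∀ b ∈ Icc (0 : ℝ) 1 ×ˢ Icc (0 : ℝ) 1,
      ψ₁ b = Real.Gamma (2 * η) / Real.Gamma η ^ 2 * ψ b)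
    (hψ₂ : ∀ b ∈ Icc (0 : ℝ) 1 ×ˢ Icc (0 : ℝ) 1,
      ψ₂ b = Real.Gamma (2 * η) / Real.Gamma η ^ 2 * ψ b.swap)
    (hm₁ : Measurable ψ₁) (hm₂ : Measurable ψ₂) {C₁ C₂ : ℝ} (hB₁ : ∀ b, |ψ₁ b| ≤ C₁)
    (hB₂ : ∀ b, |ψ₂ b| ≤ C₂) {z : ℂ} (hz : -((1 + η) / 2) < z.re) (hz' : -(3 / 4) < z.re) :
    binMixZeta M bs η ψ z =
      ∫ w, zetaIntegrand M bs η (fun b => ψ₁ b + ψ₂ b) z w ∂mixMeasure bs := by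
  have hS := measurableSet_halfCube bs
  have hint : ∀ {ψ' : ℝ × ℝ → ℝ} {C : ℝ}, Measurable ψ' → (∀ b, |ψ' b| ≤ C) →
      IntegrableOn (zetaIntegrand M bs η ψ' z) (halfCube bs) := fun hm hB => by
    have h := (integrable_zetaIntegrand hM hbs hη hm hB hz hz').integrableOn
      (s := {w : ℝ × ℝ × ℝ | w.2.2 ∈ Ioo (0 : ℝ) 1})
    rwa [IntegrableOn, mixMeasure_restrict] at h
  have i₁ := hint hm₁ hB₁
  have i₂ := hint hm₂ hB₂
  have e₁ := fullIntegrand_eqOn hM hbs hψ₁ z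
  have e₂ := fullIntegrand_eqOn (ψ := fun b => ψ b.swap) hM hbs hψ₂ z
  have hcomp : fullIntegrand M bs η ψ z =
      fullIntegrand M bs η (fun b => ψ b.swap) z ∘ mixSwap := by
    ext w
    simp only [Function.comp_apply, fullIntegrand_mixSwap, Prod.swap_swap]
  have j₁ : IntegrableOn (fullIntegrand M bs η ψ z) (halfCube bs) :=
    i₁.congr_fun e₁.symm hS
  have j₂ : IntegrableOn (fullIntegrand M bs η ψ z) (mixSwap ⁻¹' halfCube bs) := by
    rw [hcomp, measurePreserving_mixSwap.integrableOn_comp_preimage mixSwap.measurableEmbedding]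
    exact i₂.congr_fun e₂.symm hS
  have hdisj : Disjoint (halfCube bs) (mixSwap ⁻¹' halfCube bs) := by
    rw [Set.disjoint_left]
    rintro w ⟨h1, -⟩ ⟨h2, -⟩
    have h3 : 1 - w.1 < 1 / 2 := h2.2
    linarith [h1.2]
  have hsecond : ∫ w in mixSwap ⁻¹' halfCube bs, fullIntegrand M bs η ψ z w =
      ∫ w in halfCube bs, zetaIntegrand M bs η ψ₂ z w := by
    rw [hcomp, ← setIntegral_congr_fun hS e₂]
    exact measurePreserving_mixSwap.setIntegral_preimage_emb mixSwap.measurableEmbedding _ _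
  change ∫ w in _, fullIntegrand M bs η ψ z w = _
  rw [setIntegral_congr_set (Icc_prod_ae_eq_halfCube_union bs),
    setIntegral_union hdisj (mixSwap.measurable hS) j₁ j₂, hsecond,
    setIntegral_congr_fun hS e₁, integral_zetaIntegrand_eq, ← integral_add i₁ i₂]
  refine setIntegral_congr_fun hS fun w hw => ?_
  simp only [zetaIntegrand]
  rw [indicator_of_mem (by exact hw.2.2), indicator_of_mem (by exact hw.2.2),
    indicator_of_mem (by exact hw.2.2)]
  push_cast
  ring

theorem exists_lipschitzWith_extension {f : ℝ × ℝ → ℝ}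
    (hf : ∀ b ∈ Icc (0 : ℝ) 1 ×ˢ Icc (0 : ℝ) 1, ContDiffAt ℝ 1 f b)
    (hpos : ∀ b ∈ Icc (0 : ℝ) 1 ×ˢ Icc (0 : ℝ) 1, 0 < f b) :
    ∃ (F : ℝ × ℝ → ℝ) (L : NNReal) (C : ℝ), LipschitzWith L F ∧ (∀ b, 0 < F b) ∧
      (∀ b, |F b| ≤ C) ∧ ∀ b ∈ Icc (0 : ℝ) 1 ×ˢ Icc (0 : ℝ) 1, F b = f b := by
  have hcomp : IsCompact (Icc (0 : ℝ) 1 ×ˢ Icc (0 : ℝ) 1) := isCompact_Icc.prod isCompact_Icc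
  obtain ⟨K, hK⟩ := exists_lipschitzOnWith_of_contDiffAt hcomp hf
  obtain ⟨C, hC⟩ := hcomp.exists_bound_of_continuousOn hK.continuousOn
  set p : ℝ → ℝ := fun x => projIcc (0 : ℝ) 1 zero_le_one x with hp
  have hp1 : LipschitzWith 1 p := LipschitzWith.projIcc zero_le_one
  set q : ℝ × ℝ → ℝ × ℝ := fun b => (p b.1, p b.2) with hq
  have hqm : ∀ b, q b ∈ Icc (0 : ℝ) 1 ×ˢ Icc (0 : ℝ) 1 := fun b =>
    ⟨(projIcc (0 : ℝ) 1 zero_le_one b.1).2, (projIcc (0 : ℝ) 1 zero_le_one b.2).2⟩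
  have hqL := (hp1.comp LipschitzWith.prod_fst).prodMk (hp1.comp LipschitzWith.prod_snd)
  have hfq := lipschitzOnWith_univ.1 (hK.comp (lipschitzOnWith_univ.2 hqL) fun b _ => hqm b)
  refine ⟨f ∘ q, _, C, hfq, fun b => hpos _ (hqm b), fun b => hC _ (hqm b), fun b hb => ?_⟩
  have : q b = b := by
    simp only [hq, hp, projIcc_of_mem zero_le_one hb.1, projIcc_of_mem zero_le_one hb.2]
  rw [Function.comp_apply, this]

theorem exists_analytic_pole_factor {l ε : ℝ} (hl : 1 / 2 < l) {m : ℕ} {Z Φ : ℂ → ℂ}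
    (hZ : DifferentiableOn ℂ Z {z | -l < z.re})
    (hΦ : DifferentiableOn ℂ Φ {z | -l - ε < z.re ∧ z.re < -1 / 2})
    (hZΦ : ∀ z : ℂ, -l < z.re → z.re < -1 / 2 → (z + l) ^ m * Z z = Φ z)
    (h0 : Φ (-(l : ℂ)) ≠ 0) :
    ∃ g : ℂ → ℂ, AnalyticOnNhd ℂ g {z | -l - ε < z.re} ∧ g (-(l : ℂ)) ≠ 0 ∧
      ∀ z : ℂ, 0 < z.re → Z z = g z / (z + l) ^ m := by
  classical
  set g : ℂ → ℂ := fun z => if -l < z.re then (z + l) ^ m * Z z else Φ z with hg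
  have ho₁ : IsOpen {z : ℂ | -l < z.re} := isOpen_lt continuous_const Complex.continuous_re
  have ho₂ : IsOpen {z : ℂ | -l - ε < z.re ∧ z.re < -1 / 2} :=
    (isOpen_lt continuous_const Complex.continuous_re).inter
      (isOpen_lt Complex.continuous_re continuous_const)
  have ho₃ : IsOpen {z : ℂ | -l - ε < z.re} := isOpen_lt continuous_const Complex.continuous_re
  refine ⟨g, DifferentiableOn.analyticOnNhd (fun z hz => ?_) ho₃, ?_, fun z hz => ?_⟩
  · refine DifferentiableAt.differentiableWithinAt ?_
    by_cases h : -l < z.re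
    · have hlin : DifferentiableOn ℂ (fun z : ℂ => (z + l) ^ m) {z | -l < z.re} := by fun_prop
      refine ((hlin.mul hZ).differentiableAt (ho₁.mem_nhds h)).congr_of_eventuallyEq ?_
      filter_upwards [ho₁.mem_nhds h] with y hy
      simp only [hg, if_pos (show -l < y.re from hy), Pi.mul_apply]
    · have hmem : z ∈ {z : ℂ | -l - ε < z.re ∧ z.re < -1 / 2} := ⟨hz, by linarith⟩
      refine (hΦ.differentiableAt (ho₂.mem_nhds hmem)).congr_of_eventuallyEq ?_
      filter_upwards [ho₂.mem_nhds hmem] with y hy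
      by_cases hy' : -l < y.re
      · simp only [hg, if_pos hy', hZΦ y hy' hy.2]
      · simp only [hg, if_neg hy']
  · simpa [hg] using h0
  · have h : -l < z.re := by linarith
    have hne : z + l ≠ 0 := fun h' => by
      have h2 := congrArg Complex.re h'
      simp only [Complex.add_re, Complex.ofReal_re, Complex.zero_re] at h2
      linarith
    simp only [hg, if_pos h]
    field_simp

theorem exists_analytic_continuation_aux {η l ε : ℝ} (hl : 1 / 2 < l) (hε : 0 < ε)
    (hlε : l + ε ≤ 1) (h₁ : l ≤ (1 + η) / 2) (h₂ : l ≤ 3 / 4) {m : ℕ} (hm : m ≠ 0)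
    {Z R N D : ℂ → ℂ}
    (hZ : DifferentiableOn ℂ Z {z | -((1 + η) / 2) < z.re ∧ -(3 / 4) < z.re})
    (hR : DifferentiableOn ℂ R {z | -1 < z.re ∧ z.re < -1 / 2})
    (hN : DifferentiableOn ℂ N {z | -1 < z.re ∧ z.re < -1 / 2})
    (hZR : ∀ z : ℂ, -((1 + η) / 2) < z.re → -(3 / 4) < z.re → z.re < -1 / 2 →
      Z z = R z + N z / ((2 * z + 1 + η) * (4 * z + 3)))
    (hN0 : ∀ t : ℝ, -((1 + η) / 2) ≤ t → -(3 / 4) ≤ t → t < -1 / 2 → N t ≠ 0)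
    (hD : Differentiable ℂ D) (hD0 : ∀ z : ℂ, -l - ε < z.re → D z ≠ 0)
    (hDeq : ∀ z : ℂ, (2 * z + 1 + η) * (4 * z + 3) = (z + l) ^ m * D z) :
    ∃ g : ℂ → ℂ, AnalyticOnNhd ℂ g {z | -l - ε < z.re} ∧ g (-(l : ℂ)) ≠ 0 ∧
      ∀ z : ℂ, 0 < z.re → Z z = g z / (z + l) ^ m := by
  have hsub : {z : ℂ | -l - ε < z.re ∧ z.re < -1 / 2} ⊆ {z | -1 < z.re ∧ z.re < -1 / 2} :=
    fun z hz => ⟨by linarith [hz.1], hz.2⟩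
  refine exists_analytic_pole_factor (Φ := fun z => (z + l) ^ m * R z + N z / D z) hl
    ?_ ?_ ?_ ?_
  · refine hZ.mono fun z hz => ?_
    simp only [mem_ofPred_eq] at hz ⊢
    constructor <;> linarith
  · have hlin : DifferentiableOn ℂ (fun z : ℂ => (z + l) ^ m)
        {z | -l - ε < z.re ∧ z.re < -1 / 2} := by fun_prop
    exact (hlin.mul (hR.mono hsub)).add
      ((hN.mono hsub).div hD.differentiableOn fun z hz => hD0 z hz.1)
  · intro z hz hz'
    have hne : z + l ≠ 0 := fun h' => by
      have h2 := congrArg Complex.re h'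
      simp only [Complex.add_re, Complex.ofReal_re, Complex.zero_re] at h2
      linarith
    have hDz := hD0 z (by linarith)
    rw [hZR z (by linarith) (by linarith) hz', hDeq]
    field_simp
  · have hNl := hN0 (-l) (by linarith) (by linarith) (by linarith)
    have hDl := hD0 (-l) (by simpa using hε)
    push_cast at hNl
    simpa [hm] using ⟨hNl, hDl⟩

theorem exists_analytic_continuation {η : ℝ} (hη : 0 < η) {l : ℝ}
    (hl : l = if η ≤ 1 / 2 then (1 + η) / 2 else 3 / 4) {m : ℕ}
    (hm : m = if η = 1 / 2 then 2 else 1) {Z R N : ℂ → ℂ}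
    (hZ : DifferentiableOn ℂ Z {z | -((1 + η) / 2) < z.re ∧ -(3 / 4) < z.re})
    (hR : DifferentiableOn ℂ R {z | -1 < z.re ∧ z.re < -1 / 2})
    (hN : DifferentiableOn ℂ N {z | -1 < z.re ∧ z.re < -1 / 2})
    (hZR : ∀ z : ℂ, -((1 + η) / 2) < z.re → -(3 / 4) < z.re → z.re < -1 / 2 →
      Z z = R z + N z / ((2 * z + 1 + η) * (4 * z + 3)))
    (hN0 : ∀ t : ℝ, -((1 + η) / 2) ≤ t → -(3 / 4) ≤ t → t < -1 / 2 → N t ≠ 0) :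
    ∃ ε > (0 : ℝ), ∃ g : ℂ → ℂ, AnalyticOnNhd ℂ g {z | -l - ε < z.re} ∧ g (-(l : ℂ)) ≠ 0 ∧
      ∀ z : ℂ, 0 < z.re → Z z = g z / (z + l) ^ m := by
  rcases lt_trichotomy η (1 / 2) with h | h | h
  · rw [if_pos h.le] at hl
    rw [if_neg h.ne] at hm
    subst hl hm
    refine ⟨3 / 4 - (1 + η) / 2, by linarith, exists_analytic_continuation_aux
      (D := fun z => 2 * (4 * z + 3)) (by linarith) (by linarith) (by linarith) le_rfl
      (by linarith) one_ne_zero hZ hR hN hZR hN0 (by fun_prop) (fun z hz h0 => ?_) fun z => ?_⟩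
    · have h2 := congrArg Complex.re h0
      simp at h2
      linarith
    · push_cast
      ring
  · rw [if_pos h.le] at hl
    rw [if_pos h] at hm
    subst hl hm h
    refine ⟨1 / 4, by norm_num, exists_analytic_continuation_aux
      (D := fun _ => 8) (by norm_num) (by norm_num) (by norm_num) le_rfl
      (by norm_num) two_ne_zero hZ hR hN hZR hN0 (by fun_prop) (fun z hz => by norm_num)
      fun z => ?_⟩
    push_cast
    ring
  · rw [if_neg h.not_ge] at hl
    rw [if_neg h.ne'] at hm
    subst hl hm
    refine ⟨min 1 ((1 + η) / 2) - 3 / 4, ?_, exists_analytic_continuation_aux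
      (D := fun z => 4 * (2 * z + 1 + η)) (by norm_num) ?_ ?_ (by linarith)
      le_rfl one_ne_zero hZ hR hN hZR hN0 (by fun_prop) (fun z hz h0 => ?_) fun z => ?_⟩
    · exact sub_pos.2 (lt_min (by norm_num) (by linarith))
    · exact sub_pos.2 (lt_min (by norm_num) (by linarith))
    · linarith [min_le_left 1 ((1 + η) / 2)]
    · have h2 := congrArg Complex.re h0
      simp at h2
      linarith [min_le_right 1 ((1 + η) / 2)]
    · push_cast
      ring

/-- with `λ_X = (1+η₁)/2` for `η₁ ≤ 1/2` and `3/4` otherwise, and `m_X = 2`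
iff `η₁ = 1/2` (else `1`), the zeta function of the two-component binomial mixture is
holomorphic on `{Re z > 0}` and admits a meromorphic continuation to `{Re z > −λ_X − ε}`
whose only pole there is at `z = −λ_X`, of order `m_X`. -/
theorem binomial_mixture_zeta_largest_pole
    (M : ℕ) (hM : 3 ≤ M) (bstar : ℝ) (hbstar : bstar ∈ Set.Ioo (0 : ℝ) 1)
    (η₁ : ℝ) (hη₁ : 0 < η₁)
    (ψ : ℝ × ℝ → ℝ)
    (hψ_pos : ∀ b ∈ Set.Icc (0 : ℝ) 1 ×ˢ Set.Icc (0 : ℝ) 1, 0 < ψ b)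
    (hψ_an : AnalyticOnNhd ℝ ψ (Set.Icc (0 : ℝ) 1 ×ˢ Set.Icc (0 : ℝ) 1))
    (lamX : ℝ) (hlamX : lamX = if η₁ ≤ 1 / 2 then (1 + η₁) / 2 else 3 / 4)
    (mX : ℕ) (hmX : mX = if η₁ = 1 / 2 then 2 else 1) :
    AnalyticOnNhd ℂ (binMixZeta M bstar η₁ ψ) {z : ℂ | 0 < z.re} ∧
    ∃ ε > (0 : ℝ), ∃ g : ℂ → ℂ,
      AnalyticOnNhd ℂ g {z : ℂ | -lamX - ε < z.re} ∧
      g (-(lamX : ℂ)) ≠ 0 ∧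
      ∀ z : ℂ, 0 < z.re →
        binMixZeta M bstar η₁ ψ z = g z / (z + (lamX : ℂ)) ^ mX := by
  have hM2 : 2 ≤ M := by omega
  have hΓ : 0 < Real.Gamma (2 * η₁) / Real.Gamma η₁ ^ 2 := by
    have := Real.Gamma_pos_of_pos hη₁
    have := Real.Gamma_pos_of_pos (show 0 < 2 * η₁ by positivity)
    positivity
  have hswap : ∀ b : ℝ × ℝ, b ∈ Icc (0 : ℝ) 1 ×ˢ Icc (0 : ℝ) 1 →
      b.swap ∈ Icc (0 : ℝ) 1 ×ˢ Icc (0 : ℝ) 1 := fun b hb => ⟨hb.2, hb.1⟩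
  obtain ⟨ψ₁, L₁, C₁, hL₁, hpos₁, hB₁, hψ₁⟩ := exists_lipschitzWith_extension
    (f := fun b => Real.Gamma (2 * η₁) / Real.Gamma η₁ ^ 2 * ψ b)
    (fun b hb => contDiffAt_const.mul (hψ_an b hb).contDiffAt)
    (fun b hb => mul_pos hΓ (hψ_pos b hb))
  obtain ⟨ψ₂, L₂, C₂, hL₂, hpos₂, hB₂, hψ₂⟩ := exists_lipschitzWith_extension
    (f := fun b => Real.Gamma (2 * η₁) / Real.Gamma η₁ ^ 2 * ψ b.swap)
    (fun b hb => contDiffAt_const.mul ((hψ_an _ (hswap b hb)).contDiffAt.comp b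
      (contDiff_snd.prodMk contDiff_fst).contDiffAt))
    (fun b hb => mul_pos hΓ (hψ_pos _ (hswap b hb)))
  have hLs : LipschitzWith (L₁ + L₂) fun b => ψ₁ b + ψ₂ b := hL₁.add hL₂
  have hBs : ∀ b, |ψ₁ b + ψ₂ b| ≤ C₁ + C₂ := fun b =>
    (abs_add_le _ _).trans (add_le_add (hB₁ b) (hB₂ b))
  have hpos : ∀ b, 0 < ψ₁ b + ψ₂ b := fun b => add_pos (hpos₁ b) (hpos₂ b)
  have hms := hLs.continuous.measurable
  set Z : ℂ → ℂ := fun z =>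
    ∫ w, zetaIntegrand M bstar η₁ (fun b => ψ₁ b + ψ₂ b) z w ∂mixMeasure bstar with hZdef
  have hzeta : ∀ z : ℂ, 0 < z.re → binMixZeta M bstar η₁ ψ z = Z z := fun z hz =>
    binMixZeta_eq_integral_zetaIntegrand hM2 hbstar hη₁ hψ₁ hψ₂ hL₁.continuous.measurable
      hL₂.continuous.measurable hB₁ hB₂ (by linarith) (by linarith)
  have hZ := differentiableOn_integral_zetaIntegrand hM2 hbstar hη₁ hms hBs
  have hR := differentiableOn_integral_sub hM2 hbstar hη₁ hBs hLs
  obtain ⟨N, hN, hNeq, hN0⟩ := exists_integral_modelIntegrand_eq hM2 hbstar hη₁ hpos hBs hLs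
  constructor
  · have hsub : {z : ℂ | 0 < z.re} ⊆ {z | -((1 + η₁) / 2) < z.re ∧ -(3 / 4) < z.re} := by
      intro z hz
      simp only [mem_ofPred_eq] at hz ⊢
      constructor <;> linarith
    exact ((hZ.mono hsub).congr hzeta).analyticOnNhd
      (isOpen_lt continuous_const Complex.continuous_re)
  · obtain ⟨ε, hε, g, hg, hg0, hgeq⟩ := exists_analytic_continuation hη₁ hlamX hmX hZ hR hN
      (fun z h₁ h₂ h₃ => by
        have hint := integrable_integrands hM2 hbstar hη₁ hms hBs h₁ h₂ h₃
        rw [← hNeq z h₁ h₂ h₃, integral_sub hint.1 hint.2, sub_add_cancel]) hN0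
    exact ⟨ε, hε, g, hg, hg0, fun z hz => (hzeta z hz).trans (hgeq z hz)⟩
end
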